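/- arXiv:1609.01705 — 9 statements merged into one kernel-verified Lean document; each statement's English description precedes it below -/
import Mathlib

section
/- For any real numbers C > 0 and δ > 0, the following holds for all ε > 4δ and all sufficiently large n ∈ ℕ. If G is a C-Ramsey graph on n vertices and ω : V(G) → {0, 1, …, ⌊n^{1+δ}⌋} is an injective weight function, then the set Ψ(G, ω) contains at least n^{3−ε} elements. -/
/-- The number of edges of the subgraph of `G` induced by the vertex set `S`. -/
noncomputable def inducedEdges {V : Type*} (G : SimpleGraph V) (S : Set V) : ℕ :=
  (G.induce S).edgeSet.ncard

/-- A graph `G` on `n` vertices is `C`-Ramsey if every clique or independent set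
has size at most `C * log₂ n`. -/
def IsCRamsey (C : ℝ) {V : Type*} [Fintype V] (G : SimpleGraph V) : Prop :=
  ∀ s : Finset V, (G.IsClique (s : Set V) ∨ Gᶜ.IsClique (s : Set V)) →
    (s.card : ℝ) ≤ C * Real.logb 2 (Fintype.card V)

/-- For a weighted graph `(G, ω)`, the set
`Ψ(G, ω) = {(v(H), e^ω(H)) : H an induced subgraph of G}`, where
`e^ω(H) = e(H) + ∑_{v ∈ V(H)} ω(v)`. -/
noncomputable def weightedPsi {V : Type*} [Fintype V] [DecidableEq V]
    (G : SimpleGraph V) (ω : V → ℕ) : Set (ℕ × ℕ) :=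
  {p | ∃ S : Finset V, p = (S.card, inducedEdges G (S : Set V) + ∑ v ∈ S, ω v)}


open Finset

/-- The weighted size of the subgraph induced by `S`. -/
noncomputable def weightedSize {V : Type*} (G : SimpleGraph V) (ω : V → ℕ) (S : Finset V) : ℕ :=
  inducedEdges G (S : Set V) + ∑ v ∈ S, ω v

open Classical in
/-- The number of neighbours of `u` in `T`. -/
noncomputable def degreeIn {V : Type*} (G : SimpleGraph V) (T : Finset V) (u : V) : ℕ :=
  #{w ∈ T | G.Adj u w}

open Classical in
theorem two_mul_inducedEdges {V : Type*} [Fintype V] (G : SimpleGraph V) (S : Finset V) :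
    2 * inducedEdges G (S : Set V) = ∑ x ∈ S, degreeIn G S x := by
  have h := (G.induce (S : Set V)).sum_degrees_eq_twice_card_edges
  rw [inducedEdges, ← SimpleGraph.coe_edgeFinset, Set.ncard_coe_finset, ← h,
    ← Finset.sum_coe_sort S]
  refine Finset.sum_congr rfl fun x _ => ?_
  rw [← SimpleGraph.card_neighborFinset_eq_degree, degreeIn,
    ← Finset.card_map (Function.Embedding.subtype (· ∈ (S : Set V)))]
  congr 1
  ext y
  simp [and_comm]

open Classical in
theorem inducedEdges_insert {V : Type*} [Fintype V] (G : SimpleGraph V) {T : Finset V} {u : V}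
    (hu : u ∉ T) :
    inducedEdges G ((insert u T : Finset V) : Set V) =
      inducedEdges G (T : Set V) + degreeIn G T u := by
  have h1 := two_mul_inducedEdges G (insert u T)
  have h2 := two_mul_inducedEdges G T
  have h3 : ∀ x, degreeIn G (insert u T) x = (if G.Adj x u then 1 else 0) + degreeIn G T x := by
    intro x
    simp only [degreeIn, Finset.card_filter, Finset.sum_insert hu]
  rw [Finset.sum_insert hu] at h1
  simp only [h3, Finset.sum_add_distrib, SimpleGraph.irrefl, if_false] at h1
  have h4 : ∑ x ∈ T, (if G.Adj x u then 1 else 0) = degreeIn G T u := by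
    simp only [degreeIn, Finset.card_filter, G.adj_comm u]
  omega

theorem weightedSize_insert {V : Type*} [Fintype V] [DecidableEq V] (G : SimpleGraph V)
    (ω : V → ℕ) {T : Finset V} {u : V} (hu : u ∉ T) :
    weightedSize G ω (insert u T) = weightedSize G ω T + (ω u + degreeIn G T u) := by
  have := inducedEdges_insert G hu
  simp only [weightedSize, Finset.sum_insert hu]
  convert congrArg (· + (ω u + ∑ v ∈ T, ω v)) this using 1
  · congr!
  · ring

theorem degreeIn_le_card {V : Type*} (G : SimpleGraph V) (T : Finset V) (u : V) :
    degreeIn G T u ≤ #T := by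
  classical exact Finset.card_filter_le _ _

/-- A weighted form of the ballot theorem, in the style of the LYM inequality. -/
theorem sum_ballot_le_one {α : Type*} [DecidableEq α] (s : α → ℤ) (m : ℕ) :
    ∀ (A : Finset α), #A = m → (∀ a ∈ A, s a ≤ 1) → ∀ t : ℤ, 0 < t →
    ∑ W ∈ A.powerset with ∑ x ∈ W, s x = t, (t : ℚ) / (#W * m.choose #W) ≤ 1 := by
  induction m with
  | zero =>
    intro A hA _ t ht
    rw [Finset.card_eq_zero] at hA
    subst hA
    simp [Finset.sum_filter]
  | succ m ih =>
    intro A hA hs t ht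
    let ψ : α → Finset α → ℚ := fun a W =>
      if W = ∅ then 1 else ((t - s a : ℤ) : ℚ) / (#W * m.choose #W)
    have key : ∀ W ∈ A.powerset.filter (fun W => ∑ x ∈ W, s x = t),
        (t : ℚ) / (#W * (m + 1).choose #W) = (1 / (m + 1 : ℚ)) * ∑ a ∈ W, ψ a (W.erase a) := by
      intro W hW
      rw [Finset.mem_filter, Finset.mem_powerset] at hW
      obtain ⟨hWA, hWt⟩ := hW
      have hWne : W.Nonempty := by
        rw [Finset.nonempty_iff_ne_empty]
        rintro rfl
        simp at hWt
        omega
      have hWc : #W ≤ m + 1 := hA ▸ Finset.card_le_card hWA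
      obtain ⟨w, hw⟩ : ∃ w, #W = w + 1 := ⟨#W - 1, by have := hWne.card_pos; omega⟩
      have hch : ((m + 1).choose (w + 1) : ℚ) * (w + 1) = (m + 1) * m.choose w := by
        exact_mod_cast (Nat.add_one_mul_choose_eq m w).symm
      have hpos : (0 : ℚ) < m.choose w := by
        exact_mod_cast Nat.choose_pos (by omega)
      rcases Nat.eq_zero_or_pos w with rfl | hw0
      · obtain ⟨a, rfl⟩ := Finset.card_eq_one.mp hw
        have h1 := hs a (hWA (Finset.mem_singleton_self a))
        simp only [Finset.sum_singleton] at hWt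
        have : t = 1 := by omega
        simp [ψ, this]
      · have : ∀ a ∈ W, ψ a (W.erase a) = ((t - s a : ℤ) : ℚ) / (w * m.choose w) := by
          intro a ha
          have hc : #(W.erase a) = w := by rw [Finset.card_erase_of_mem ha, hw]; rfl
          have hne : W.erase a ≠ ∅ := by
            rw [← Finset.nonempty_iff_ne_empty, ← Finset.card_pos]; omega
          simp only [ψ, if_neg hne, hc]
        rw [Finset.sum_congr rfl this, ← Finset.sum_div]
        have h2 : ∑ a ∈ W, ((t - s a : ℤ) : ℚ) = w * t := by
          rw [← Int.cast_sum, Finset.sum_sub_distrib, hWt]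
          simp [hw]
          ring
        rw [h2, hw]
        have hw0' : (0 : ℚ) < w := by exact_mod_cast hw0
        push_cast
        have h3 : (w + 1 : ℚ) * ((m + 1).choose (w + 1) : ℚ) = (m + 1) * m.choose w := by
          rw [← hch]; ring
        rw [h3]
        field_simp
    rw [Finset.sum_congr rfl key, ← Finset.mul_sum]
    have swap : ∑ W ∈ A.powerset with ∑ x ∈ W, s x = t, ∑ a ∈ W, ψ a (W.erase a) =
        ∑ a ∈ A, ∑ W ∈ (A.erase a).powerset with ∑ x ∈ W, s x = t - s a, ψ a W := by
      rw [Finset.sum_sigma', Finset.sum_sigma']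
      refine Finset.sum_bij' (fun p _ => ⟨p.2, p.1.erase p.2⟩) (fun p _ => ⟨insert p.1 p.2, p.1⟩)
        ?_ ?_ ?_ ?_ ?_
      · rintro ⟨W, a⟩ h
        simp only [Finset.mem_sigma, Finset.mem_filter, Finset.mem_powerset] at h ⊢
        refine ⟨h.1.1 h.2, Finset.erase_subset_erase _ h.1.1, ?_⟩
        have := Finset.sum_erase_add W s h.2
        omega
      · rintro ⟨a, W⟩ h
        simp only [Finset.mem_sigma, Finset.mem_filter, Finset.mem_powerset] at h ⊢
        have ha : a ∉ W := fun hh => by simpa using h.2.1 hh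
        refine ⟨⟨Finset.insert_subset h.1 (h.2.1.trans (Finset.erase_subset _ _)), ?_⟩,
          Finset.mem_insert_self _ _⟩
        rw [Finset.sum_insert ha]
        omega
      · rintro ⟨W, a⟩ h
        simp only [Finset.mem_sigma] at h
        simp [Finset.insert_erase h.2]
      · rintro ⟨a, W⟩ h
        simp only [Finset.mem_sigma, Finset.mem_filter, Finset.mem_powerset] at h
        have ha : a ∉ W := fun hh => by simpa using h.2.1 hh
        simp [Finset.erase_insert ha]
      · rintro ⟨W, a⟩ h
        rfl
    rw [swap]
    have bound : ∀ a ∈ A,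
        ∑ W ∈ (A.erase a).powerset with ∑ x ∈ W, s x = t - s a, ψ a W ≤ 1 := by
      intro a ha
      have h1 := hs a ha
      by_cases hta : t = s a
      · calc _ ≤ ∑ W ∈ {(∅ : Finset α)}, (1 : ℚ) := by
              rw [Finset.sum_filter]
              rw [Finset.sum_eq_single_of_mem ∅ (by simp)]
              · simp [ψ, hta]
              · intro W _ hW
                simp [ψ, hW, hta]
          _ = 1 := by simp
      · refine le_trans (le_of_eq ?_) (ih (A.erase a) (by rw [Finset.card_erase_of_mem ha, hA]; rfl)
          (fun x hx => hs x (Finset.mem_of_mem_erase hx)) (t - s a) (by omega))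
        refine Finset.sum_congr rfl fun W hW => ?_
        have hne : W ≠ ∅ := by
          rintro rfl
          simp at hW
          omega
        simp only [ψ, if_neg hne]
    calc _ ≤ (1 / (m + 1 : ℚ)) * ∑ a ∈ A, (1 : ℚ) := by
          gcongr with a ha
          exact bound a ha
      _ = 1 := by
          simp [hA]
          field_simp

/-- The first `i` elements of a numbering. -/
def numberingPrefix {α : Type*} [Fintype α] (f : Numbering α) (i : ℕ) : Finset α :=
  {x | (f x : ℕ) < i}

theorem card_numberingPrefix {α : Type*} [Fintype α] (f : Numbering α) {i : ℕ}
    (hi : i ≤ Fintype.card α) : #(numberingPrefix f i) = i := by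
  have h : (numberingPrefix f i).map f.toEmbedding =
      ({y : Fin (Fintype.card α) | (y : ℕ) < i} : Finset _) := by
    ext y
    simp only [numberingPrefix, Finset.mem_map, Finset.mem_filter, Finset.mem_univ, true_and]
    constructor
    · rintro ⟨x, hx, rfl⟩
      exact hx
    · intro hy
      exact ⟨f.symm y, by simpa using hy, by simp⟩
  rw [← Finset.card_map f.toEmbedding, h, Fin.card_filter_val_lt]
  omega

theorem exists_numberingPrefix_succ {α : Type*} [Fintype α] [DecidableEq α] (f : Numbering α)
    {i : ℕ} (hi : i < Fintype.card α) :
    ∃ a, a ∉ numberingPrefix f i ∧ numberingPrefix f (i + 1) = insert a (numberingPrefix f i) := by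
  refine ⟨f.symm ⟨i, hi⟩, by simp [numberingPrefix], ?_⟩
  ext x
  simp only [numberingPrefix, Finset.mem_filter, Finset.mem_univ, true_and, Finset.mem_insert,
    Equiv.eq_symm_apply, Fin.ext_iff]
  omega

theorem sum_card_visits_le_of_pos {α : Type*} [Fintype α] [DecidableEq α] (s : α → ℤ)
    (hs : ∀ a, s a ≤ 1) {t : ℤ} (ht : 0 < t) :
    (t : ℚ) * ∑ f : Numbering α,
      (#{i ∈ range (Fintype.card α + 1) | ∑ x ∈ numberingPrefix f i, s x = t} : ℚ) ≤
      Fintype.card α * (Fintype.card α).factorial := by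
  set m := Fintype.card α with hm
  have h1 : ∀ f : Numbering α,
      #{i ∈ range (m + 1) | ∑ x ∈ numberingPrefix f i, s x = t} ≤
      #{W : Finset α | ∑ x ∈ W, s x = t ∧ f.IsPrefix W} := by
    intro f
    refine Finset.card_le_card_of_injOn (numberingPrefix f) ?_ ?_
    · intro i hi
      simp only [Finset.coe_filter, Finset.mem_range, Set.mem_ofPred_eq, Finset.mem_univ,
        true_and] at hi ⊢
      refine ⟨hi.2, fun x => ?_⟩
      rw [card_numberingPrefix f (by omega)]
      simp [numberingPrefix]
    · intro i hi j hj hij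
      simp only [Finset.coe_filter, Finset.mem_range, Set.mem_ofPred_eq] at hi hj
      rw [← card_numberingPrefix f (i := i) (by omega), hij, card_numberingPrefix f (by omega)]
  have h2 : ∑ f : Numbering α, (#{W : Finset α | ∑ x ∈ W, s x = t ∧ f.IsPrefix W} : ℚ) =
      ∑ W ∈ (univ : Finset α).powerset with ∑ x ∈ W, s x = t, (#(Numbering.prefixed W) : ℚ) := by
    simp only [← Finset.filter_filter, Numbering.prefixed]
    simp only [Finset.card_filter _ (Finset.filter _ _), Finset.card_filter _ univ, Nat.cast_sum]
    rw [Finset.sum_comm]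
    simp
  have h3 := sum_ballot_le_one s m univ (by simp [hm]) (fun a _ => hs a) t ht
  have htq : (0 : ℚ) < t := by exact_mod_cast ht
  calc _ ≤ (t : ℚ) * ∑ f : Numbering α,
        (#{W : Finset α | ∑ x ∈ W, s x = t ∧ f.IsPrefix W} : ℚ) := by
        gcongr with f
        exact h1 f
    _ = ∑ W ∈ (univ : Finset α).powerset with ∑ x ∈ W, s x = t,
          (t : ℚ) * (#(Numbering.prefixed W) : ℚ) := by rw [h2, Finset.mul_sum]
    _ ≤ ∑ W ∈ (univ : Finset α).powerset with ∑ x ∈ W, s x = t,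
          (m * m.factorial : ℚ) * ((t : ℚ) / (#W * m.choose #W)) := by
        refine Finset.sum_le_sum fun W hW => ?_
        have hWm : #W ≤ m := Finset.card_le_univ W
        have hW0 : 0 < #W := by
          rw [Finset.card_pos, Finset.nonempty_iff_ne_empty]
          rintro rfl
          simp at hW
          omega
        have hch : (m.choose #W : ℚ) * ((#W).factorial * (m - #W).factorial) = m.factorial := by
          rw [← mul_assoc]
          exact_mod_cast Nat.choose_mul_factorial_mul_factorial hWm
        have hcpos : (0 : ℚ) < m.choose #W := by exact_mod_cast Nat.choose_pos hWm
        have hW0' : (0 : ℚ) < #W := by exact_mod_cast hW0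
        have hWm' : (#W : ℚ) ≤ m := by exact_mod_cast hWm
        rw [Numbering.card_prefixed, ← hm, Nat.cast_mul, ← hch, ← mul_div_assoc,
          le_div_iff₀ (by positivity)]
        have : (0 : ℚ) ≤ (t * ((#W).factorial * (m - #W).factorial)) * m.choose #W := by positivity
        nlinarith [mul_le_mul_of_nonneg_left hWm' this]
    _ ≤ m * m.factorial := by
        rw [← Finset.mul_sum]
        exact mul_le_of_le_one_right (by positivity) h3

/-- A random ordering of steps of size at most one makes few visits to any level far from `0`. -/
theorem sum_card_visits_le {α : Type*} [Fintype α] [DecidableEq α] (s : α → ℤ)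
    (hs : ∀ a, |s a| ≤ 1) {t : ℤ} (ht : t ≠ 0) :
    ∑ f : Numbering α,
      (#{i ∈ range (Fintype.card α + 1) | ∑ x ∈ numberingPrefix f i, s x = t} : ℚ) ≤
      Fintype.card α * (Fintype.card α).factorial / |(t : ℚ)| := by
  rw [le_div_iff₀ (by positivity), mul_comm]
  rcases lt_or_gt_of_ne ht with h | h
  · have := sum_card_visits_le_of_pos (fun a => - s a) (fun a => by have := abs_le.mp (hs a); omega)
      (t := -t) (by omega)
    simp only [Finset.sum_neg_distrib, neg_inj] at this
    rw [abs_of_neg (by exact_mod_cast h)]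
    exact_mod_cast this
  · rw [abs_of_pos (by exact_mod_cast h)]
    exact sum_card_visits_le_of_pos s (fun a => (abs_le.mp (hs a)).2) h

theorem sum_card_visits_pair_le_aux {α β : Type*} [Fintype α] [DecidableEq α] [Fintype β]
    {m : ℕ} (hα : Fintype.card α = m)
    (s : α → ℤ) (hs : ∀ a, |s a| ≤ 1) (r : β → ℤ) {t : ℤ} (ht : t ≠ 0) (h : Numbering β) :
    ∑ f : Numbering α, (#{p ∈ range (m + 1) ×ˢ range (m + 1) |
      ∑ x ∈ numberingPrefix f p.1, s x + ∑ x ∈ numberingPrefix h p.2, r x = t ∧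
      |t| ≤ 2 * |∑ x ∈ numberingPrefix f p.1, s x|} : ℚ) ≤
      (m + 1) * (2 * m * m.factorial / |(t : ℚ)|) := by
  simp only [Finset.card_filter, Finset.sum_product_right, Nat.cast_sum]
  rw [Finset.sum_comm]
  have : ∀ j ∈ range (m + 1), ∑ f : Numbering α, ∑ i ∈ range (m + 1),
      (((if ∑ x ∈ numberingPrefix f i, s x + ∑ x ∈ numberingPrefix h j, r x = t ∧
      |t| ≤ 2 * |∑ x ∈ numberingPrefix f i, s x| then 1 else 0 : ℕ)) : ℚ) ≤
      2 * m * m.factorial / |(t : ℚ)| := by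
    intro j _
    set u := t - ∑ x ∈ numberingPrefix h j, r x with hu
    by_cases hut : |t| ≤ 2 * |u|
    · have hu0 : u ≠ 0 := by
        rintro h0
        rw [h0] at hut
        simp at hut
        exact ht hut
      calc _ ≤ ∑ f : Numbering α,
            (#{i ∈ range (m + 1) | ∑ x ∈ numberingPrefix f i, s x = u} : ℚ) := by
            refine Finset.sum_le_sum fun f _ => ?_
            rw [Finset.card_filter, Nat.cast_sum]
            refine Finset.sum_le_sum fun i _ => ?_
            split_ifs with h1 h2
            · exact le_rfl
            · omega
            · simp
            · exact le_rfl
        _ ≤ m * m.factorial / |(u : ℚ)| := by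
            have := sum_card_visits_le s hs hu0
            simpa only [hα] using this
        _ ≤ 2 * m * m.factorial / |(t : ℚ)| := by
            have hut' : |(t : ℚ)| ≤ 2 * |(u : ℚ)| := by exact_mod_cast hut
            rw [div_le_div_iff₀ (by positivity) (by positivity)]
            have : (0 : ℚ) ≤ m * m.factorial := by positivity
            nlinarith [mul_le_mul_of_nonneg_left hut' this]
    · rw [Finset.sum_eq_zero]
      · positivity
      · intro f _
        refine Finset.sum_eq_zero fun i _ => ?_
        rw [if_neg]
        · simp
        · rintro ⟨h1, h2⟩
          apply hut
          have h3 : u = ∑ x ∈ numberingPrefix f i, s x := by omega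
          rwa [h3]
  refine (Finset.sum_le_sum this).trans ?_
  simp

/-- The sum of two independent walks, each in random order, equals a fixed nonzero `t` for few
pairs of times. -/
theorem sum_card_visits_pair_le {α β : Type*} [Fintype α] [DecidableEq α] [Fintype β]
    [DecidableEq β] {m : ℕ} (hα : Fintype.card α = m) (hβ : Fintype.card β = m)
    (s : α → ℤ) (hs : ∀ a, |s a| ≤ 1) (r : β → ℤ) (hr : ∀ b, |r b| ≤ 1) {t : ℤ} (ht : t ≠ 0) :
    ∑ q : Numbering α × Numbering β, (#{p ∈ range (m + 1) ×ˢ range (m + 1) |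
      ∑ x ∈ numberingPrefix q.1 p.1, s x + ∑ x ∈ numberingPrefix q.2 p.2, r x = t} : ℚ) ≤
      m.factorial ^ 2 * (4 * (m + 1) ^ 2 / |(t : ℚ)|) := by
  have hsplit : ∀ q : Numbering α × Numbering β, (#{p ∈ range (m + 1) ×ˢ range (m + 1) |
      ∑ x ∈ numberingPrefix q.1 p.1, s x + ∑ x ∈ numberingPrefix q.2 p.2, r x = t} : ℚ) ≤
      #{p ∈ range (m + 1) ×ˢ range (m + 1) |
        ∑ x ∈ numberingPrefix q.1 p.1, s x + ∑ x ∈ numberingPrefix q.2 p.2, r x = t ∧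
        |t| ≤ 2 * |∑ x ∈ numberingPrefix q.1 p.1, s x|} +
      #{p ∈ range (m + 1) ×ˢ range (m + 1) |
        ∑ x ∈ numberingPrefix q.2 p.1, r x + ∑ x ∈ numberingPrefix q.1 p.2, s x = t ∧
        |t| ≤ 2 * |∑ x ∈ numberingPrefix q.2 p.1, r x|} := by
    intro q
    rw [← Finset.card_map (Equiv.prodComm ℕ ℕ).toEmbedding (s := Finset.filter (fun p : ℕ × ℕ =>
        ∑ x ∈ numberingPrefix q.2 p.1, r x + ∑ x ∈ numberingPrefix q.1 p.2, s x = t ∧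
        |t| ≤ 2 * |∑ x ∈ numberingPrefix q.2 p.1, r x|) _)]
    norm_cast
    refine le_trans (Finset.card_le_card ?_) (Finset.card_union_le _ _)
    rintro ⟨i, j⟩ hp
    simp only [Finset.mem_filter, Finset.mem_product, Finset.mem_union, Finset.mem_map_equiv,
      Equiv.prodComm_symm, Equiv.prodComm_apply, Prod.swap_prod_mk] at hp ⊢
    have h1 := abs_add_le (∑ x ∈ numberingPrefix q.1 i, s x) (∑ x ∈ numberingPrefix q.2 j, r x)
    rw [hp.2] at h1
    rcases le_total (|∑ x ∈ numberingPrefix q.1 i, s x|) (|∑ x ∈ numberingPrefix q.2 j, r x|)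
      with h | h
    · right
      exact ⟨⟨hp.1.2, hp.1.1⟩, by rw [add_comm]; exact hp.2, by linarith⟩
    · left
      exact ⟨hp.1, hp.2, by linarith⟩
  refine (Finset.sum_le_sum fun q _ => hsplit q).trans ?_
  rw [Finset.sum_add_distrib]
  have hcα : (Fintype.card (Numbering α)) = m.factorial := by rw [Fintype.card_numbering, hα]
  have hcβ : (Fintype.card (Numbering β)) = m.factorial := by rw [Fintype.card_numbering, hβ]
  have hA := Finset.sum_le_sum (s := univ) fun (h : Numbering β) _ =>
    sum_card_visits_pair_le_aux hα s hs r ht h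
  have hB := Finset.sum_le_sum (s := univ) fun (f : Numbering α) _ =>
    sum_card_visits_pair_le_aux hβ r hr s ht f
  rw [Finset.sum_const, Finset.card_univ, hcβ, nsmul_eq_mul] at hA
  rw [Finset.sum_const, Finset.card_univ, hcα, nsmul_eq_mul] at hB
  rw [Fintype.sum_prod_type_right, Fintype.sum_prod_type]
  refine (add_le_add hA hB).trans ?_
  have ht' : (0 : ℚ) < |(t : ℚ)| := by positivity
  rw [← sub_nonneg]
  have : (m.factorial : ℚ) ^ 2 * (4 * (m + 1) ^ 2 / |(t : ℚ)|) -
      (m.factorial * ((m + 1) * (2 * m * m.factorial / |(t : ℚ)|)) +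
        m.factorial * ((m + 1) * (2 * m * m.factorial / |(t : ℚ)|))) =
      m.factorial ^ 2 * (4 * (m + 1)) / |(t : ℚ)| := by
    field_simp
    ring
  rw [this]
  positivity

theorem sq_card_le_card_image_mul_card_collisions {α β : Type*} [DecidableEq β] (s : Finset α)
    (f : α → β) : #s ^ 2 ≤ #(s.image f) * #{p ∈ s ×ˢ s | f p.1 = f p.2} := by
  have h1 : #s = ∑ b ∈ s.image f, #{a ∈ s | f a = b} :=
    Finset.card_eq_sum_card_fiberwise fun a ha => Finset.mem_image_of_mem f ha
  have h2 : #{p ∈ s ×ˢ s | f p.1 = f p.2} = ∑ b ∈ s.image f, #{a ∈ s | f a = b} ^ 2 := by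
    rw [Finset.card_eq_sum_card_fiberwise (f := fun p : α × α => f p.1) (t := s.image f)]
    · refine Finset.sum_congr rfl fun b _ => ?_
      rw [sq, ← Finset.card_product]
      congr 1
      ext ⟨x, y⟩
      simp only [Finset.mem_filter, Finset.mem_product]
      constructor
      · rintro ⟨⟨⟨hx, hy⟩, hxy⟩, hb⟩
        exact ⟨⟨hx, hb⟩, hy, hxy ▸ hb⟩
      · rintro ⟨⟨hx, hb⟩, hy, hb'⟩
        exact ⟨⟨⟨hx, hy⟩, hb.trans hb'.symm⟩, hb⟩
    · intro p hp
      simp only [Finset.coe_filter, Finset.mem_product, Set.mem_ofPred_eq] at hp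
      exact Finset.mem_image_of_mem f hp.1.1
  rw [h2]
  nth_rewrite 1 [h1]
  exact sq_sum_le_card_mul_sum_sq

theorem card_le_of_sub_mul_le {S : Finset ℕ} {q D : ℕ} (hq : 0 < q)
    (h : ∀ x ∈ S, ∀ y ∈ S, x ≤ y → (y - x) * q ≤ D) : #S ≤ D / q + 1 := by
  rcases S.eq_empty_or_nonempty with rfl | hS
  · simp
  · have hsub : S ⊆ Finset.Icc (S.min' hS) (S.min' hS + D / q) := by
      intro y hy
      have h1 := S.min'_le y hy
      have h2 := (Nat.le_div_iff_mul_le hq).mpr (h _ (S.min'_mem hS) y hy h1)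
      rw [Finset.mem_Icc]
      omega
    refine (Finset.card_le_card hsub).trans ?_
    rw [Nat.card_Icc]
    generalize D / q = e
    omega

/-- An increasing chain of subsets of `A`, one new element at a time. -/
structure IsChainIn {V : Type*} [DecidableEq V] (A : Finset V) (m : ℕ) (P : ℕ → Finset V) :
    Prop where
  subset : ∀ i, P i ⊆ A
  card_eq : ∀ i ≤ m, #(P i) = i
  succ : ∀ i < m, ∃ a ∈ A, a ∉ P i ∧ P (i + 1) = insert a (P i)

section Windows

variable {V : Type*} [DecidableEq V] {A B : Finset V} {m : ℕ} {P Q : ℕ → Finset V}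

theorem IsChainIn.card_union_le (hP : IsChainIn A m P) (hQ : IsChainIn B m Q)
    {i j : ℕ} (hi : i ≤ m) (hj : j ≤ m) : #(P i ∪ Q j) ≤ 2 * m := by
  have := Finset.card_union_le (P i) (Q j)
  rw [hP.card_eq i hi, hQ.card_eq j hj] at this
  omega

variable [Fintype V] {G : SimpleGraph V} {ω : V → ℕ} {q : ℕ}

theorem IsChainIn.weightedSize_add_le (hP : IsChainIn A m P) (hQ : IsChainIn B m Q)
    (hAB : Disjoint A B) (hgap : ∀ a ∈ A, ∀ b ∈ B, ω b + 2 * m + q ≤ ω a) {i j : ℕ} (hi : i < m)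
    (hj : j < m) :
    weightedSize G ω (P i ∪ Q (j + 1)) + q ≤ weightedSize G ω (P (i + 1) ∪ Q j) := by
  obtain ⟨a, haA, haP, ha⟩ := hP.succ i hi
  obtain ⟨b, hbB, hbQ, hb⟩ := hQ.succ j hj
  have haT : a ∉ P i ∪ Q j := by
    rw [Finset.mem_union, not_or]
    exact ⟨haP, fun h => Finset.disjoint_left.mp hAB haA (hQ.subset j h)⟩
  have hbT : b ∉ P i ∪ Q j := by
    rw [Finset.mem_union, not_or]
    exact ⟨fun h => Finset.disjoint_left.mp hAB (hP.subset i h) hbB, hbQ⟩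
  rw [ha, hb, Finset.union_insert, Finset.insert_union, weightedSize_insert G ω haT,
    weightedSize_insert G ω hbT]
  have h1 := degreeIn_le_card G (P i ∪ Q j) b
  have h2 := hP.card_union_le hQ hi.le hj.le
  have h3 := hgap a haA b hbB
  omega

theorem IsChainIn.weightedSize_add_mul_le (hP : IsChainIn A m P) (hQ : IsChainIn B m Q)
    (hAB : Disjoint A B) (hgap : ∀ a ∈ A, ∀ b ∈ B, ω b + 2 * m + q ≤ ω a) (j d : ℕ) :
    ∀ i, i + d ≤ m → j + d ≤ m →
    weightedSize G ω (P i ∪ Q (j + d)) + d * q ≤ weightedSize G ω (P (i + d) ∪ Q j) := by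
  induction d with
  | zero => intro i _ _; simp
  | succ d ih =>
    intro i hi hj
    have h1 := hP.weightedSize_add_le (G := G) hQ hAB hgap (i := i) (j := j + d) (by omega)
      (by omega)
    have h2 := ih (i + 1) (by omega) (by omega)
    rw [show i + 1 + d = i + (d + 1) by ring] at h2
    rw [← add_assoc j d 1, add_mul]
    omega

theorem IsChainIn.card_image_le (hP : IsChainIn A m P) (hQ : IsChainIn B m Q)
    (hAB : Disjoint A B) (hq : 0 < q) (hgap : ∀ a ∈ A, ∀ b ∈ B, ω b + 2 * m + q ≤ ω a)
    {U : Finset V} (hUA : Disjoint U A) (hUB : Disjoint U B) {M : ℕ} (hM : ∀ v, ω v ≤ M) :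
    #(((range (m + 1) ×ˢ range (m + 1)) ×ˢ U).image
      fun x => (x.1, ω x.2 + degreeIn G (P x.1.1 ∪ Q x.1.2) x.2)) ≤
    ((M + 2 * m) / q + 1) * (weightedPsi G ω).ncard := by
  set I := ((range (m + 1) ×ˢ range (m + 1)) ×ˢ U).image
      fun x => (x.1, ω x.2 + degreeIn G (P x.1.1 ∪ Q x.1.2) x.2) with hI
  have hIbound : ∀ z ∈ I, z.1.1 ≤ m ∧ z.1.2 ≤ m ∧ z.2 ≤ M + 2 * m := by
    intro z hz
    obtain ⟨⟨⟨i, j⟩, u⟩, hx, rfl⟩ := Finset.mem_image.mp hz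
    simp only [Finset.mem_product, Finset.mem_range] at hx
    have h1 := hM u
    have h2 := degreeIn_le_card G (P i ∪ Q j) u
    have h3 := hP.card_union_le hQ (i := i) (j := j) (by omega) (by omega)
    refine ⟨?_, ?_, ?_⟩ <;> dsimp only <;> omega
  let θ : (ℕ × ℕ) × ℕ → ℕ × ℕ :=
    fun z => (z.1.1 + z.1.2 + 1, weightedSize G ω (P z.1.1 ∪ Q z.1.2) + z.2)
  have hfin : (weightedPsi G ω).Finite := by
    refine (Set.finite_range fun S : Finset V =>
      (#S, inducedEdges G (S : Set V) + ∑ v ∈ S, ω v)).subset ?_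
    rintro p ⟨S, rfl⟩
    exact ⟨S, rfl⟩
  have himage : #(I.image θ) ≤ (weightedPsi G ω).ncard := by
    rw [← Set.ncard_coe_finset]
    refine Set.ncard_le_ncard ?_ hfin
    intro p hp
    obtain ⟨z, hz, rfl⟩ := Finset.mem_image.mp (Finset.mem_coe.mp hp)
    obtain ⟨⟨⟨i, j⟩, u⟩, hx, rfl⟩ := Finset.mem_image.mp hz
    simp only [Finset.mem_product, Finset.mem_range] at hx
    have huT : u ∉ P i ∪ Q j := by
      rw [Finset.mem_union, not_or]
      exact ⟨fun h => Finset.disjoint_left.mp hUA hx.2 (hP.subset i h),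
        fun h => Finset.disjoint_left.mp hUB hx.2 (hQ.subset j h)⟩
    refine ⟨insert u (P i ∪ Q j), Prod.ext ?_ ?_⟩
    · rw [Finset.card_insert_of_notMem huT, Finset.card_union_of_disjoint
        (Finset.disjoint_of_subset_left (hP.subset i)
          (Finset.disjoint_of_subset_right (hQ.subset j) hAB)), hP.card_eq i (by omega),
        hQ.card_eq j (by omega)]
    · exact (weightedSize_insert G ω huT).symm
  refine (Finset.card_le_mul_card_image I _ fun b _ => ?_).trans (Nat.mul_le_mul_left _ himage)
  have hinj : Set.InjOn (fun z : (ℕ × ℕ) × ℕ => z.1.1) ({z ∈ I | θ z = b} : Finset _) := by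
    rintro ⟨⟨i, j⟩, y⟩ h ⟨⟨i', j'⟩, y'⟩ h' hii'
    simp only [Finset.coe_filter, Set.mem_ofPred_eq] at h h' hii'
    subst hii'
    have h2 := h.2.trans h'.2.symm
    simp only [θ, Prod.mk.injEq] at h2
    obtain rfl : j = j' := by omega
    simp only [Prod.mk.injEq, true_and]
    omega
  rw [← Finset.card_image_of_injOn hinj]
  refine card_le_of_sub_mul_le hq ?_
  intro x hx x' hx' hxx'
  simp only [Finset.mem_image, Finset.mem_filter] at hx hx'
  obtain ⟨⟨⟨i, j⟩, y⟩, ⟨hz, hzb⟩, rfl⟩ := hx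
  obtain ⟨⟨⟨i', j'⟩, y'⟩, ⟨hz', hzb'⟩, rfl⟩ := hx'
  have h1 := hIbound _ hz
  have h1' := hIbound _ hz'
  have h2 := hzb.trans hzb'.symm
  simp only [θ, Prod.mk.injEq] at h1 h1' h2 hxx' ⊢
  have h3 := hP.weightedSize_add_mul_le (G := G) hQ hAB hgap j' (i' - i) i (by omega) (by omega)
  rw [show j' + (i' - i) = j by omega, show i + (i' - i) = i' by omega] at h3
  omega

end Windows

theorem sum_inv_le_harmonic {V : Type*} {S : Finset V} {g : V → ℕ} {M : ℕ}
    (hg : Set.InjOn g S) (hpos : ∀ v ∈ S, 0 < g v) (hM : ∀ v ∈ S, g v ≤ M) :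
    ∑ v ∈ S, (1 / (g v : ℚ)) ≤ harmonic M := by
  classical
  rw [harmonic_eq_sum_Icc]
  calc ∑ v ∈ S, (1 / (g v : ℚ)) = ∑ d ∈ S.image g, ((d : ℚ))⁻¹ := by
        rw [Finset.sum_image hg]
        simp
    _ ≤ _ := by
        refine Finset.sum_le_sum_of_subset_of_nonneg ?_ fun _ _ _ => by positivity
        intro d hd
        obtain ⟨v, hv, rfl⟩ := Finset.mem_image.mp hd
        exact Finset.mem_Icc.mpr ⟨hpos v hv, hM v hv⟩

theorem sum_inv_abs_sub_le {V : Type*} [DecidableEq V] {ω : V → ℕ} (hω : Function.Injective ω)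
    {M : ℕ} (hM : ∀ v, ω v ≤ M) (U : Finset V) (u : V) :
    ∑ v ∈ U.erase u, 1 / |(((ω v : ℤ) - ω u : ℤ) : ℚ)| ≤ 2 * harmonic M := by
  rw [← Finset.sum_filter_add_sum_filter_not _ (fun v => ω u < ω v), two_mul]
  have hne : ∀ v ∈ U.erase u, ω v ≠ ω u := fun v hv h => Finset.ne_of_mem_erase hv (hω h)
  refine add_le_add ?_ ?_
  · refine le_trans (le_of_eq (Finset.sum_congr rfl fun v hv => ?_))
      (sum_inv_le_harmonic (g := fun v => ω v - ω u) ?_ ?_ ?_)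
    · have := (Finset.mem_filter.mp hv).2
      push_cast [Nat.cast_sub this.le]
      rw [abs_of_pos]
      rw [sub_pos]
      exact_mod_cast this
    · intro v hv w hw h
      simp only [Finset.coe_filter, Set.mem_ofPred_eq] at hv hw h
      exact hω (by omega)
    · intro v hv
      have := (Finset.mem_filter.mp hv).2
      omega
    · intro v _
      have := hM v
      omega
  · refine le_trans (le_of_eq (Finset.sum_congr rfl fun v hv => ?_))
      (sum_inv_le_harmonic (g := fun v => ω u - ω v) ?_ ?_ ?_)
    · have h1 := (Finset.mem_filter.mp hv).2
      have h2 := hne v (Finset.mem_filter.mp hv).1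
      push_cast [Nat.cast_sub (not_lt.mp h1)]
      rw [abs_of_neg, neg_sub]
      rw [sub_neg]
      exact_mod_cast (show ω v < ω u by omega)
    · intro v hv w hw h
      simp only [Finset.coe_filter, Set.mem_ofPred_eq] at hv hw h
      exact hω (by omega)
    · intro v hv
      have h1 := (Finset.mem_filter.mp hv).2
      have h2 := hne v (Finset.mem_filter.mp hv).1
      omega
    · intro v _
      have := hM u
      omega

/-- The first `i` elements of a numbering of `A`, as a subset of the ambient type. -/
def prefixIn {V : Type*} {A : Finset V} (f : Numbering A) (i : ℕ) : Finset V :=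
  (numberingPrefix f i).map (Function.Embedding.subtype _)

theorem isChainIn_prefixIn {V : Type*} [DecidableEq V] {A : Finset V} {m : ℕ} (hA : #A = m)
    (f : Numbering A) : IsChainIn A m (prefixIn f) where
  subset i := by
    intro x hx
    obtain ⟨y, _, rfl⟩ := Finset.mem_map.mp hx
    exact y.2
  card_eq i hi := by
    rw [prefixIn, Finset.card_map, card_numberingPrefix]
    rwa [Fintype.card_coe, hA]
  succ i hi := by
    obtain ⟨a, ha, h⟩ := exists_numberingPrefix_succ f (i := i) (by rwa [Fintype.card_coe, hA])
    refine ⟨a, a.2, ?_, ?_⟩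
    · simpa [prefixIn] using ha
    · rw [prefixIn, h, Finset.map_insert]
      rfl

open Classical in
theorem degreeIn_prefixIn_union {V : Type*} [DecidableEq V] {A B : Finset V}
    (hAB : Disjoint A B) (G : SimpleGraph V) (f : Numbering A) (h : Numbering B) (i j : ℕ) (u : V) :
    (degreeIn G (prefixIn f i ∪ prefixIn h j) u : ℤ) =
      ∑ x ∈ numberingPrefix f i, (if G.Adj u x then 1 else 0) +
      ∑ x ∈ numberingPrefix h j, (if G.Adj u x then 1 else 0) := by
  have hd : Disjoint (prefixIn f i) (prefixIn h j) :=
    Finset.disjoint_of_subset_left ((isChainIn_prefixIn rfl f).subset i)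
      (Finset.disjoint_of_subset_right ((isChainIn_prefixIn rfl h).subset j) hAB)
  rw [degreeIn, Finset.card_filter, Finset.sum_union hd, prefixIn, prefixIn, Finset.sum_map,
    Finset.sum_map]
  push_cast
  rfl

open Classical in
theorem sum_card_collisions_le {V : Type*} [DecidableEq V] (G : SimpleGraph V) (ω : V → ℕ)
    {A B : Finset V} {m : ℕ} (hA : #A = m) (hB : #B = m) (hAB : Disjoint A B) {u v : V}
    (huv : ω u ≠ ω v) :
    ∑ q : Numbering A × Numbering B, (#{p ∈ range (m + 1) ×ˢ range (m + 1) |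
      ω u + degreeIn G (prefixIn q.1 p.1 ∪ prefixIn q.2 p.2) u =
        ω v + degreeIn G (prefixIn q.1 p.1 ∪ prefixIn q.2 p.2) v} : ℚ) ≤
      m.factorial ^ 2 * (4 * (m + 1) ^ 2 * (1 / |(((ω v : ℤ) - ω u : ℤ) : ℚ)|)) := by
  have ht : (ω v : ℤ) - ω u ≠ 0 := by omega
  have hstep : ∀ x : V, |((if G.Adj u x then 1 else 0) - (if G.Adj v x then 1 else 0) : ℤ)| ≤ 1 := by
    intro x
    split_ifs <;> simp
  have := sum_card_visits_pair_le (α := A) (β := B) (m := m) (by rw [Fintype.card_coe, hA])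
    (by rw [Fintype.card_coe, hB]) (fun x => (if G.Adj u x then 1 else 0) -
      (if G.Adj v x then 1 else 0)) (fun x => hstep x) (fun x => (if G.Adj u x then 1 else 0) -
      (if G.Adj v x then 1 else 0)) (fun x => hstep x) ht
  rw [mul_one_div]
  refine le_trans (le_of_eq (Finset.sum_congr rfl fun q _ => ?_)) this
  congr 2
  refine Finset.filter_congr fun p _ => ?_
  have h1 := degreeIn_prefixIn_union hAB G q.1 q.2 p.1 p.2 u
  have h2 := degreeIn_prefixIn_union hAB G q.1 q.2 p.1 p.2 v
  simp only [Finset.sum_sub_distrib]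
  omega

open Classical in
theorem exists_card_collisions_le {V : Type*} [DecidableEq V] (G : SimpleGraph V)
    {ω : V → ℕ} (hω : Function.Injective ω) {M : ℕ} (hM : ∀ v, ω v ≤ M)
    {A B : Finset V} {m : ℕ} (hA : #A = m) (hB : #B = m) (hAB : Disjoint A B) (U : Finset V) :
    ∃ q : Numbering A × Numbering B, (∑ u ∈ U, ∑ v ∈ U, (#{p ∈ range (m + 1) ×ˢ range (m + 1) |
      ω u + degreeIn G (prefixIn q.1 p.1 ∪ prefixIn q.2 p.2) u =
        ω v + degreeIn G (prefixIn q.1 p.1 ∪ prefixIn q.2 p.2) v} : ℚ)) ≤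
      (m + 1) ^ 2 * #U * (1 + 8 * harmonic M) := by
  have hcard : Fintype.card (Numbering A × Numbering B) = m.factorial ^ 2 := by
    rw [Fintype.card_prod, Fintype.card_numbering, Fintype.card_numbering, Fintype.card_coe,
      Fintype.card_coe, hA, hB, sq]
  have : Nonempty (Numbering A × Numbering B) := by
    rw [← Fintype.card_pos_iff, hcard]
    positivity
  suffices h : ∑ q : Numbering A × Numbering B, (∑ u ∈ U, ∑ v ∈ U,
      (#{p ∈ range (m + 1) ×ˢ range (m + 1) |
      ω u + degreeIn G (prefixIn q.1 p.1 ∪ prefixIn q.2 p.2) u =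
        ω v + degreeIn G (prefixIn q.1 p.1 ∪ prefixIn q.2 p.2) v} : ℚ)) ≤
      ∑ _q : Numbering A × Numbering B, ((m + 1) ^ 2 * #U * (1 + 8 * harmonic M) : ℚ) by
    obtain ⟨q, _, hq⟩ := Finset.exists_le_of_sum_le Finset.univ_nonempty h
    exact ⟨q, hq⟩
  rw [Finset.sum_comm, Finset.sum_const, Finset.card_univ, hcard, nsmul_eq_mul]
  calc _ ≤ ∑ u ∈ U, (m.factorial : ℚ) ^ 2 * ((m + 1) ^ 2 * (1 + 8 * harmonic M)) := by
        refine Finset.sum_le_sum fun u hu => ?_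
        rw [Finset.sum_comm, ← Finset.add_sum_erase U _ hu]
        have h1 : ∑ q : Numbering A × Numbering B, (#{p ∈ range (m + 1) ×ˢ range (m + 1) |
            ω u + degreeIn G (prefixIn q.1 p.1 ∪ prefixIn q.2 p.2) u =
            ω u + degreeIn G (prefixIn q.1 p.1 ∪ prefixIn q.2 p.2) u} : ℚ) =
            (m.factorial : ℚ) ^ 2 * (m + 1) ^ 2 := by
          simp only [Finset.filter_true, Finset.card_product, Finset.card_range, Finset.sum_const,
            Finset.card_univ, hcard, nsmul_eq_mul]
          push_cast
          ring
        have h2 := Finset.sum_le_sum fun v (hv : v ∈ U.erase u) =>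
          sum_card_collisions_le G ω hA hB hAB (u := u) (v := v)
            fun h => Finset.ne_of_mem_erase hv (hω h).symm
        rw [← Finset.mul_sum, ← Finset.mul_sum] at h2
        have h3 := sum_inv_abs_sub_le hω hM U u
        rw [h1]
        refine (add_le_add le_rfl h2).trans ?_
        calc _ ≤ (m.factorial : ℚ) ^ 2 * (m + 1) ^ 2 +
              m.factorial ^ 2 * (4 * (m + 1) ^ 2 * (2 * harmonic M)) := by gcongr
          _ = _ := by ring
    _ = _ := by
        rw [Finset.sum_const, nsmul_eq_mul]
        push_cast
        ring

/-- The pairs of order and weighted size are numerous as soon as there are two sets of vertices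
whose weights are well separated. -/
theorem card_le_mul_ncard_weightedPsi {V : Type*} [Fintype V] [DecidableEq V] (G : SimpleGraph V)
    {ω : V → ℕ} (hω : Function.Injective ω) {M : ℕ} (hM : ∀ v, ω v ≤ M)
    {A B U : Finset V} {m q : ℕ} (hA : #A = m) (hB : #B = m) (hAB : Disjoint A B)
    (hUA : Disjoint U A) (hUB : Disjoint U B) (hq : 0 < q)
    (hgap : ∀ a ∈ A, ∀ b ∈ B, ω b + 2 * m + q ≤ ω a) :
    ((m + 1) ^ 2 * #U : ℚ) ≤
      (1 + 8 * harmonic M) * (((M + 2 * m) / q + 1 : ℕ) * (weightedPsi G ω).ncard) := by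
  obtain ⟨⟨f, h⟩, hfh⟩ := exists_card_collisions_le G hω hM hA hB hAB U
  have hI := (isChainIn_prefixIn hA f).card_image_le (G := G) (isChainIn_prefixIn hB h) hAB hq hgap
    hUA hUB hM
  set D := (range (m + 1) ×ˢ range (m + 1)) ×ˢ U with hD
  set φ : (ℕ × ℕ) × V → (ℕ × ℕ) × ℕ :=
    fun x => (x.1, ω x.2 + degreeIn G (prefixIn f x.1.1 ∪ prefixIn h x.1.2) x.2) with hφ
  have hcs := sq_card_le_card_image_mul_card_collisions D φ
  have hDc : (#D : ℚ) = (m + 1) ^ 2 * #U := by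
    simp only [hD, Finset.card_product, Finset.card_range]
    push_cast
    ring
  have hcoll : (#{p ∈ D ×ˢ D | φ p.1 = φ p.2} : ℚ) ≤ #D * (1 + 8 * harmonic M) := by
    rw [hDc]
    refine le_trans (le_of_eq ?_) hfh
    norm_cast
    simp only [← Finset.card_sigma]
    refine Finset.card_bij' (fun z _ => ⟨z.1.2, z.2.2, z.1.1⟩)
      (fun z _ => ((z.2.2, z.1), (z.2.2, z.2.1))) ?_ ?_ ?_ ?_
    · rintro ⟨⟨p, u⟩, ⟨p', v⟩⟩ hz
      simp only [hD, hφ, Finset.mem_filter, Finset.mem_product, Prod.mk.injEq] at hz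
      obtain ⟨hz, rfl, hz'⟩ := hz
      simp only [Finset.mem_sigma, Finset.mem_filter, Finset.mem_product]
      exact ⟨hz.1.2, hz.2.2, hz.1.1, hz'⟩
    · rintro ⟨u, v, p⟩ hz
      simp only [Finset.mem_sigma, Finset.mem_filter, Finset.mem_product] at hz
      simp only [hD, hφ, Finset.mem_filter, Finset.mem_product, Prod.mk.injEq, true_and]
      exact ⟨⟨⟨hz.2.2.1, hz.1⟩, hz.2.2.1, hz.2.1⟩, hz.2.2.2⟩
    · rintro ⟨⟨p, u⟩, ⟨p', v⟩⟩ hz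
      simp only [hφ, Finset.mem_filter, Prod.mk.injEq] at hz
      simp [hz.2.1]
    · rintro ⟨u, v, p⟩ _
      rfl
  rw [← hDc]
  rcases Nat.eq_zero_or_pos #D with h0 | h0
  · rw [h0, Nat.cast_zero]
    have : (0 : ℚ) ≤ harmonic M := Finset.sum_nonneg fun _ _ => by positivity
    positivity
  · have h0' : (0 : ℚ) < #D := by exact_mod_cast h0
    have hcs' : (#D : ℚ) ^ 2 ≤ #(D.image φ) * #{p ∈ D ×ˢ D | φ p.1 = φ p.2} := by
      exact_mod_cast hcs
    have hI' : (#(D.image φ) : ℚ) ≤ ((M + 2 * m) / q + 1 : ℕ) * (weightedPsi G ω).ncard := by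
      exact_mod_cast hI
    have hH : (0 : ℚ) ≤ 1 + 8 * harmonic M := by
      have : (0 : ℚ) ≤ harmonic M := Finset.sum_nonneg fun _ _ => by positivity
      positivity
    have h1 : (#D : ℚ) * #D ≤ #D * ((1 + 8 * harmonic M) * #(D.image φ)) := by
      calc (#D : ℚ) * #D = #D ^ 2 := (sq _).symm
        _ ≤ _ := hcs'
        _ ≤ #(D.image φ) * (#D * (1 + 8 * harmonic M)) := by gcongr
        _ = _ := by ring
    exact (le_of_mul_le_mul_left h1 h0').trans (mul_le_mul_of_nonneg_left hI' hH)

theorem exists_separated_sets {n : ℕ} {ω : Fin n → ℕ} (hω : Function.Injective ω) {m : ℕ}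
    (hm : 2 * m ≤ n) :
    ∃ A B : Finset (Fin n), #A = m ∧ #B = m ∧ Disjoint A B ∧
      ∀ a ∈ A, ∀ b ∈ B, ω b + (n - 2 * m) ≤ ω a := by
  set e := Tuple.sort ω with he
  have hmono : StrictMono (ω ∘ e) :=
    (Tuple.monotone_sort ω).strictMono_of_injective (hω.comp e.injective)
  have hgap : ∀ d : ℕ, ∀ i j : Fin n, (j : ℕ) = i + d → ω (e i) + d ≤ ω (e j) := by
    intro d
    induction d with
    | zero =>
      intro i j h
      obtain rfl : i = j := Fin.ext (by omega)
      rfl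
    | succ d ih =>
      intro i j h
      have h1 := ih i ⟨i + d, by omega⟩ rfl
      have h2 : ω (e ⟨i + d, by omega⟩) < ω (e j) :=
        hmono (Fin.lt_def.mpr (show (i : ℕ) + d < j by omega))
      omega
  refine ⟨({i | n - m ≤ (i : ℕ)} : Finset (Fin n)).map e.toEmbedding,
    ({i | (i : ℕ) < m} : Finset (Fin n)).map e.toEmbedding, ?_, ?_, ?_, ?_⟩
  · rw [Finset.card_map]
    have h1 := Fin.card_filter_val_lt (n := n) (m := n - m)
    have h2 := Finset.card_filter_add_card_filter_not (s := (univ : Finset (Fin n)))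
      (fun i => (i : ℕ) < n - m)
    simp only [not_lt, Finset.card_univ, Fintype.card_fin] at h2
    omega
  · rw [Finset.card_map, Fin.card_filter_val_lt]
    omega
  · rw [Finset.disjoint_map, Finset.disjoint_left]
    intro i hi hi'
    simp only [Finset.mem_filter, Finset.mem_univ, true_and] at hi hi'
    omega
  · intro a ha b hb
    obtain ⟨i, hi, rfl⟩ := Finset.mem_map.mp ha
    obtain ⟨j, hj, rfl⟩ := Finset.mem_map.mp hb
    simp only [Finset.mem_filter, Finset.mem_univ, true_and] at hi hj
    have := hgap (i - j) j i (by omega)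
    simp only [Equiv.coe_toEmbedding]
    omega

theorem cube_le_mul_ncard_weightedPsi {δ : ℝ} (hδ : 0 < δ) {n : ℕ} (hn : 2 ≤ n)
    (G : SimpleGraph (Fin n)) {ω : Fin n → ℕ} (hω : Function.Injective ω)
    (hM : ∀ v, (ω v : ℝ) ≤ (n : ℝ) ^ (1 + δ)) :
    (n : ℝ) ^ 3 ≤ 700 * (9 + 8 * (1 + δ) * Real.log n) * (n : ℝ) ^ δ *
      (weightedPsi G ω).ncard := by
  set m := n / 8 with hm
  set q := n / 2 with hq
  set M := ⌊(n : ℝ) ^ (1 + δ)⌋₊ with hMdef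
  obtain ⟨A, B, hA, hB, hAB, hgap⟩ := exists_separated_sets hω (m := m) (by omega)
  have hn1 : (1 : ℝ) ≤ n := by exact_mod_cast (by omega : 1 ≤ n)
  have hnδ : (1 : ℝ) ≤ (n : ℝ) ^ δ := Real.one_le_rpow hn1 hδ.le
  have hpow : (n : ℝ) ^ (1 + δ) = n * (n : ℝ) ^ δ := by
    rw [Real.rpow_add (by linarith), Real.rpow_one]
  have hUcard : #(univ \ (A ∪ B)) = n - 2 * m := by
    rw [Finset.card_sdiff_of_subset (Finset.subset_univ _), Finset.card_union_of_disjoint hAB, hA,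
      hB, Finset.card_univ, Fintype.card_fin]
    omega
  have main := card_le_mul_ncard_weightedPsi G hω (M := M) (fun v => Nat.le_floor (hM v)) hA hB hAB
    (U := univ \ (A ∪ B))
    (Finset.disjoint_of_subset_right Finset.subset_union_left Finset.sdiff_disjoint)
    (Finset.disjoint_of_subset_right Finset.subset_union_right Finset.sdiff_disjoint)
    (q := q) (by omega) (fun a ha b hb => by have := hgap a ha b hb; omega)
  rw [hUcard] at main
  have main' : ((m + 1) ^ 2 * (n - 2 * m : ℕ) : ℝ) ≤
      (1 + 8 * (harmonic M : ℚ)) * (((M + 2 * m) / q + 1 : ℕ) * (weightedPsi G ω).ncard) := by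
    exact_mod_cast main
  have hM1 : 1 ≤ M := Nat.le_floor (by rw [hpow]; push_cast; nlinarith)
  have hMle : (M : ℝ) ≤ n * (n : ℝ) ^ δ := hpow ▸ Nat.floor_le (by positivity)
  have hlog : Real.log M ≤ (1 + δ) * Real.log n := by
    rw [← Real.log_rpow (by linarith), hpow]
    exact Real.log_le_log (by exact_mod_cast hM1) hMle
  have hharm : ((harmonic M : ℚ) : ℝ) ≤ 1 + (1 + δ) * Real.log n :=
    (harmonic_le_one_add_log M).trans (by linarith)
  have hwin : (((M + 2 * m) / q + 1 : ℕ) : ℝ) ≤ 7 * (n : ℝ) ^ δ := by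
    have h1 : (((M + 2 * m) / q : ℕ) : ℝ) ≤ ((M + 2 * m : ℕ) : ℝ) / q := Nat.cast_div_le
    have hq3 : (n : ℝ) / 3 ≤ q := by
      rw [div_le_iff₀ (by norm_num)]
      exact_mod_cast (by omega : n ≤ q * 3)
    have h2 : ((M + 2 * m : ℕ) : ℝ) / q ≤ 6 * (n : ℝ) ^ δ := by
      rw [div_le_iff₀ (by linarith)]
      have h3 : ((2 * m : ℕ) : ℝ) ≤ n := by exact_mod_cast (by omega : 2 * m ≤ n)
      rw [Nat.cast_add]
      nlinarith
    push_cast at h1 h2 ⊢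
    linarith
  have hlow : (n : ℝ) ^ 3 / 100 ≤ (m + 1) ^ 2 * (n - 2 * m : ℕ) := by
    have h1 : (n : ℝ) / 8 ≤ m + 1 := by
      rw [div_le_iff₀ (by norm_num)]
      exact_mod_cast (by omega : n ≤ (m + 1) * 8)
    have h2 : 3 * (n : ℝ) / 4 ≤ (n - 2 * m : ℕ) := by
      rw [div_le_iff₀ (by norm_num)]
      exact_mod_cast (by omega : 3 * n ≤ (n - 2 * m) * 4)
    calc (n : ℝ) ^ 3 / 100 ≤ (n / 8) ^ 2 * (3 * n / 4) := by
          have : (0 : ℝ) ≤ (n : ℝ) ^ 3 := by positivity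
          linarith [show ((n : ℝ) / 8) ^ 2 * (3 * n / 4) = 3 / 256 * (n : ℝ) ^ 3 by ring]
      _ ≤ _ := by gcongr
  have hlogn : 0 ≤ Real.log n := Real.log_nonneg hn1
  have hup : (1 + 8 * ((harmonic M : ℚ) : ℝ)) *
      (((M + 2 * m) / q + 1 : ℕ) * (weightedPsi G ω).ncard) ≤
      (9 + 8 * (1 + δ) * Real.log n) * (7 * (n : ℝ) ^ δ * (weightedPsi G ω).ncard) := by
    refine mul_le_mul (by linarith) (by gcongr) (by positivity) (by positivity)
  linarith

/-- Theorem 6 (second step): for any `C, δ > 0`, all `ε > 4δ` and all sufficiently large `n`,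
if `G` is a `C`-Ramsey graph on `n` vertices with an injective weight function
`ω : V(G) → {0, 1, …, ⌊n^{1+δ}⌋}`, then `|Ψ(G, ω)| ≥ n^{3-ε}`. -/
theorem ramsey_second_step (C δ : ℝ) (hC : 0 < C) (hδ : 0 < δ) :
    ∀ ε : ℝ, 4 * δ < ε → ∃ N : ℕ, ∀ n : ℕ, N ≤ n →
      ∀ G : SimpleGraph (Fin n), IsCRamsey C G →
        ∀ ω : Fin n → ℕ, Function.Injective ω →
          (∀ v : Fin n, (ω v : ℝ) ≤ (n : ℝ) ^ ((1 : ℝ) + δ)) →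
          (n : ℝ) ^ (3 - ε) ≤ ((weightedPsi G ω).ncard : ℝ) := by
  intro ε hε
  have hc : 0 < ε - δ := by linarith
  have hev : ∀ᶠ x : ℝ in Filter.atTop,
      700 * (9 + 8 * (1 + δ) * Real.log x) ≤ x ^ (ε - δ) := by
    have h1 := (isLittleO_log_rpow_atTop hc).bound
      (show (0 : ℝ) < 1 / (2 * (5600 * (1 + δ))) by positivity)
    have h2 := (tendsto_rpow_atTop hc).eventually_ge_atTop (2 * 6300)
    filter_upwards [h1, h2, Filter.eventually_ge_atTop 1] with x hx1 hx2 hx3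
    rw [Real.norm_of_nonneg (Real.log_nonneg hx3), Real.norm_of_nonneg (by positivity), one_div,
      inv_mul_eq_div, le_div_iff₀ (by positivity)] at hx1
    linarith
  obtain ⟨N, hN⟩ := Filter.eventually_atTop.mp
    ((tendsto_natCast_atTop_atTop (R := ℝ)).eventually hev)
  refine ⟨max N 2, fun n hn G _ ω hω hM => ?_⟩
  have hn2 : 2 ≤ n := (le_max_right _ _).trans hn
  have hn0 : (0 : ℝ) < n := by exact_mod_cast (by omega : 0 < n)
  have h1 := cube_le_mul_ncard_weightedPsi hδ hn2 G hω hM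
  have h2 := hN n ((le_max_left _ _).trans hn)
  have h3 : (n : ℝ) ^ 3 ≤ (n : ℝ) ^ ε * (weightedPsi G ω).ncard := by
    calc (n : ℝ) ^ 3 ≤ _ := h1
      _ ≤ (n : ℝ) ^ (ε - δ) * (n : ℝ) ^ δ * (weightedPsi G ω).ncard := by gcongr
      _ = _ := by rw [← Real.rpow_add hn0, sub_add_cancel]
  rw [Real.rpow_sub hn0, div_le_iff₀ (by positivity), mul_comm]
  exact_mod_cast h3
end

section
/- For any real numbers C > 0 and δ > 0, there exists a constant c > 0 such that the following holds for all sufficiently large n ∈ ℕ. If G is a C-Ramsey graph on n vertices, then there exist disjoint sets X, Y ⊆ V(G) with |X|, |Y| ≥ cn such that for every u ∈ Y, the inequality |Γ_X(u) △ Γ_X(v)| ≥ cn holds for all but at most n^δ vertices v ∈ Y. -/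
/-- Off-diagonal Ramsey bound in product form: the weights `a, b` with `1/a + 1/b = 1`
give `R(k + 1, l + 1) ≤ a ^ k * b ^ l`. -/
lemma card_add_one_le_of_isClique_le {V : Type*} (G : SimpleGraph V) {a b : ℝ}
    (ha : 0 < a) (hb : 0 < b) (hab : a⁻¹ + b⁻¹ = 1) (k l : ℕ) (W : Finset V)
    (hk : ∀ s ⊆ W, G.IsClique (s : Set V) → s.card ≤ k)
    (hl : ∀ s ⊆ W, Gᶜ.IsClique (s : Set V) → s.card ≤ l) :
    (W.card : ℝ) + 1 ≤ a ^ k * b ^ l := by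
  classical
  have ha1 : 1 ≤ a := by
    have : a⁻¹ ≤ 1 := by linarith [inv_pos.2 hb]
    exact (inv_le_one₀ ha).1 this
  have hb1 : 1 ≤ b := by
    have : b⁻¹ ≤ 1 := by linarith [inv_pos.2 ha]
    exact (inv_le_one₀ hb).1 this
  induction W using Finset.strongInduction generalizing k l with
  | H W ih =>
  rcases W.eq_empty_or_nonempty with rfl | ⟨v, hv⟩
  · simpa using one_le_mul_of_one_le_of_one_le (one_le_pow₀ ha1) (one_le_pow₀ hb1)
  have hk1 : 1 ≤ k := by simpa using hk {v} (by simpa using hv) (by simp)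
  have hl1 : 1 ≤ l := by simpa using hl {v} (by simpa using hv) (by simp)
  obtain ⟨k, rfl⟩ := Nat.exists_eq_add_of_le' hk1
  obtain ⟨l, rfl⟩ := Nat.exists_eq_add_of_le' hl1
  have key : ∀ (H : SimpleGraph V) (j : ℕ),
      (∀ s ⊆ W, H.IsClique (s : Set V) → s.card ≤ j + 1) →
      ∀ s ⊆ W.filter (H.Adj v), H.IsClique (s : Set V) → s.card ≤ j := by
    intro H j hj s hs hc
    have hvs : v ∉ s := fun h => by simpa using hs h
    have := hj (insert v s)
      (Finset.insert_subset hv (hs.trans (Finset.filter_subset _ _))) (by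
        rw [Finset.coe_insert, SimpleGraph.isClique_insert]
        exact ⟨hc, fun x hx _ => (Finset.mem_filter.1 (hs hx)).2⟩)
    rw [Finset.card_insert_of_notMem hvs] at this
    omega
  have hN := ih (W.filter (G.Adj v))
    (Finset.filter_ssubset.2 ⟨v, hv, by simp⟩) k (l + 1) (key G k hk)
    (fun s hs => hl s (hs.trans (Finset.filter_subset _ _)))
  have hM := ih (W.filter (Gᶜ.Adj v))
    (Finset.filter_ssubset.2 ⟨v, hv, by simp⟩) (k + 1) l
    (fun s hs => hk s (hs.trans (Finset.filter_subset _ _))) (by convert key Gᶜ l hl)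
  have hcard : W.card ≤ 1 + (W.filter (G.Adj v)).card + (W.filter (Gᶜ.Adj v)).card := by
    have hsub : W ⊆ {v} ∪ W.filter (G.Adj v) ∪ W.filter (Gᶜ.Adj v) := by
      intro x hx
      by_cases hxv : x = v
      · simp [hxv]
      · by_cases hadj : G.Adj v x <;>
          simp [hx, hadj, SimpleGraph.compl_adj, Ne.symm hxv]
    refine (Finset.card_le_card hsub).trans ((Finset.card_union_le _ _).trans ?_)
    gcongr
    exact (Finset.card_union_le _ _).trans (by simp)
  have hcard' : (W.card : ℝ) ≤
      1 + (W.filter (G.Adj v)).card + (W.filter (Gᶜ.Adj v)).card := by exact_mod_cast hcard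
  have hsplit : a ^ (k + 1) * b ^ (l + 1) = a ^ k * b ^ (l + 1) + a ^ (k + 1) * b ^ l := by
    have h1 : a + b = a * b := by
      field_simp at hab
      linarith
    rw [pow_succ, pow_succ]
    linear_combination (-(a ^ k * b ^ l)) * h1
  linarith

/-- Markov's inequality for finite sums. -/
lemma card_filter_lt_mul_le_sum {ι : Type*} (s : Finset ι) (f : ι → ℕ) (t : ℝ)
    [DecidablePred fun i => t < (f i : ℝ)] :
    ((s.filter fun i => t < (f i : ℝ)).card : ℝ) * t ≤ ∑ i ∈ s, (f i : ℝ) := by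
  calc ((s.filter fun i => t < (f i : ℝ)).card : ℝ) * t
      = ∑ i ∈ s.filter (fun i => t < (f i : ℝ)), t := by simp
    _ ≤ ∑ i ∈ s.filter (fun i => t < (f i : ℝ)), (f i : ℝ) :=
        Finset.sum_le_sum fun i hi => (Finset.mem_filter.1 hi).2.le
    _ ≤ ∑ i ∈ s, (f i : ℝ) :=
        Finset.sum_le_sum_of_subset_of_nonneg (Finset.filter_subset _ _) fun _ _ _ => by positivity

lemma card_powerset_filter_card_le {V : Type*} (I : Finset V) {θ : ℝ} (hθ : 0 < θ) (D s : ℕ)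
    (hI : I.card ≤ D) :
    ((I.powerset.filter fun J => J.card ≤ s).card : ℝ) ≤ (1 + θ) ^ D * (1 + θ⁻¹) ^ s := by
  have hinv : 0 < θ⁻¹ := inv_pos.2 hθ
  calc ((I.powerset.filter fun J => J.card ≤ s).card : ℝ)
      = ∑ J ∈ I.powerset.filter (fun J => J.card ≤ s), (1 : ℝ) := by simp
    _ ≤ ∑ J ∈ I.powerset.filter (fun J => J.card ≤ s), θ ^ J.card * (1 + θ⁻¹) ^ s := by
        refine Finset.sum_le_sum fun J hJ => ?_
        have hJs : J.card ≤ s := (Finset.mem_filter.1 hJ).2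
        calc (1 : ℝ) ≤ (1 + θ) ^ J.card := one_le_pow₀ (by linarith)
          _ = θ ^ J.card * (1 + θ⁻¹) ^ J.card := by
              rw [← mul_pow, mul_add, mul_inv_cancel₀ hθ.ne', mul_one, add_comm]
          _ ≤ θ ^ J.card * (1 + θ⁻¹) ^ s := by
              gcongr
              linarith
    _ ≤ ∑ J ∈ I.powerset, θ ^ J.card * (1 + θ⁻¹) ^ s :=
        Finset.sum_le_sum_of_subset_of_nonneg (Finset.filter_subset _ _)
          fun _ _ _ => by positivity
    _ = (1 + θ) ^ I.card * (1 + θ⁻¹) ^ s := by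
        rw [← Finset.sum_mul]
        congr 1
        have := Finset.sum_pow_mul_eq_add_pow θ 1 I
        simpa [add_comm] using this
    _ ≤ (1 + θ) ^ D * (1 + θ⁻¹) ^ s := by
        gcongr
        linarith

open Classical in
/-- Quantitative Erdős–Szemerédi theorem: a sparse vertex set in which all homogeneous sets
have size at most `D` is small. -/
lemma card_le_of_sparse {V : Type*} (G : SimpleGraph V) (T : Finset V)
    {η θ : ℝ} (hη : 0 < η) (hθ : 0 < θ) (D s : ℕ) (hs : 8 * η * D < s + 1)
    (hclique : ∀ S : Finset V, G.IsClique (S : Set V) → S.card ≤ D)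
    (hindep : ∀ S : Finset V, Gᶜ.IsClique (S : Set V) → S.card ≤ D)
    (hsparse : ∑ x ∈ T, ((T.filter (G.Adj x)).card : ℝ) ≤ η * (T.card : ℝ) ^ 2) :
    (T.card : ℝ) / 4 - D ≤ ((1 + θ) ^ D * (1 + θ⁻¹) ^ s) ^ 2 := by
  rcases T.eq_empty_or_nonempty with rfl | ⟨v₀, hv₀⟩
  · have : (0 : ℝ) ≤ D := by positivity
    have : (0 : ℝ) ≤ ((1 + θ) ^ D * (1 + θ⁻¹) ^ s) ^ 2 := by positivity
    simp only [Finset.card_empty, Nat.cast_zero]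
    linarith
  have hT : (0 : ℝ) < T.card := by exact_mod_cast Finset.card_pos.2 ⟨v₀, hv₀⟩
  have hD : (0 : ℝ) < D := by
    have : 1 ≤ D := by simpa using hclique {v₀} (by simp)
    exact_mod_cast this
  set high := T.filter fun x => 2 * η * T.card < ((T.filter (G.Adj x)).card : ℝ) with hhigh
  have hhighcard : (high.card : ℝ) ≤ T.card / 2 := by
    have h := (card_filter_lt_mul_le_sum T (fun x => (T.filter (G.Adj x)).card)
      (2 * η * T.card)).trans hsparse
    have : (high.card : ℝ) * (2 * η * T.card) ≤ T.card / 2 * (2 * η * T.card) := by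
      refine le_trans h (le_of_eq ?_)
      ring
    exact le_of_mul_le_mul_right this (by positivity)
  set L := T \ high with hL
  have hLT : L ⊆ T := Finset.sdiff_subset
  have hLdeg : ∀ x ∈ L, ((T.filter (G.Adj x)).card : ℝ) ≤ 2 * η * T.card := by
    intro x hx
    by_contra! hlt
    exact (Finset.mem_sdiff.1 hx).2 (Finset.mem_filter.2 ⟨hLT hx, hlt⟩)
  obtain ⟨I, hIL, hImax⟩ := Finset.exists_max_image
    (L.powerset.filter fun S : Finset V => Gᶜ.IsClique (S : Set V)) Finset.card ⟨∅, by simp⟩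
  obtain ⟨hIL, hIind⟩ := Finset.mem_filter.1 hIL
  rw [Finset.mem_powerset] at hIL
  have hID : I.card ≤ D := hindep I hIind
  set bad := T.filter fun v => 8 * η * D < ((I.filter (G.Adj v)).card : ℝ) with hbad
  have hbadcard : (bad.card : ℝ) ≤ T.card / 4 := by
    have h := card_filter_lt_mul_le_sum T (fun v => (I.filter (G.Adj v)).card) (8 * η * D)
    have hswap : ∑ v ∈ T, ((I.filter (G.Adj v)).card : ℝ)
        = ∑ u ∈ I, ((T.filter (G.Adj u)).card : ℝ) := by
      have := Finset.sum_card_bipartiteAbove_eq_sum_card_bipartiteBelow (s := T) (t := I) G.Adj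
      simp only [Finset.bipartiteAbove, Finset.bipartiteBelow] at this
      simp only [G.adj_comm _] at this ⊢
      exact_mod_cast this
    have hle : ∑ u ∈ I, ((T.filter (G.Adj u)).card : ℝ) ≤ D * (2 * η * T.card) := by
      calc _ ≤ ∑ u ∈ I, 2 * η * T.card := Finset.sum_le_sum fun u hu => hLdeg u (hIL hu)
        _ = I.card * (2 * η * T.card) := by simp
        _ ≤ _ := by gcongr
    have : (bad.card : ℝ) * (8 * η * D) ≤ T.card / 4 * (8 * η * D) := by
      refine (h.trans (hswap.trans_le hle)).trans (le_of_eq ?_)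
      ring
    exact le_of_mul_le_mul_right this (by positivity)
  set U := (L \ bad) \ I with hU
  have hUcard : (T.card : ℝ) / 4 - D ≤ U.card := by
    have h1 : T.card ≤ U.card + I.card + bad.card + high.card := by
      have e1 := Finset.le_card_sdiff I (L \ bad)
      have e2 := Finset.le_card_sdiff bad L
      have e3 := Finset.le_card_sdiff high T
      rw [← hU] at e1
      rw [← hL] at e3
      omega
    have h1' : (T.card : ℝ) ≤ U.card + I.card + bad.card + high.card := by exact_mod_cast h1
    have h2 : (I.card : ℝ) ≤ D := by exact_mod_cast hID
    linarith
  refine hUcard.trans ?_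
  have hUs : ∀ v ∈ U, (I.filter (G.Adj v)).card ≤ s := by
    intro v hv
    simp only [hU, Finset.mem_sdiff] at hv
    by_contra! hlt
    refine hv.1.2 (Finset.mem_filter.2 ⟨hLT hv.1.1, hs.trans_le ?_⟩)
    exact_mod_cast hlt
  have hfiber : ∀ J ∈ I.powerset.filter (fun J => J.card ≤ s),
      ((U.filter fun v => I.filter (G.Adj v) = J).card : ℝ)
        ≤ (1 + θ) ^ D * (1 + θ⁻¹) ^ s := by
    intro J hJ
    obtain ⟨hJI, hJs⟩ := Finset.mem_filter.1 hJ
    rw [Finset.mem_powerset] at hJI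
    have := card_add_one_le_of_isClique_le G (a := 1 + θ) (b := 1 + θ⁻¹) (by positivity)
      (by positivity) (by field_simp; ring) D s (U.filter fun v => I.filter (G.Adj v) = J)
      (fun S _ => hclique S) ?_
    · linarith
    intro S hS hSind
    have hSU : ∀ v ∈ S, v ∈ U ∧ I.filter (G.Adj v) = J := fun v hv => by
      simpa using hS hv
    have hdisj : Disjoint (I \ J) S := by
      rw [Finset.disjoint_left]
      intro x hx hxS
      exact (Finset.mem_sdiff.1 (hSU x hxS).1).2 (Finset.mem_sdiff.1 hx).1
    have hcross : ∀ x ∈ I \ J, ∀ y ∈ S, ¬ G.Adj x y := by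
      intro x hx y hy hadj
      obtain ⟨hxI, hxJ⟩ := Finset.mem_sdiff.1 hx
      exact hxJ ((hSU y hy).2 ▸ Finset.mem_filter.2 ⟨hxI, hadj.symm⟩)
    have hmem : (I \ J) ∪ S ∈ L.powerset.filter fun S : Finset V => Gᶜ.IsClique (S : Set V) := by
      refine Finset.mem_filter.2 ⟨Finset.mem_powerset.2 (Finset.union_subset
        (Finset.sdiff_subset.trans hIL) fun v hv => ?_), ?_⟩
      · have := (hSU v hv).1
        simp only [hU, Finset.mem_sdiff] at this
        exact this.1.1
      · intro x hx y hy hxy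
        simp only [Finset.coe_union, Set.mem_union, Finset.mem_coe] at hx hy
        rcases hx with hx | hx <;> rcases hy with hy | hy
        · exact hIind (Finset.sdiff_subset hx) (Finset.sdiff_subset hy) hxy
        · exact (SimpleGraph.compl_adj _ _ _).2 ⟨hxy, hcross x hx y hy⟩
        · exact (SimpleGraph.compl_adj _ _ _).2 ⟨hxy, fun h => hcross y hy x hx h.symm⟩
        · exact hSind hx hy hxy
    have hle := hImax _ hmem
    rw [Finset.card_union_of_disjoint hdisj, Finset.card_sdiff_of_subset hJI] at hle
    have := Finset.card_le_card hJI
    omega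
  have hsum : (U.card : ℝ) = ∑ J ∈ I.powerset.filter (fun J => J.card ≤ s),
      ((U.filter fun v => I.filter (G.Adj v) = J).card : ℝ) := by
    exact_mod_cast Finset.card_eq_sum_card_fiberwise fun v hv =>
      Finset.mem_filter.2 ⟨Finset.mem_powerset.2 (Finset.filter_subset _ _), hUs v hv⟩
  rw [hsum, sq]
  calc _ ≤ ∑ J ∈ I.powerset.filter (fun J => J.card ≤ s), (1 + θ) ^ D * (1 + θ⁻¹) ^ s :=
        Finset.sum_le_sum hfiber
    _ = ((I.powerset.filter fun J => J.card ≤ s).card : ℝ) *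
          ((1 + θ) ^ D * (1 + θ⁻¹) ^ s) := by simp
    _ ≤ _ := by
        gcongr
        exact card_powerset_filter_card_le I hθ D s hID

open Classical in
/-- Vertices with nearly equal neighbourhoods in `X` are seen in the same way by most of `X`. -/
lemma exists_large_consistent_subset {V : Type*} (G : SimpleGraph V) (X S : Finset V) (u : V)
    {ε d : ℝ} (hε : 0 < ε) (hS : S.Nonempty)
    (hclose : ∀ v ∈ S, ((X.filter fun x => ¬ (G.Adj u x ↔ G.Adj v x)).card : ℝ) ≤ d)
    (hd : 2 * d ≤ ε * X.card) :
    ∃ W ⊆ X, (X.card : ℝ) / 4 ≤ W.card ∧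
      ((∀ x ∈ W, ((S.filter (G.Adj x)).card : ℝ) ≤ ε * S.card) ∨
        (∀ x ∈ W, ((S.filter (Gᶜ.Adj x)).card : ℝ) ≤ ε * S.card)) := by
  have hS0 : (0 : ℝ) < S.card := by exact_mod_cast hS.card_pos
  set bad : V → ℕ := fun x => (S.filter fun v => ¬ (G.Adj u x ↔ G.Adj v x)).card with hbad
  set B := X.filter fun x => ε * S.card < (bad x : ℝ) with hB
  have hBcard : (B.card : ℝ) ≤ X.card / 2 := by
    have h := card_filter_lt_mul_le_sum X bad (ε * S.card)
    have hswap : ∑ x ∈ X, (bad x : ℝ)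
        = ∑ v ∈ S, ((X.filter fun x => ¬ (G.Adj u x ↔ G.Adj v x)).card : ℝ) := by
      have := Finset.sum_card_bipartiteAbove_eq_sum_card_bipartiteBelow (s := X) (t := S)
        fun x v => ¬ (G.Adj u x ↔ G.Adj v x)
      simp only [Finset.bipartiteAbove, Finset.bipartiteBelow] at this
      exact_mod_cast this
    have hle : ∑ v ∈ S, ((X.filter fun x => ¬ (G.Adj u x ↔ G.Adj v x)).card : ℝ)
        ≤ S.card * d := by
      simpa using Finset.sum_le_sum hclose
    have : (B.card : ℝ) * (ε * S.card) ≤ X.card / 2 * (ε * S.card) := by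
      refine (h.trans (hswap.trans_le hle)).trans ?_
      nlinarith
    exact le_of_mul_le_mul_right this (by positivity)
  have hgood : ∀ x ∈ X \ B, (bad x : ℝ) ≤ ε * S.card := by
    intro x hx
    by_contra! hlt
    exact (Finset.mem_sdiff.1 hx).2 (Finset.mem_filter.2 ⟨(Finset.mem_sdiff.1 hx).1, hlt⟩)
  have hcard : (X.card : ℝ) / 2 ≤
      ((X \ B).filter (G.Adj u)).card + ((X \ B).filter fun x => ¬ G.Adj u x).card := by
    have h1 := Finset.card_filter_add_card_filter_not (s := X \ B) (G.Adj u)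
    have h2 := Finset.le_card_sdiff B X
    have h3 : X.card ≤ B.card + (((X \ B).filter (G.Adj u)).card
      + ((X \ B).filter fun x => ¬ G.Adj u x).card) := by omega
    have h3' : (X.card : ℝ) ≤ B.card + (((X \ B).filter (G.Adj u)).card
      + ((X \ B).filter fun x => ¬ G.Adj u x).card) := by exact_mod_cast h3
    linarith
  by_cases hbig : (X.card : ℝ) / 4 ≤ ((X \ B).filter fun x => ¬ G.Adj u x).card
  · refine ⟨_, (Finset.filter_subset _ _).trans Finset.sdiff_subset, hbig, Or.inl ?_⟩
    intro x hx
    obtain ⟨hx, hux⟩ := Finset.mem_filter.1 hx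
    refine le_trans ?_ (hgood x hx)
    refine Nat.cast_le.2 (Finset.card_le_card (Finset.monotone_filter_right _ ?_))
    intro v _ hv hiff
    exact hux (hiff.2 hv.symm)
  · refine ⟨(X \ B).filter (G.Adj u), (Finset.filter_subset _ _).trans Finset.sdiff_subset,
      by linarith, Or.inr ?_⟩
    intro x hx
    obtain ⟨hx, hux⟩ := Finset.mem_filter.1 hx
    refine le_trans ?_ (hgood x hx)
    refine Nat.cast_le.2 (Finset.card_le_card (Finset.monotone_filter_right _ ?_))
    intro v _ hv hiff
    exact ((SimpleGraph.compl_adj _ _ _).1 hv).2 (hiff.1 hux).symm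

open Classical in
/-- Adding to `A` a set `S` to which `A` is sparsely joined. -/
lemma sum_degrees_union_le {V : Type*} (G : SimpleGraph V) (A S : Finset V) {ε : ℝ} {a m : ℕ}
    (hSm : S.card = m) (hAm : A.card = a * m) (hAS : Disjoint A S)
    (hjoin : ∀ x ∈ A, ((S.filter (G.Adj x)).card : ℝ) ≤ ε * m)
    (hA : ∑ x ∈ A, ((A.filter (G.Adj x)).card : ℝ) ≤ (a + ε * a ^ 2) * m ^ 2) (hε : 0 ≤ ε) :
    ∑ x ∈ A ∪ S, (((A ∪ S).filter (G.Adj x)).card : ℝ)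
      ≤ ((a + 1 : ℕ) + ε * (a + 1 : ℕ) ^ 2) * m ^ 2 := by
  have hsplit : ∀ x, (((A ∪ S).filter (G.Adj x)).card : ℝ)
      = (A.filter (G.Adj x)).card + (S.filter (G.Adj x)).card := by
    intro x
    rw [Finset.filter_union, Finset.card_union_of_disjoint
      (Finset.disjoint_filter_filter hAS)]
    push_cast
    rfl
  have hAS' : ∑ x ∈ A, ((S.filter (G.Adj x)).card : ℝ) ≤ a * m * (ε * m) := by
    refine (Finset.sum_le_sum hjoin).trans (le_of_eq ?_)
    simp [hAm]
  have hswap : ∑ x ∈ S, ((A.filter (G.Adj x)).card : ℝ)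
      = ∑ x ∈ A, ((S.filter (G.Adj x)).card : ℝ) := by
    have := Finset.sum_card_bipartiteAbove_eq_sum_card_bipartiteBelow (s := S) (t := A) G.Adj
    simp only [Finset.bipartiteAbove, Finset.bipartiteBelow] at this
    simp only [G.adj_comm _] at this ⊢
    exact_mod_cast this
  have hSS : ∑ x ∈ S, ((S.filter (G.Adj x)).card : ℝ) ≤ m * m := by
    calc _ ≤ ∑ x ∈ S, (m : ℝ) := by
          refine Finset.sum_le_sum fun x _ => ?_
          exact_mod_cast hSm ▸ Finset.card_filter_le S (G.Adj x)
      _ = m * m := by simp [hSm]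
  rw [Finset.sum_union hAS]
  simp only [hsplit, Finset.sum_add_distrib]
  rw [hswap]
  push_cast
  nlinarith [mul_nonneg hε (sq_nonneg (m : ℝ))]

open Classical in
/-- Iterating a step that extracts an `m`-set sparsely (or densely) joined to a large remaining
set produces a sparse set and a co-sparse set. -/
lemma exists_sparse_of_step {V : Type*} (G : SimpleGraph V) {ε w : ℝ} {m : ℕ} (hε : 0 ≤ ε)
    (hstep : ∀ W : Finset V, w ≤ W.card → ∃ S ⊆ W, ∃ W' ⊆ W, Disjoint W' S ∧ S.card = m ∧
      (W.card : ℝ) / 12 ≤ W'.card ∧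
      ((∀ x ∈ W', ((S.filter (G.Adj x)).card : ℝ) ≤ ε * m) ∨
        (∀ x ∈ W', ((S.filter (Gᶜ.Adj x)).card : ℝ) ≤ ε * m)))
    (hw : 0 ≤ w) (K : ℕ) (W : Finset V) (hW : w * 12 ^ K ≤ W.card) :
    ∃ A ⊆ W, ∃ B ⊆ W, ∃ a b : ℕ, a + b = K ∧ A.card = a * m ∧ B.card = b * m ∧
      ∑ x ∈ A, ((A.filter (G.Adj x)).card : ℝ) ≤ (a + ε * a ^ 2) * m ^ 2 ∧
      ∑ x ∈ B, ((B.filter (Gᶜ.Adj x)).card : ℝ) ≤ (b + ε * b ^ 2) * m ^ 2 := by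
  induction K generalizing W with
  | zero => exact ⟨∅, by simp, ∅, by simp, 0, 0, by simp⟩
  | succ K ih =>
    have hwW : w ≤ W.card :=
      (le_mul_of_one_le_right hw (one_le_pow₀ (by norm_num))).trans hW
    obtain ⟨S, hSW, W', hW'W, hdisj, hSm, hW', hjoin⟩ := hstep W hwW
    obtain ⟨A, hAW, B, hBW, a, b, hab, hAm, hBm, hA, hB⟩ := ih W' (by
      rw [pow_succ] at hW
      linarith)
    have hAS : Disjoint A S := hdisj.mono_left hAW
    have hBS : Disjoint B S := hdisj.mono_left hBW
    rcases hjoin with hjoin | hjoin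
    · refine ⟨A ∪ S, Finset.union_subset (hAW.trans hW'W) hSW, B, hBW.trans hW'W, a + 1, b,
        by omega, ?_, hBm, ?_, hB⟩
      · rw [Finset.card_union_of_disjoint hAS, hAm, hSm]
        ring
      · exact sum_degrees_union_le G A S hSm hAm hAS (fun x hx => hjoin x (hAW hx)) hA hε
    · refine ⟨A, hAW.trans hW'W, B ∪ S, Finset.union_subset (hBW.trans hW'W) hSW, a, b + 1,
        by omega, hAm, ?_, hA, ?_⟩
      · rw [Finset.card_union_of_disjoint hBS, hBm, hSm]
        ring
      · convert sum_degrees_union_le Gᶜ B S hSm hBm hBS (fun x hx => ?_) ?_ hε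
        · convert hjoin x (hBW hx)
        · convert hB

open Classical in
/-- If bipartite diversity fails, then every large vertex set contains a set of `m` vertices
sparsely or densely joined to a large disjoint subset. -/
lemma exists_step_of_not_diverse {V : Type*} [Fintype V] (G : SimpleGraph V) {ε d p : ℝ} {m : ℕ}
    (hε : 0 < ε) (hε1 : ε ≤ 1) (hp : 0 ≤ p) (hm : m = ⌊p⌋₊ + 1)
    (hfail : ∀ X Y : Set V, Disjoint X Y → d ≤ (X.ncard : ℝ) → d ≤ (Y.ncard : ℝ) →
      ∃ u ∈ Y, p < (({v ∈ Y | ((symmDiff (G.neighborSet u ∩ X)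
        (G.neighborSet v ∩ X)).ncard : ℝ) < d}).ncard : ℝ))
    (W : Finset V) (hW2 : 2 ≤ W.card) (hWd : 6 * d ≤ ε * W.card) :
    ∃ S ⊆ W, ∃ W' ⊆ W, Disjoint W' S ∧ S.card = m ∧ (W.card : ℝ) / 12 ≤ W'.card ∧
      ((∀ x ∈ W', ((S.filter (G.Adj x)).card : ℝ) ≤ ε * m) ∨
        (∀ x ∈ W', ((S.filter (Gᶜ.Adj x)).card : ℝ) ≤ ε * m)) := by
  obtain ⟨X, hXW, hXcard⟩ := Finset.exists_subset_card_eq (Nat.div_le_self W.card 2)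
  have hYcard := Finset.card_sdiff_of_subset hXW
  have hX3 : (W.card : ℝ) / 3 ≤ X.card := by
    have : W.card ≤ X.card * 3 := by omega
    have : (W.card : ℝ) ≤ X.card * 3 := by exact_mod_cast this
    linarith
  have hY3 : (W.card : ℝ) / 3 ≤ (W \ X).card := by
    have : W.card ≤ (W \ X).card * 3 := by omega
    have : (W.card : ℝ) ≤ (W \ X).card * 3 := by exact_mod_cast this
    linarith
  have hd3 : d ≤ (W.card : ℝ) / 3 := by nlinarith [Nat.cast_nonneg (α := ℝ) W.card]
  obtain ⟨u, -, hu⟩ := hfail X (W \ X : Finset V)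
    (Finset.disjoint_coe.2 Finset.disjoint_sdiff)
    (by rw [Set.ncard_coe_finset]; linarith) (by rw [Set.ncard_coe_finset]; linarith)
  have hsymm : ∀ v, symmDiff (G.neighborSet u ∩ X) (G.neighborSet v ∩ X)
      = ((X.filter fun x => ¬ (G.Adj u x ↔ G.Adj v x) : Finset V) : Set V) := by
    intro v
    ext x
    simp only [Set.mem_symmDiff, Set.mem_inter_iff, SimpleGraph.mem_neighborSet,
      Finset.mem_coe, Finset.mem_filter]
    tauto
  have hset : {v ∈ ((W \ X : Finset V) : Set V) | ((symmDiff (G.neighborSet u ∩ X)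
      (G.neighborSet v ∩ X)).ncard : ℝ) < d} = (((W \ X).filter fun v =>
        ((X.filter fun x => ¬ (G.Adj u x ↔ G.Adj v x)).card : ℝ) < d : Finset V) : Set V) := by
    ext v
    simp only [hsymm, Set.ncard_coe_finset, Set.mem_ofPred_eq, Finset.mem_coe, Finset.mem_filter]
  rw [hset, Set.ncard_coe_finset, ← Nat.floor_lt hp] at hu
  obtain ⟨S, hS, hSm⟩ := Finset.exists_subset_card_eq (hm.trans_le hu)
  have hSW : S ⊆ W \ X := hS.trans (Finset.filter_subset _ _)
  obtain ⟨W', hW'X, hW', hjoin⟩ := exists_large_consistent_subset G X S u (d := d) hε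
    (Finset.card_pos.1 (by omega)) (fun v hv => (Finset.mem_filter.1 (hS hv)).2.le) (by nlinarith)
  refine ⟨S, hSW.trans Finset.sdiff_subset, W', hW'X.trans hXW, ?_, hSm, by linarith, ?_⟩
  · exact Finset.disjoint_sdiff.mono hW'X hSW
  · simpa only [hSm] using hjoin

open Classical in
lemma card_le_exp_of_sparse {V : Type*} (G : SimpleGraph V) (T : Finset V) {θ x : ℝ}
    (hθ : 0 < θ) (D : ℕ) (hx : 18 * θ * D ≤ x)
    (hclique : ∀ S : Finset V, G.IsClique (S : Set V) → S.card ≤ D)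
    (hindep : ∀ S : Finset V, Gᶜ.IsClique (S : Set V) → S.card ≤ D)
    (hsparse : ∑ x ∈ T, ((T.filter (G.Adj x)).card : ℝ) ≤ θ ^ 2 * (T.card : ℝ) ^ 2) :
    (T.card : ℝ) / 4 - D ≤ Real.exp x := by
  have hs : (⌊8 * θ ^ 2 * D⌋₊ : ℝ) ≤ 8 * θ ^ 2 * D := Nat.floor_le (by positivity)
  refine (card_le_of_sparse G T (by positivity) hθ D ⌊8 * θ ^ 2 * D⌋₊ (Nat.lt_floor_add_one _)
    hclique hindep hsparse).trans ?_
  have h1 : 1 + θ ≤ Real.exp θ := by linarith [Real.add_one_le_exp θ]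
  have h2 : 1 + θ⁻¹ ≤ Real.exp θ⁻¹ := by linarith [Real.add_one_le_exp θ⁻¹]
  calc _ ≤ (Real.exp θ ^ D * Real.exp θ⁻¹ ^ ⌊8 * θ ^ 2 * D⌋₊) ^ 2 := by gcongr
    _ = Real.exp (2 * (D * θ + ⌊8 * θ ^ 2 * D⌋₊ * θ⁻¹)) := by
        rw [← Real.exp_nat_mul, ← Real.exp_nat_mul, ← Real.exp_add, ← Real.exp_nat_mul]
        norm_num
    _ ≤ Real.exp x := by
        refine Real.exp_le_exp.2 (le_trans ?_ hx)
        calc 2 * (D * θ + ⌊8 * θ ^ 2 * D⌋₊ * θ⁻¹)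
            ≤ 2 * (D * θ + 8 * θ ^ 2 * D * θ⁻¹) := by gcongr
          _ = 18 * θ * D := by
              field_simp
              ring

lemma eventually_log_add_rpow_lt (C δ : ℝ) (hδ : 0 < δ) :
    ∀ᶠ n : ℕ in Filter.atTop,
      C * Real.logb 2 n + (n : ℝ) ^ (δ / 2) < (n : ℝ) ^ δ / 4 := by
  have h1 : (fun x : ℝ => C * Real.logb 2 x) =o[Filter.atTop] fun x => x ^ δ := by
    have := (isLittleO_log_rpow_atTop hδ).const_mul_left (C / Real.log 2)
    refine this.congr_left fun x => ?_
    rw [Real.logb]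
    ring
  have h2 : (fun x : ℝ => x ^ (δ / 2)) =o[Filter.atTop] fun x => x ^ δ := by
    have hpos := Filter.eventually_gt_atTop (0 : ℝ)
    refine (Asymptotics.isLittleO_iff_tendsto' (hpos.mono fun x hx h =>
      absurd h (Real.rpow_pos_of_pos hx δ).ne')).2 ?_
    refine (tendsto_rpow_neg_atTop (half_pos hδ)).congr' (hpos.mono fun x hx => ?_)
    beta_reduce
    rw [← Real.rpow_sub hx]
    congr 1
    ring
  have h := ((h1.add h2).def (c := 1 / 8) (by norm_num)).and (Filter.eventually_gt_atTop 0)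
  refine (tendsto_natCast_atTop_atTop.eventually h).mono fun n hn => ?_
  have hpos := Real.rpow_pos_of_pos hn.2 δ
  have := (le_abs_self _).trans hn.1
  rw [Real.norm_of_nonneg hpos.le] at this
  linarith

/-- Lemma 7 (bipartite diversity): for any `C, δ > 0` there is `c > 0` such that for all
sufficiently large `n`, every `C`-Ramsey graph `G` on `n` vertices admits disjoint sets
`X, Y` with `|X|, |Y| ≥ cn` such that for every `u ∈ Y`, the inequality
`|Γ_X(u) △ Γ_X(v)| ≥ cn` holds for all but at most `n^δ` vertices `v ∈ Y`. -/
theorem ramsey_bipartite_diverse (C δ : ℝ) (hC : 0 < C) (hδ : 0 < δ) :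
    ∃ c : ℝ, 0 < c ∧ ∃ N : ℕ, ∀ n : ℕ, N ≤ n →
      ∀ G : SimpleGraph (Fin n), IsCRamsey C G →
        ∃ X Y : Set (Fin n), Disjoint X Y ∧
          c * n ≤ (X.ncard : ℝ) ∧ c * n ≤ (Y.ncard : ℝ) ∧
          ∀ u ∈ Y,
            (({v ∈ Y | ((symmDiff (G.neighborSet u ∩ X) (G.neighborSet v ∩ X)).ncard : ℝ)
                < c * n}).ncard : ℝ) ≤ (n : ℝ) ^ δ := by
  classical
  have hlog2 : 0 < Real.log 2 := Real.log_pos (by norm_num)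
  set θ : ℝ := δ * Real.log 2 / (36 * C) with hθdef
  have hθ : 0 < θ := by positivity
  set ε : ℝ := min 1 (θ ^ 2 / 2) with hεdef
  have hε : 0 < ε := by positivity
  have hε1 : ε ≤ 1 := min_le_left _ _
  have hε2 : ε ≤ θ ^ 2 / 2 := min_le_right _ _
  obtain ⟨k, hk⟩ := exists_nat_gt (2 / θ ^ 2)
  have hk0 : (0 : ℝ) < k := lt_trans (by positivity) hk
  have hkθ : 1 ≤ θ ^ 2 / 2 * k := by
    rw [div_lt_iff₀ (by positivity)] at hk
    linarith
  set c : ℝ := ε / (6 * 12 ^ (2 * k)) with hcdef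
  obtain ⟨N, hN⟩ := Filter.eventually_atTop.1 (eventually_log_add_rpow_lt C δ hδ)
  refine ⟨c, by positivity, max N (2 * 12 ^ (2 * k)), fun n hn G hG => ?_⟩
  have hnN := hN n ((le_max_left _ _).trans hn)
  have hnK : 2 * 12 ^ (2 * k) ≤ n := (le_max_right _ _).trans hn
  have hn0 : 0 < n := lt_of_lt_of_le (by positivity) hnK
  have hn0' : (0 : ℝ) < n := by exact_mod_cast hn0
  by_contra! hfail
  set m := ⌊(n : ℝ) ^ δ⌋₊ + 1 with hm
  have hmn : (n : ℝ) ^ δ ≤ m := by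
    rw [hm]
    push_cast
    exact (Nat.lt_floor_add_one _).le
  set D := ⌊C * Real.logb 2 n⌋₊ with hD
  have hlogn : 0 ≤ C * Real.logb 2 n :=
    mul_nonneg hC.le (Real.logb_nonneg (by norm_num) (by exact_mod_cast hn0))
  have hDn : (D : ℝ) ≤ C * Real.logb 2 n := Nat.floor_le hlogn
  have hhom : ∀ S : Finset (Fin n), (G.IsClique (S : Set (Fin n)) ∨
      Gᶜ.IsClique (S : Set (Fin n))) → S.card ≤ D := by
    intro S hS
    have := hG S hS
    rw [Fintype.card_fin] at this
    exact Nat.le_floor this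
  have hnosparse : ∀ (H : SimpleGraph (Fin n)) (A : Finset (Fin n)) (a : ℕ),
      (∀ S : Finset (Fin n), H.IsClique (S : Set (Fin n)) → S.card ≤ D) →
      (∀ S : Finset (Fin n), Hᶜ.IsClique (S : Set (Fin n)) → S.card ≤ D) →
      k ≤ a → A.card = a * m →
      ¬ ∑ x ∈ A, ((A.filter (H.Adj x)).card : ℝ) ≤ (a + ε * a ^ 2) * m ^ 2 := by
    intro H A a hcl hind hka hA hsum
    have hka' : (k : ℝ) ≤ a := by exact_mod_cast hka
    have ha1 : (1 : ℝ) ≤ a := by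
      have : 0 < k := by exact_mod_cast hk0
      exact_mod_cast this.trans_le hka
    have hA' : (A.card : ℝ) = a * m := by exact_mod_cast hA
    have hbound := card_le_exp_of_sparse H A (x := Real.log n * (δ / 2)) hθ D ?_ hcl hind ?_
    · rw [← Real.rpow_def_of_pos hn0'] at hbound
      have : (m : ℝ) ≤ A.card := by
        rw [hA']
        exact le_mul_of_one_le_left (by positivity) ha1
      linarith
    · calc 18 * θ * D ≤ 18 * θ * (C * Real.logb 2 n) := by gcongr
        _ = Real.log n * (δ / 2) := by
            rw [hθdef, Real.logb]
            field_simp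
            ring
    · refine hsum.trans ?_
      rw [hA', mul_pow, ← mul_assoc]
      gcongr
      have h1 : 1 ≤ θ ^ 2 / 2 * a := hkθ.trans (by gcongr)
      nlinarith [sq_nonneg (a : ℝ)]
  have hcn : c * n * 6 * 12 ^ (2 * k) = ε * n := by
    rw [hcdef]
    field_simp
  have hstep := exists_step_of_not_diverse G (d := c * n) (m := m) hε hε1 (by positivity) hm hfail
  obtain ⟨A, -, B, -, a, b, hab, hA, hB, hAsum, hBsum⟩ :=
    exists_sparse_of_step G (w := max 2 (6 * (c * n) / ε)) (m := m) hε.le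
      (fun W hW => hstep W (by exact_mod_cast (le_max_left _ _).trans hW) (by
        have := (le_max_right _ _).trans hW
        rw [div_le_iff₀ hε] at this
        linarith))
      (by positivity) (2 * k) Finset.univ (by
        rw [Finset.card_univ, Fintype.card_fin, max_mul_of_nonneg _ _ (by positivity)]
        refine max_le (by exact_mod_cast hnK) (le_of_eq ?_)
        rw [div_mul_eq_mul_div, div_eq_iff hε.ne']
        linarith)
  rcases le_or_gt k a with hka | hka
  · refine hnosparse G A a (fun S hS => hhom S (Or.inl hS)) (fun S hS => hhom S (Or.inr hS))
      hka hA ?_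
    convert hAsum
  · refine hnosparse Gᶜ B b (fun S hS => hhom S (Or.inr hS))
      (fun S hS => hhom S (Or.inl (by simpa using hS))) (by omega) hB ?_
    convert hBsum
end

section
/- For any real number δ > 0, there exists a constant c > 0 such that the following holds for all n ∈ ℕ. Let A and B be disjoint subsets of {1, 2, …, n} such that δn ≤ |A| ≤ (1−δ)n, and let k be an integer satisfying δn ≤ k ≤ n/2. If U is a k-element subset of {1, 2, …, n} chosen uniformly at random, then for every integer r, the probability that |U ∩ B| − |U ∩ A| = r is at most c/n^{1/2}; equivalently, for every integer r, the number of k-element subsets U of {1,…,n} with |U ∩ B| − |U ∩ A| = r is at most (c/n^{1/2})·C(n,k). -/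
theorem choose_mul_choose_shift (i u v w j : ℕ) (hv : j < v) :
    (i + u).choose (i + (j + 1)) * (v + w).choose (v - (j + 1)) * ((i + j + 1) * (w + j + 1)) =
      (i + u).choose (i + j) * (v + w).choose (v - j) * ((u - j) * (v - j)) := by
  have h1 := Nat.choose_succ_right_eq (i + u) (i + j)
  have h2 := Nat.choose_succ_right_eq (v + w) (v - (j + 1))
  rw [show v - (j + 1) + 1 = v - j by omega, show v + w - (v - (j + 1)) = w + j + 1 by omega] at h2
  rw [show i + u - (i + j) = u - j by omega] at h1
  calc _ = ((i + u).choose (i + j + 1) * (i + j + 1)) *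
        ((v + w).choose (v - (j + 1)) * (w + j + 1)) := by rw [add_assoc i j 1]; ring
    _ = _ := by rw [h1, ← h2]; ring

theorem choose_mul_choose_shift_lower {i u v w : ℕ} {M : ℝ} (hi : M ≤ i + 1) (hu : M ≤ u + 1)
    (hv : M ≤ v + 1) (hw : M ≤ w + 1) (hmode : i * w ≤ (u + 1) * (v + 1)) (j : ℕ)
    (hj : 8 * (j : ℝ) ^ 2 ≤ M) :
    ((i + u).choose i * (v + w).choose v : ℝ) * (1 - 4 * j ^ 2 / M) ≤
      (i + u).choose (i + j) * (v + w).choose (v - j) := by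
  induction j with
  | zero => simp
  | succ j ih =>
    push_cast at hj
    have hj0 : (0 : ℝ) ≤ j := j.cast_nonneg
    have hM : 0 < M := by nlinarith
    have hjv : j < v := by
      have : (j : ℝ) < v := by nlinarith
      exact_mod_cast this
    have hju : j < u := by
      have : (j : ℝ) < u := by nlinarith
      exact_mod_cast this
    have ih := ih (by nlinarith)
    have hstep := congrArg (Nat.cast (R := ℝ)) (choose_mul_choose_shift i u v w j hjv)
    push_cast [Nat.cast_sub hjv.le, Nat.cast_sub hju.le] at hstep
    set P : ℝ := (i + u).choose i * (v + w).choose v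
    set Q : ℝ := (i + u).choose (i + j) * (v + w).choose (v - j)
    set R : ℝ := (i + u).choose (i + (j + 1)) * (v + w).choose (v - (j + 1))
    have hP : 0 ≤ P := by positivity
    have hQ : 0 ≤ Q := by positivity
    obtain ⟨t, ht⟩ : ∃ t : ℝ, t = (j + 1) / M := ⟨_, rfl⟩
    have htM : t * M = j + 1 := by rw [ht]; field_simp
    have ht0 : 0 ≤ t := by rw [ht]; positivity
    have ht1 : t ≤ 1 := by rw [ht, div_le_one hM]; nlinarith
    have hs : 0 ≤ 1 - t := by linarith
    have e1 : (u + 1) * (1 - t) ≤ (u : ℝ) - j := by nlinarith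
    have e2 : (v + 1) * (1 - t) ≤ (v : ℝ) - j := by nlinarith
    have e3 : (i + j + 1) * (1 - t) ≤ (i : ℝ) := by nlinarith
    have e4 : (w + j + 1) * (1 - t) ≤ (w : ℝ) := by nlinarith
    have hmode' : (i : ℝ) * w ≤ (u + 1) * (v + 1) := by exact_mod_cast hmode
    have key : ((i + j + 1) * (w + j + 1) : ℝ) * (1 - 4 * t) ≤ (u - j) * (v - j) :=
      calc ((i + j + 1) * (w + j + 1) : ℝ) * (1 - 4 * t)
          ≤ ((i + j + 1) * (w + j + 1) : ℝ) * (1 - t) ^ 4 := by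
            gcongr
            have := one_add_mul_le_pow (a := -t) (by linarith) 4
            push_cast at this
            calc _ = 1 + 4 * -t := by ring
              _ ≤ _ := this
              _ = _ := by ring
        _ = ((i + j + 1) * (1 - t)) * ((w + j + 1) * (1 - t)) * (1 - t) ^ 2 := by ring
        _ ≤ (i * w) * (1 - t) ^ 2 := by gcongr
        _ ≤ ((u + 1) * (v + 1)) * (1 - t) ^ 2 := by gcongr
        _ = ((u + 1) * (1 - t)) * ((v + 1) * (1 - t)) := by ring
        _ ≤ _ := by
            apply mul_le_mul e1 e2 (by positivity)
            exact le_trans (by positivity) e1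
    have hR : Q * (1 - 4 * t) ≤ R := by
      have hpos : (0 : ℝ) < (i + j + 1) * (w + j + 1) := by positivity
      refine le_of_mul_le_mul_right ?_ hpos
      rw [hstep]
      calc _ = Q * (((i + j + 1) * (w + j + 1) : ℝ) * (1 - 4 * t)) := by ring
        _ ≤ _ := by gcongr
    have ht4 : 0 ≤ 1 - 4 * t := by
      have : 8 * t ≤ 1 := by
        rw [ht, mul_div_assoc', div_le_one hM]; nlinarith
      linarith
    refine le_trans ?_ hR
    refine le_trans ?_ (mul_le_mul_of_nonneg_right ih ht4)
    rw [mul_assoc P]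
    refine mul_le_mul_of_nonneg_left ?_ hP
    have e5 : 4 * ((j : ℝ) + 1) ^ 2 / M = 4 * j ^ 2 / M + 4 * t + 4 * j / M := by
      rw [ht]; field_simp; ring
    have e6 : 0 ≤ 4 * (j : ℝ) / M := by positivity
    have e7 : 0 ≤ 4 * (j : ℝ) ^ 2 / M := by positivity
    have e8 := mul_nonneg e7 ht0
    calc 1 - 4 * ((j + 1 : ℕ) : ℝ) ^ 2 / M
        = 1 - (4 * j ^ 2 / M + 4 * t + 4 * j / M) := by rw [← e5]; push_cast; rfl
      _ ≤ (1 - 4 * j ^ 2 / M) * (1 - 4 * t) := by linarith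

theorem sum_choose_shift_le (i u v w J : ℕ) (hJ : J ≤ v) :
    ∑ j ∈ Finset.range (J + 1), (i + u).choose (i + j) * (v + w).choose (v - j) ≤
      (i + u + (v + w)).choose (i + v) := by
  rw [Nat.add_choose_eq]
  have hinj : Set.InjOn (fun j : ℕ => (i + j, v - j)) (Finset.range (J + 1)) := by
    intro x _ y _ h
    simp only [Prod.mk.injEq] at h
    omega
  rw [← Finset.sum_image (f := fun p : ℕ × ℕ => (i + u).choose p.1 * (v + w).choose p.2) hinj]
  refine Finset.sum_le_sum_of_subset fun p hp => ?_
  obtain ⟨j, hj, rfl⟩ := Finset.mem_image.mp hp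
  rw [Finset.mem_range] at hj
  rw [Finset.HasAntidiagonal.mem_antidiagonal]
  omega

theorem choose_mul_choose_mul_sqrt_le {i u v w : ℕ} {M : ℝ} (hM : 0 ≤ M) (hi : M ≤ i + 1)
    (hu : M ≤ u + 1) (hv : M ≤ v + 1) (hw : M ≤ w + 1) (hmode : i * w ≤ (u + 1) * (v + 1)) :
    ((i + u).choose i * (v + w).choose v : ℝ) * √M ≤ 6 * (i + u + (v + w)).choose (i + v) := by
  set J : ℕ := ⌊√(M / 8)⌋₊
  have hJ8 : (J : ℝ) ≤ √(M / 8) := Nat.floor_le (Real.sqrt_nonneg _)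
  have hJM : 8 * (J : ℝ) ^ 2 ≤ M := by
    have := pow_le_pow_left₀ (Nat.cast_nonneg J) hJ8 2
    rw [Real.sq_sqrt (by positivity)] at this
    linarith
  have hJv : J ≤ v := by
    have : (J : ℝ) < v + 1 := by
      rcases Nat.eq_zero_or_pos J with h | h
      · rw [h]; push_cast; positivity
      · have : (1 : ℝ) ≤ J := by exact_mod_cast h
        nlinarith
    exact Nat.lt_succ_iff.mp (by exact_mod_cast this)
  have hsum : (∑ j ∈ Finset.range (J + 1),
      ((i + u).choose (i + j) * (v + w).choose (v - j) : ℝ)) ≤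
      (i + u + (v + w)).choose (i + v) := by
    exact_mod_cast sum_choose_shift_le i u v w J hJv
  set P : ℝ := (i + u).choose i * (v + w).choose v
  have hP : 0 ≤ P := by positivity
  have hlow : ∑ j ∈ Finset.range (J + 1), P / 2 ≤ ∑ j ∈ Finset.range (J + 1),
      ((i + u).choose (i + j) * (v + w).choose (v - j) : ℝ) := by
    refine Finset.sum_le_sum fun j hj => ?_
    have hjJ : (j : ℝ) ≤ J := by exact_mod_cast Nat.lt_succ_iff.mp (Finset.mem_range.mp hj)
    have hj8 : 8 * (j : ℝ) ^ 2 ≤ M := le_trans (by gcongr) hJM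
    refine le_trans ?_ (choose_mul_choose_shift_lower hi hu hv hw hmode j hj8)
    have : 4 * (j : ℝ) ^ 2 / M ≤ 1 / 2 := div_le_of_le_mul₀ hM (by norm_num) (by linarith)
    nlinarith
  rw [Finset.sum_const, Finset.card_range, nsmul_eq_mul] at hlow
  push_cast at hlow
  have hsqrt : √M ≤ 3 * (J + 1) := by
    have h1 : √(M / 8) ≤ J + 1 := (Nat.lt_floor_add_one _).le
    have h2 : √M ≤ 3 * √(M / 8) := by
      rw [Real.sqrt_le_left (by positivity), mul_pow, Real.sq_sqrt (by positivity)]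
      linarith
    linarith
  calc P * √M ≤ P * (3 * (J + 1)) := by gcongr
    _ = 6 * ((J + 1) * (P / 2)) := by ring
    _ ≤ _ := by linarith

theorem card_filter_inter_sub_inter_le {n : ℕ} {A B : Finset (Fin n)} (hAB : Disjoint A B)
    (k : ℕ) (r : ℤ) {P : ℝ}
    (hP : ∀ s ≤ k, (A.card.choose s * (n - A.card).choose (k - s) : ℝ) ≤ P) :
    ((Finset.univ.filter (fun U : Finset (Fin n) =>
      U.card = k ∧ ((U ∩ B).card : ℤ) - ((U ∩ A).card : ℤ) = r)).card : ℝ) ≤ P := by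
  classical
  set F := Finset.univ.filter (fun U : Finset (Fin n) =>
    U.card = k ∧ ((U ∩ B).card : ℤ) - ((U ∩ A).card : ℤ) = r) with hF
  let φ : Finset (Fin n) → Finset {x // x ∉ A} := fun U => U.subtype (· ∉ A)
  have hcard : Fintype.card {x // x ∉ A} = n - A.card := by
    simp [Fintype.card_subtype_compl]
  have hsplit (U : Finset (Fin n)) : (U ∩ A).card + (φ U).card = U.card := by
    rw [Finset.card_subtype, ← Finset.filter_mem_eq_inter,
      Finset.card_filter_add_card_filter_not]
  have hB (U : Finset (Fin n)) : U ∩ B = ((φ U).map (.subtype _)) ∩ B := by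
    ext x
    have : x ∈ B → x ∉ A := fun hx hA => Finset.disjoint_left.mp hAB hA hx
    simp only [φ, Finset.subtype_map, Finset.mem_inter, Finset.mem_filter]
    tauto
  have hanti : IsAntichain (· ⊆ ·) (F.image φ : Set (Finset {x // x ∉ A})) := by
    intro Y hY Z hZ hne hsub
    simp only [Finset.coe_image, Set.mem_image, Finset.mem_coe, hF, Finset.mem_filter,
      Finset.mem_univ, true_and] at hY hZ
    obtain ⟨U, ⟨hUk, hUr⟩, rfl⟩ := hY
    obtain ⟨V, ⟨hVk, hVr⟩, rfl⟩ := hZ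
    have h1 := Finset.card_lt_card (hsub.ssubset_of_ne hne)
    have h2 : (U ∩ B).card ≤ (V ∩ B).card := by
      rw [hB U, hB V]
      gcongr
    have h3 := hsplit U
    have h4 := hsplit V
    omega
  have hfib (Y : Finset {x // x ∉ A}) :
      (F.filter (φ · = Y)).card ≤ A.card.choose (k - Y.card) := by
    rw [← Finset.card_powersetCard]
    refine Finset.card_le_card_of_injOn (· ∩ A) ?_ ?_
    · intro U hU
      simp only [hF, Finset.coe_filter, Finset.mem_filter, Finset.mem_univ, true_and,
        Set.mem_ofPred_eq] at hU
      obtain ⟨⟨hUk, -⟩, rfl⟩ := hU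
      rw [Finset.mem_coe, Finset.mem_powersetCard]
      have := hsplit U
      exact ⟨Finset.inter_subset_right, show (U ∩ A).card = k - (φ U).card by omega⟩
    · intro U hU V hV hUV
      have hUV' : φ U = φ V := (Finset.mem_filter.mp hU).2.trans (Finset.mem_filter.mp hV).2.symm
      ext x
      by_cases hx : x ∈ A
      · simpa [hx] using Finset.ext_iff.mp hUV x
      · simpa [φ] using Finset.ext_iff.mp hUV' ⟨x, hx⟩
  have hlym := Finset.lubell_yamamoto_meshalkin_inequality_sum_inv_choose (𝕜 := ℝ) hanti
  rw [hcard] at hlym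
  have hP0 : 0 ≤ P := le_trans (by positivity) (hP 0 k.zero_le)
  rw [Finset.card_eq_sum_card_image φ F, Nat.cast_sum]
  calc ∑ Y ∈ F.image φ, ((F.filter (φ · = Y)).card : ℝ)
      ≤ ∑ Y ∈ F.image φ, P * ((n - A.card).choose Y.card : ℝ)⁻¹ := by
        refine Finset.sum_le_sum fun Y hY => ?_
        have hYk : Y.card ≤ k := by
          obtain ⟨U, hU, rfl⟩ := Finset.mem_image.mp hY
          have h1 : U.card = k := (Finset.mem_filter.mp hU).2.1
          have h2 := hsplit U
          omega
        have hYpos : (0 : ℝ) < (n - A.card).choose Y.card := by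
          exact_mod_cast Nat.choose_pos (hcard ▸ Y.card_le_univ)
        rw [← div_eq_mul_inv, le_div_iff₀ hYpos]
        have h3 := hP (k - Y.card) (Nat.sub_le _ _)
        rw [Nat.sub_sub_self hYk] at h3
        refine le_trans ?_ h3
        gcongr
        exact hfib Y
    _ = P * ∑ Y ∈ F.image φ, ((n - A.card).choose Y.card : ℝ)⁻¹ := by rw [Finset.mul_sum]
    _ ≤ P := mul_le_of_le_one_right hP0 hlym

theorem sq_mul_div_three_le_add_one {i u v w : ℕ} (h : u * v ≤ (i + 1) * (w + 1)) {δ : ℝ}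
    (hδ : 0 ≤ δ) {n : ℕ} (hn : 1 ≤ n) (hsum : i + u + (v + w) = n) (ha : δ * n ≤ (i + u : ℝ))
    (hk : δ * n ≤ (i + v : ℝ)) : δ ^ 2 * n / 3 ≤ i + 1 := by
  have h' : (u * v : ℝ) ≤ (i + 1) * (w + 1) := by exact_mod_cast h
  have hn' : (1 : ℝ) ≤ n := by exact_mod_cast hn
  have hs : (n : ℝ) = i + u + (v + w) := by exact_mod_cast hsum.symm
  have h1 : (δ * n) * (δ * n) ≤ (i + u + 1) * (i + v + 1 : ℝ) := by
    apply mul_le_mul <;> first | positivity | linarith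
  have h2 : (i + u + 1) * (i + v + 1 : ℝ) ≤ (i + 1) * (n + 2) := by rw [hs]; nlinarith
  have h3 : (i + 1) * (n + 2) ≤ (i + 1) * (3 * n : ℝ) := by gcongr; linarith
  have hpos : (0 : ℝ) < 3 * n := by positivity
  refine le_of_mul_le_mul_right ?_ hpos
  calc δ ^ 2 * n / 3 * (3 * n) = (δ * n) * (δ * n) := by ring
    _ ≤ _ := by linarith

theorem mul_le_of_choose_mul_choose_le {i u v w : ℕ}
    (hle : 0 < u → 0 < v → (i + u).choose (i + 1) * (v + w).choose (v - 1) ≤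
      (i + u).choose i * (v + w).choose v) : u * v ≤ (i + 1) * (w + 1) := by
  rcases Nat.eq_zero_or_pos u with rfl | hu
  · simp
  rcases Nat.eq_zero_or_pos v with rfl | hv
  · simp
  have h := choose_mul_choose_shift i u v w 0 hv
  simp only [add_zero, zero_add, Nat.sub_zero] at h
  have hpos : 0 < (i + u).choose i * (v + w).choose v :=
    Nat.mul_pos (Nat.choose_pos (by omega)) (Nat.choose_pos (by omega))
  refine Nat.le_of_mul_le_mul_left ?_ hpos
  rw [← h]
  exact Nat.mul_le_mul_right _ (hle hu hv)

theorem choose_mul_choose_le_of_balanced {n a k : ℕ} {δ : ℝ} (hδ : 0 < δ) (hn : 1 ≤ n)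
    (han : a ≤ n) (hkn : k ≤ n)
    (ha : δ * n ≤ a) (ha' : a ≤ (1 - δ) * n) (hk : δ * n ≤ k) (hk' : k ≤ (1 - δ) * n)
    {s : ℕ} (hs : s ≤ k) :
    (a.choose s * (n - a).choose (k - s) : ℝ) * √(δ ^ 2 * n / 3) ≤ 6 * n.choose k := by
  obtain ⟨m, hm, hmax⟩ := Finset.exists_max_image (Finset.range (k + 1))
    (fun s => a.choose s * (n - a).choose (k - s)) ⟨0, by simp⟩
  rw [Finset.mem_range, Nat.lt_succ_iff] at hm
  have hmax' : ∀ s ≤ k, a.choose s * (n - a).choose (k - s) ≤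
      a.choose m * (n - a).choose (k - m) :=
    fun s hs => hmax s (Finset.mem_range.mpr (by omega))
  have hpos : 0 < a.choose m * (n - a).choose (k - m) :=
    (Nat.mul_pos (Nat.choose_pos (by omega)) (Nat.choose_pos (by omega))).trans_le
      (hmax' (min a k) (min_le_right _ _))
  have hma : m ≤ a := by
    by_contra! h
    simp [Nat.choose_eq_zero_of_lt h] at hpos
  have hmb : k - m ≤ n - a := by
    by_contra! h
    simp [Nat.choose_eq_zero_of_lt h] at hpos
  obtain ⟨u, rfl⟩ := Nat.exists_eq_add_of_le hma
  obtain ⟨v, rfl⟩ := Nat.exists_eq_add_of_le hm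
  obtain ⟨b, rfl⟩ := Nat.exists_eq_add_of_le han
  simp only [Nat.add_sub_cancel_left] at hmax' hmb ⊢
  obtain ⟨w, rfl⟩ := Nat.exists_eq_add_of_le hmb
  have hmode : u * v ≤ (m + 1) * (w + 1) := mul_le_of_choose_mul_choose_le fun _ hv => by
    have := hmax' (m + 1) (by omega)
    rwa [show m + v - (m + 1) = v - 1 by omega] at this
  have hmode' : m * w ≤ (u + 1) * (v + 1) := mul_le_of_choose_mul_choose_le fun hm hw => by
    have := hmax' (m - 1) (by omega)
    rwa [show m + v - (m - 1) = v + 1 by omega,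
      Nat.choose_symm_of_eq_add (show m + u = m - 1 + (u + 1) by omega),
      Nat.choose_symm_of_eq_add (show v + w = v + 1 + (w - 1) by omega),
      Nat.choose_symm_add, Nat.choose_symm_add, add_comm m u, add_comm v w] at this
  have hsle : ((m + u).choose s * (v + w).choose (m + v - s) : ℝ) ≤
      (m + u).choose m * (v + w).choose v := by exact_mod_cast hmax' s hs
  refine (mul_le_mul_of_nonneg_right hsle (Real.sqrt_nonneg _)).trans ?_
  obtain ⟨N, hN⟩ : ∃ N : ℕ, m + u + (v + w) = N := ⟨_, rfl⟩
  have hNr : (m + u + (v + w) : ℝ) = N := by exact_mod_cast hN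
  rw [hN] at hn ha ha' hk hk' ⊢
  push_cast at ha ha' hk hk'
  have hb : δ * N ≤ (v + w : ℝ) := by linarith
  have hl : δ * N ≤ (u + w : ℝ) := by linarith
  rw [← hN]
  refine choose_mul_choose_mul_sqrt_le (by positivity) ?_ ?_ ?_ ?_ hmode' <;> rw [hN]
  · exact sq_mul_div_three_le_add_one hmode hδ.le hn hN ha hk
  · exact sq_mul_div_three_le_add_one (w := v) (v := w) hmode' hδ.le hn (by omega)
      (by linarith) hl
  · exact sq_mul_div_three_le_add_one (u := w) (v := m) (w := u) (by linarith) hδ.le hn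
      (by omega) (by linarith) (by linarith)
  · exact sq_mul_div_three_le_add_one (u := v) (v := u) (w := m) (by linarith) hδ.le hn
      (by omega) (by linarith) (by linarith)


/-- Proposition (anticoncentration for hypergeometric differences): for any `δ > 0` there is a
constant `c > 0` such that for all `n`, all disjoint `A, B ⊆ {1, …, n}` with
`δn ≤ |A| ≤ (1-δ)n`, and every integer `k` with `δn ≤ k ≤ n/2`: for every integer `r`,
the number of `k`-element subsets `U` of `{1, …, n}` with `|U ∩ B| - |U ∩ A| = r` is at most
`(c / n^{1/2}) · C(n, k)`; equivalently (clearing the denominator `n^{1/2}`), that number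
times `n^{1/2}` is at most `c · C(n, k)`. -/
theorem hypergeometric_anticoncentration (δ : ℝ) (hδ : 0 < δ) :
    ∃ c : ℝ, 0 < c ∧ ∀ n : ℕ, ∀ A B : Finset (Fin n), Disjoint A B →
      δ * n ≤ (A.card : ℝ) → (A.card : ℝ) ≤ (1 - δ) * n →
      ∀ k : ℕ, δ * n ≤ (k : ℝ) → (k : ℝ) ≤ (n : ℝ) / 2 →
      ∀ r : ℤ,
        ((Finset.univ.filter (fun U : Finset (Fin n) =>
            U.card = k ∧ ((U ∩ B).card : ℤ) - ((U ∩ A).card : ℤ) = r)).card : ℝ)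
          * (n : ℝ) ^ ((1 : ℝ) / 2)
        ≤ c * (n.choose k : ℝ) := by
  refine ⟨12 / δ, by positivity, fun n A B hAB ha ha' k hk hk' r => ?_⟩
  rcases Nat.eq_zero_or_pos n with rfl | hn
  · rw [Nat.cast_zero, Real.zero_rpow (by norm_num), mul_zero]
    positivity
  have hn' : (0 : ℝ) < n := by exact_mod_cast hn
  have hkn : k ≤ n := by
    have : (k : ℝ) ≤ n := by linarith
    exact_mod_cast this
  have han : A.card ≤ n := by simpa using A.card_le_univ
  rw [← Real.sqrt_eq_rpow, ← le_div_iff₀ (Real.sqrt_pos.mpr hn')]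
  refine card_filter_inter_sub_inter_le hAB k r fun s hs => ?_
  have h := choose_mul_choose_le_of_balanced hδ hn han hkn ha ha' hk (by linarith) hs
  have hsqrt : δ * √n / 2 ≤ √(δ ^ 2 * n / 3) := by
    refine Real.le_sqrt_of_sq_le ?_
    rw [div_pow, mul_pow, Real.sq_sqrt hn'.le]
    have : 0 < δ ^ 2 * n := by positivity
    linarith
  rw [le_div_iff₀ (Real.sqrt_pos.mpr hn'), div_mul_eq_mul_div, le_div_iff₀ hδ]
  have h2 := (mul_le_mul_of_nonneg_left hsqrt (by positivity)).trans h
  linarith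
end

section
/- For any real numbers C > 0 and δ > 0, there exists a constant c > 0 such that the following holds for all n ∈ ℕ: every C-Ramsey graph on n vertices contains a (c, δ)-diverse induced subgraph on at least cn vertices. -/
/-- An `n`-vertex graph `G` is `(c, δ)`-diverse if for each vertex `x`, the inequality
`|Γ(x) △ Γ(y)| ≥ c n` holds for all but at most `n^δ` vertices `y`. -/
def Diverse (c δ : ℝ) {V : Type*} [Fintype V] (G : SimpleGraph V) : Prop :=
  ∀ x : V,
    (({y : V | ((symmDiff (G.neighborSet x) (G.neighborSet y)).ncard : ℝ)
        < c * (Fintype.card V : ℝ)}).ncard : ℝ) ≤ (Fintype.card V : ℝ) ^ δ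

open Finset in
/-- A weighted form of the Erdős–Szekeres bound: a set whose cliques have at most `b` and whose
independent sets have at most `a` elements has at most `y ^ a * z ^ b` elements, as soon as
`1 + y + z ≤ y * z`. -/
theorem card_le_pow_mul_pow_of_card_isClique_le {V : Type*} (G : SimpleGraph V)
    {y z : ℝ} (hy : 0 < y) (hz : 0 < z) (hyz : 1 + y + z ≤ y * z) (U : Finset V) :
    ∀ a b : ℕ, (∀ J ⊆ U, Gᶜ.IsClique (J : Set V) → #J ≤ a) →
      (∀ J ⊆ U, G.IsClique (J : Set V) → #J ≤ b) → (#U : ℝ) ≤ y ^ a * z ^ b := by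
  classical
  induction U using Finset.strongInduction with
  | H U ih =>
    intro a b ha hb
    rcases U.eq_empty_or_nonempty with rfl | ⟨v, hv⟩
    · simp only [card_empty, Nat.cast_zero]; positivity
    have ha1 : 1 ≤ a := by simpa using ha {v} (by simpa using hv) (by simp)
    have hb1 : 1 ≤ b := by simpa using hb {v} (by simpa using hv) (by simp)
    obtain ⟨a, rfl⟩ := Nat.exists_eq_add_of_le' ha1
    obtain ⟨b, rfl⟩ := Nat.exists_eq_add_of_le' hb1
    have key : ∀ H : SimpleGraph V, ∀ k : ℕ, (∀ J ⊆ U, H.IsClique (J : Set V) → #J ≤ k + 1) →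
        ∀ J ⊆ (U.erase v).filter (H.Adj v), H.IsClique (J : Set V) → #J ≤ k := by
      intro H k hk J hJ hJc
      have hvJ : v ∉ J := fun h => by simpa using hJ h
      have := hk (insert v J)
        (insert_subset hv ((hJ.trans (filter_subset _ _)).trans (erase_subset _ _)))
        (by
          rw [coe_insert]
          exact hJc.insert fun w hw _ => (mem_filter.1 (hJ hw)).2)
      rw [card_insert_of_notMem hvJ] at this
      omega
    have hsub : ∀ H : SimpleGraph V, (U.erase v).filter (H.Adj v) ⊂ U := fun H =>
      (filter_subset _ _).trans_ssubset (erase_ssubset hv)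
    have h1 := ih _ (hsub G) (a + 1) b
      (fun J hJ => ha J (hJ.trans (hsub G).subset)) (key G b hb)
    have h2 : (#((U.erase v).filter (Gᶜ.Adj v)) : ℝ) ≤ y ^ a * z ^ (b + 1) := by
      convert ih _ (hsub Gᶜ) a (b + 1) (key Gᶜ a ha)
        (fun J hJ => hb J (hJ.trans (hsub Gᶜ).subset))
    have hcard : #U = 1 + #((U.erase v).filter (G.Adj v)) + #((U.erase v).filter (Gᶜ.Adj v)) := by
      have e : (U.erase v).filter (Gᶜ.Adj v) = (U.erase v).filter (fun w => ¬ G.Adj v w) := by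
        refine filter_congr fun w hw => ?_
        simp [SimpleGraph.compl_adj, (ne_of_mem_erase hw).symm]
      rw [e, add_assoc, card_filter_add_card_filter_not, add_comm, card_erase_add_one hv]
    have hge : 1 ≤ y ^ a * z ^ b := by
      have hy1 : 1 ≤ y := by nlinarith
      have hz1 : 1 ≤ z := by nlinarith
      exact one_le_mul_of_one_le_of_one_le (one_le_pow₀ hy1) (one_le_pow₀ hz1)
    rw [hcard]
    push_cast
    calc (1 : ℝ) + _ + _ ≤ y ^ a * z ^ b + y ^ (a + 1) * z ^ b + y ^ a * z ^ (b + 1) := by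
          linarith
      _ = y ^ a * z ^ b * (1 + y + z) := by ring
      _ ≤ y ^ a * z ^ b * (y * z) := by gcongr
      _ = _ := by ring

open Finset in
theorem card_filter_powerset_card_le {V : Type*} (I : Finset V) (r : ℕ) {x : ℝ}
    (hx : 0 < x) (hx1 : x ≤ 1) :
    (#(I.powerset.filter (fun T => #T ≤ r)) : ℝ) ≤ (1 / x) ^ r * (1 + x) ^ #I := by
  have h : (#(I.powerset.filter (fun T => #T ≤ r)) : ℝ) * x ^ r ≤ (1 + x) ^ #I := by
    have e := sum_pow_mul_eq_add_pow x 1 I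
    rw [add_comm] at e
    rw [← e, ← nsmul_eq_mul, ← sum_const]
    refine (sum_le_sum fun T hT => ?_).trans
      (sum_le_sum_of_subset_of_nonneg (filter_subset _ _) fun T _ _ => by positivity)
    rw [one_pow, mul_one]
    exact pow_le_pow_of_le_one hx.le hx1 (mem_filter.1 hT).2
  rw [one_div, inv_pow, inv_mul_eq_div, le_div_iff₀ (by positivity)]
  exact h

open Finset in
/-- Markov's inequality for counting measure. -/
theorem mul_card_filter_lt_le_sum {V : Type*} (W : Finset V) (f : V → ℝ)
    (hf : ∀ v ∈ W, 0 ≤ f v) (t : ℝ) :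
    t * (#(W.filter (fun v => t < f v)) : ℝ) ≤ ∑ v ∈ W, f v := by
  rw [mul_comm, ← nsmul_eq_mul, ← sum_const]
  refine (sum_le_sum fun v hv => (mem_filter.1 hv).2.le).trans ?_
  exact sum_le_sum_of_subset_of_nonneg (filter_subset _ _) fun v hv _ => hf v hv

open Finset Classical in
/-- The combinatorial part of the Erdős–Szemerédi theorem on homogeneous sets in sparse graphs. -/
theorem card_le_of_sparse_s6 {V : Type*} (G : SimpleGraph V) (W : Finset V) {θ x : ℝ}
    (hθ : 0 < θ) (hx : 0 < x) (hx1 : x ≤ 1) (k : ℕ)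
    (hk : ∀ J ⊆ W, (G.IsClique (J : Set V) ∨ Gᶜ.IsClique (J : Set V)) → #J ≤ k)
    (hsparse : ∑ v ∈ W, (#(W.filter (G.Adj v)) : ℝ) ≤ θ / 8 * (#W : ℝ) ^ 2)
    (hkW : 8 * (k : ℝ) ≤ #W) :
    (#W : ℝ) ≤ 8 * ((3 / x) ^ (2 * ⌊θ * k⌋₊) * (1 + x) ^ (2 * k)) := by
  rcases W.eq_empty_or_nonempty with rfl | hWne
  · simp only [card_empty, Nat.cast_zero]; positivity
  have hN : (0 : ℝ) < #W := by exact_mod_cast hWne.card_pos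
  set N : ℝ := (#W : ℝ)
  set W₁ := W.filter (fun v => ¬ θ / 4 * N < #(W.filter (G.Adj v))) with hW₁
  have hW₁card : N / 2 ≤ #W₁ := by
    have h1 := mul_card_filter_lt_le_sum W (fun v => (#(W.filter (G.Adj v)) : ℝ))
      (fun _ _ => by positivity) (θ / 4 * N)
    have h2 := card_filter_add_card_filter_not (s := W)
      (fun v => θ / 4 * N < (#(W.filter (G.Adj v)) : ℝ))
    have h2' : (#(W.filter (fun v => θ / 4 * N < (#(W.filter (G.Adj v)) : ℝ))) : ℝ) + #W₁ = N := by
      rw [hW₁, ← Nat.cast_add, h2]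
    have h3 : (#(W.filter (fun v => θ / 4 * N < (#(W.filter (G.Adj v)) : ℝ))) : ℝ) ≤ N / 2 := by
      have : 0 < θ / 4 * N := by positivity
      refine le_of_mul_le_mul_left ?_ this
      calc _ ≤ _ := h1.trans hsparse
        _ = _ := by ring
    linarith
  have hW₁W : W₁ ⊆ W := filter_subset _ _
  obtain ⟨I, hI, hImax⟩ := exists_max_image
    (W₁.powerset.filter fun J : Finset V => Gᶜ.IsClique (J : Set V)) Finset.card ⟨∅, by simp⟩
  simp only [mem_filter, mem_powerset, and_imp] at hI hImax
  obtain ⟨hIW, hIc⟩ := hI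
  have hIk : #I ≤ k := hk I (hIW.trans hW₁W) (Or.inr hIc)
  have hIpos : 0 < #I := by
    have : 0 < #W₁ := by
      have : (0 : ℝ) < #W₁ := by linarith
      exact_mod_cast this
    obtain ⟨v, hv⟩ := card_pos.1 this
    exact hImax {v} (by simpa using hv) (by simp)
  set W₂ := (W₁.filter (fun v => ¬ θ * #I < #(I.filter (G.Adj v)))) \ I with hW₂
  have hW₂card : N / 8 ≤ #W₂ := by
    have h1 := mul_card_filter_lt_le_sum W₁ (fun v => (#(I.filter (G.Adj v)) : ℝ))
      (fun _ _ => by positivity) (θ * #I)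
    have hsum : ∑ v ∈ W₁, (#(I.filter (G.Adj v)) : ℝ) ≤ #I * (θ / 4 * N) := by
      have e : ∑ v ∈ W₁, (#(I.filter (G.Adj v)) : ℝ) = ∑ u ∈ I, (#(W₁.filter (G.Adj u)) : ℝ) := by
        have := sum_card_bipartiteAbove_eq_sum_card_bipartiteBelow (s := W₁) (t := I) G.Adj
        simp only [bipartiteAbove, bipartiteBelow] at this
        simp only [G.adj_comm] at this ⊢
        exact_mod_cast this
      rw [e, ← nsmul_eq_mul, ← sum_const]
      refine sum_le_sum fun u hu => ?_
      have h := (mem_filter.1 (hIW hu)).2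
      rw [not_lt] at h
      refine le_trans ?_ h
      exact_mod_cast card_le_card (filter_subset_filter _ hW₁W)
    have h2 := card_filter_add_card_filter_not (s := W₁)
      (fun v => θ * #I < (#(I.filter (G.Adj v)) : ℝ))
    have h3 : (#(W₁.filter (fun v => θ * #I < (#(I.filter (G.Adj v)) : ℝ))) : ℝ) ≤ N / 4 := by
      have : (0 : ℝ) < θ * #I := by positivity
      refine le_of_mul_le_mul_left ?_ this
      calc _ ≤ _ := h1.trans hsum
        _ = _ := by ring
    have h4 := le_card_sdiff I (W₁.filter (fun v => ¬ θ * #I < (#(I.filter (G.Adj v)) : ℝ)))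
    have h5 : #W₁ ≤ #(W₁.filter (fun v => θ * #I < (#(I.filter (G.Adj v)) : ℝ))) + (#W₂ + k) := by
      rw [hW₂]; omega
    have h5' : (#W₁ : ℝ) ≤
        #(W₁.filter (fun v => θ * #I < (#(I.filter (G.Adj v)) : ℝ))) + (#W₂ + k) := by
      exact_mod_cast h5
    linarith
  set r := ⌊θ * k⌋₊ with hr
  set P := I.powerset.filter (fun T => #T ≤ r) with hP
  have hyz : 1 + 3 / x + (1 + x) ≤ 3 / x * (1 + x) := by
    have h : 3 / x * x = 3 := by field_simp
    nlinarith
  have hmaps : ∀ v ∈ W₂, I.filter (G.Adj v) ∈ P := by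
    intro v hv
    have h := (mem_filter.1 (mem_sdiff.1 hv).1).2
    rw [not_lt] at h
    refine mem_filter.2 ⟨mem_powerset.2 (filter_subset _ _), Nat.le_floor (h.trans ?_)⟩
    gcongr
  have hfib : ∀ T ∈ P, (#(W₂.filter (fun v => I.filter (G.Adj v) = T)) : ℝ) ≤
      (3 / x) ^ r * (1 + x) ^ k := by
    intro T hT
    obtain ⟨hTI, hTr⟩ := mem_filter.1 hT
    rw [mem_powerset] at hTI
    have hUW : W₂.filter (fun v => I.filter (G.Adj v) = T) ⊆ W₁ :=
      (filter_subset _ _).trans (sdiff_subset.trans (filter_subset _ _))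
    refine card_le_pow_mul_pow_of_card_isClique_le G (by positivity) (by positivity) hyz _ r k ?_
      fun J hJ hJc => hk J (hJ.trans (hUW.trans hW₁W)) (Or.inl hJc)
    intro J hJ hJc
    have hJI : ∀ v ∈ J, v ∉ I := fun v hv =>
      (mem_sdiff.1 (filter_subset _ _ (hJ hv))).2
    have hdisj : Disjoint (I \ T) J :=
      disjoint_left.2 fun v hv hvJ => hJI v hvJ (mem_sdiff.1 hv).1
    have hcl : Gᶜ.IsClique ((I \ T ∪ J : Finset V) : Set V) := by
      have hcross : ∀ u ∈ I \ T, ∀ v ∈ J, Gᶜ.Adj u v := by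
        intro u hu v hv
        have hu' := mem_sdiff.1 hu
        refine (G.compl_adj u v).2 ⟨fun h => hJI v hv (h ▸ hu'.1), fun h => hu'.2 ?_⟩
        rw [← (mem_filter.1 (hJ hv)).2]
        exact mem_filter.2 ⟨hu'.1, h.symm⟩
      intro u hu v hv huv
      rw [mem_coe, mem_union] at hu hv
      rcases hu with hu | hu <;> rcases hv with hv | hv
      · exact hIc (mem_sdiff.1 hu).1 (mem_sdiff.1 hv).1 huv
      · exact hcross u hu v hv
      · exact (hcross v hv u hu).symm
      · exact hJc hu hv huv
    have hle := hImax _ (union_subset (sdiff_subset.trans hIW) (hJ.trans hUW)) hcl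
    rw [card_union_of_disjoint hdisj, card_sdiff_of_subset hTI] at hle
    have := card_le_card hTI
    omega
  have htot : (#W₂ : ℝ) ≤ #P * ((3 / x) ^ r * (1 + x) ^ k) := by
    rw [card_eq_sum_card_fiberwise hmaps, ← nsmul_eq_mul, ← sum_const]
    push_cast
    exact sum_le_sum hfib
  have hPcard : (#P : ℝ) ≤ (3 / x) ^ r * (1 + x) ^ k := by
    refine (card_filter_powerset_card_le I r hx hx1).trans ?_
    gcongr
    · norm_num
    · linarith
  calc N ≤ 8 * #W₂ := by linarith
    _ ≤ 8 * (((3 / x) ^ r * (1 + x) ^ k) * ((3 / x) ^ r * (1 + x) ^ k)) := by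
      gcongr
      exact htot.trans (by gcongr)
    _ = _ := by ring

open Finset Classical Filter in
/-- A qualitative Erdős–Szemerédi theorem: sufficiently sparse graphs contain homogeneous sets of
size more than any prescribed multiple of the logarithm of their order. -/
theorem exists_homogeneous_of_sparse (M : ℝ) (hM : 0 < M) :
    ∃ ε : ℝ, 0 < ε ∧ ∃ N₀ : ℕ, ∀ (V : Type*) (G : SimpleGraph V) (W : Finset V), N₀ ≤ #W →
      ∑ v ∈ W, (#(W.filter (G.Adj v)) : ℝ) ≤ ε * (#W : ℝ) ^ 2 →
      ∃ J ⊆ W, (G.IsClique (J : Set V) ∨ Gᶜ.IsClique (J : Set V)) ∧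
        M * Real.logb 2 #W < #J := by
  have hl2 : 0 < Real.log 2 := Real.log_pos (by norm_num)
  set x : ℝ := min 1 (Real.log 2 / (8 * M)) with hxdef
  have hx : 0 < x := lt_min one_pos (by positivity)
  have hx1 : x ≤ 1 := min_le_left _ _
  have hx2 : x ≤ Real.log 2 / (8 * M) := min_le_right _ _
  set L := Real.log (3 / x) with hL
  have hLpos : 0 < L := Real.log_pos (by rw [lt_div_iff₀ hx]; linarith)
  set θ := Real.log 2 / (8 * M * L) with hθdef
  have hθ : 0 < θ := by positivity
  have hlog : ∀ᶠ n : ℕ in atTop, 8 * (M * Real.logb 2 n) ≤ n := by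
    have h := (Real.isLittleO_log_id_atTop.comp_tendsto tendsto_natCast_atTop_atTop).def
      (c := Real.log 2 / (8 * M)) (by positivity)
    filter_upwards [h] with n hn
    simp only [Function.comp, id, Real.norm_eq_abs, Nat.abs_cast] at hn
    have hn' := (le_abs_self _).trans hn
    rw [Real.logb]
    calc 8 * (M * (Real.log n / Real.log 2)) = (8 * M / Real.log 2) * Real.log n := by ring
      _ ≤ (8 * M / Real.log 2) * (Real.log 2 / (8 * M) * n) := by gcongr
      _ = n := by field_simp
  obtain ⟨N₀, hN₀⟩ := eventually_atTop.1 hlog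
  refine ⟨θ / 8, by positivity, max N₀ 65, fun V G W hW hsparse => ?_⟩
  by_contra! hcon
  have h65 : (65 : ℝ) ≤ #W := by exact_mod_cast (le_max_right _ _).trans hW
  have hWlog := hN₀ #W ((le_max_left _ _).trans hW)
  have hlogW : 0 < Real.log #W := Real.log_pos (by linarith)
  have hklog : 0 ≤ M * Real.logb 2 #W := by unfold Real.logb; positivity
  set k := ⌊M * Real.logb 2 #W⌋₊ with hk
  have hkle : (k : ℝ) ≤ M * Real.logb 2 #W := Nat.floor_le hklog
  have hmain := card_le_of_sparse_s6 G W hθ hx hx1 k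
    (fun J hJ hJc => Nat.le_floor (hcon J hJ hJc)) hsparse (by linarith)
  have hkle' : (k : ℝ) ≤ M / Real.log 2 * Real.log #W := by
    rw [Real.logb] at hkle
    linarith [show M * (Real.log #W / Real.log 2) = M / Real.log 2 * Real.log #W by ring]
  have hpow : (3 / x) ^ (2 * ⌊θ * k⌋₊) * (1 + x) ^ (2 * k) ≤ Real.exp (Real.log #W / 2) := by
    have e1 : (3 / x) ^ (2 * ⌊θ * k⌋₊) ≤ Real.exp (Real.log #W / 4) := by
      rw [← Real.exp_log (show 0 < 3 / x by positivity), ← Real.exp_nat_mul, Real.exp_le_exp]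
      push_cast
      calc 2 * (⌊θ * k⌋₊ : ℝ) * L ≤ 2 * (θ * k) * L := by
            gcongr; exact Nat.floor_le (by positivity)
        _ ≤ 2 * (θ * (M / Real.log 2 * Real.log #W)) * L := by gcongr
        _ = Real.log #W / 4 := by rw [hθdef]; field_simp; norm_num
    have e2 : (1 + x) ^ (2 * k) ≤ Real.exp (Real.log #W / 4) := by
      calc (1 + x) ^ (2 * k) ≤ Real.exp x ^ (2 * k) := by
            gcongr; linarith [Real.add_one_le_exp x]
        _ = Real.exp (2 * k * x) := by rw [← Real.exp_nat_mul]; push_cast; rfl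
        _ ≤ Real.exp (Real.log #W / 4) := by
            rw [Real.exp_le_exp]
            calc 2 * (k : ℝ) * x ≤ 2 * (M / Real.log 2 * Real.log #W) * (Real.log 2 / (8 * M)) := by
                  gcongr
              _ = Real.log #W / 4 := by field_simp; norm_num
    calc _ ≤ Real.exp (Real.log #W / 4) * Real.exp (Real.log #W / 4) := by gcongr
      _ = _ := by rw [← Real.exp_add]; ring_nf
  set E := Real.exp (Real.log #W / 2) with hE
  have hEE : E * E = #W := by
    rw [hE, ← Real.exp_add, add_halves, Real.exp_log (by linarith)]
  have hEpos : 0 < E := Real.exp_pos _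
  nlinarith

open Finset Classical in
theorem sum_card_filter_adj_union_le {V : Type*} (G : SimpleGraph V) {S A : Finset V} {s a : ℕ}
    {ε : ℝ} (hε : 0 ≤ ε) (hSA : Disjoint S A) (hS : #S = s) (hA : #A = a * s)
    (hcross : ∀ z ∈ A, (#(S.filter (G.Adj z)) : ℝ) ≤ ε * s)
    (hsum : ∑ v ∈ A, (#(A.filter (G.Adj v)) : ℝ) ≤ a * (s : ℝ) ^ 2 + ε * (a * s : ℝ) ^ 2) :
    ∑ v ∈ S ∪ A, (#((S ∪ A).filter (G.Adj v)) : ℝ) ≤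
      (a + 1 : ℕ) * (s : ℝ) ^ 2 + ε * ((a + 1 : ℕ) * s : ℝ) ^ 2 := by
  have hsplit : ∀ v, (#((S ∪ A).filter (G.Adj v)) : ℝ) =
      #(S.filter (G.Adj v)) + #(A.filter (G.Adj v)) := by
    intro v
    rw [filter_union, card_union_of_disjoint (disjoint_filter_filter hSA)]
    push_cast; rfl
  have hdc : ∑ v ∈ S, (#(A.filter (G.Adj v)) : ℝ) = ∑ v ∈ A, (#(S.filter (G.Adj v)) : ℝ) := by
    have := sum_card_bipartiteAbove_eq_sum_card_bipartiteBelow (s := S) (t := A) G.Adj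
    simp only [bipartiteAbove, bipartiteBelow] at this
    simp only [G.adj_comm] at this ⊢
    exact_mod_cast this
  have h1 : ∑ v ∈ S, (#(S.filter (G.Adj v)) : ℝ) ≤ s * s := by
    calc _ ≤ ∑ v ∈ S, (s : ℝ) := sum_le_sum fun v _ => by
          rw [← hS]; exact_mod_cast card_filter_le _ _
      _ = s * s := by rw [sum_const, hS, nsmul_eq_mul]
  have h2 : ∑ v ∈ A, (#(S.filter (G.Adj v)) : ℝ) ≤ a * s * (ε * s) := by
    calc _ ≤ ∑ v ∈ A, ε * s := sum_le_sum hcross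
      _ = a * s * (ε * s) := by rw [sum_const, hA, nsmul_eq_mul]; push_cast; rfl
  rw [sum_union hSA]
  simp only [hsplit, sum_add_distrib]
  rw [hdc]
  push_cast
  nlinarith [mul_nonneg hε (sq_nonneg (s : ℝ))]

open Finset Classical in
/-- In a graph where every large set of vertices contains `s` almost-twins, one can repeatedly
extract `m` such classes and assemble them into a sparse part and a co-sparse part. -/
theorem exists_sparse_and_dense_parts {V : Type*} (G : SimpleGraph V) {s : ℕ} (hs : 0 < s)
    {t ε c : ℝ} (hε : 0 < ε) (hc : c ≤ ε / 4) (hst : 4 * (s : ℝ) ≤ t)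
    (H : ∀ W : Finset V, t ≤ #W → ∃ x, ∃ S ⊆ W, #S = s ∧
      ∀ y ∈ S, (#(W.filter (fun z => ¬ (G.Adj x z ↔ G.Adj y z))) : ℝ) ≤ c * #W)
    (m : ℕ) : ∀ W : Finset V, 4 ^ m * t ≤ #W → ∃ (a b : ℕ) (A B : Finset V), a + b = m ∧
      A ⊆ W ∧ B ⊆ W ∧ #A = a * s ∧ #B = b * s ∧
      ∑ v ∈ A, (#(A.filter (G.Adj v)) : ℝ) ≤ a * (s : ℝ) ^ 2 + ε * (a * s : ℝ) ^ 2 ∧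
      ∑ v ∈ B, (#(B.filter (Gᶜ.Adj v)) : ℝ) ≤ b * (s : ℝ) ^ 2 + ε * (b * s : ℝ) ^ 2 := by
  induction m with
  | zero => exact fun W _ => ⟨0, 0, ∅, ∅, by simp⟩
  | succ m ih =>
    intro W hW
    have hs' : (0 : ℝ) < s := by exact_mod_cast hs
    have ht : 0 < t := by linarith
    have h4 : (1 : ℝ) ≤ 4 ^ m := one_le_pow₀ (by norm_num)
    have htW : 4 * t ≤ #W := by
      rw [pow_succ] at hW
      nlinarith
    obtain ⟨x, S, hSW, hSs, hS⟩ := H W (by linarith)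
    set mis : V → Finset V := fun z => S.filter (fun y => ¬ (G.Adj x z ↔ G.Adj y z)) with hmis
    set bad := W.filter (fun z => ε * s < (#(mis z) : ℝ)) with hbad
    have hbadcard : (#bad : ℝ) ≤ #W / 4 := by
      have h1 := mul_card_filter_lt_le_sum W (fun z => (#(mis z) : ℝ))
        (fun _ _ => by positivity) (ε * s)
      have h2 : ∑ z ∈ W, (#(mis z) : ℝ) ≤ s * (c * #W) := by
        have e := sum_card_bipartiteAbove_eq_sum_card_bipartiteBelow (s := S) (t := W)
          (fun y z => ¬ (G.Adj x z ↔ G.Adj y z))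
        simp only [bipartiteAbove, bipartiteBelow] at e
        calc ∑ z ∈ W, (#(mis z) : ℝ)
            = ∑ y ∈ S, (#(W.filter (fun z => ¬ (G.Adj x z ↔ G.Adj y z))) : ℝ) := by
              exact_mod_cast e.symm
          _ ≤ ∑ y ∈ S, c * #W := sum_le_sum hS
          _ = s * (c * #W) := by rw [sum_const, hSs, nsmul_eq_mul]
      have hp : 0 < ε * s := by positivity
      refine le_of_mul_le_mul_left ?_ hp
      calc _ ≤ s * (c * #W) := h1.trans h2
        _ ≤ s * (ε / 4 * #W) := by gcongr
        _ = _ := by ring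
    set R := (W \ S) \ bad with hR
    have hRcard : (#W : ℝ) / 2 ≤ #R := by
      have e1 := le_card_sdiff S W
      have e2 := le_card_sdiff bad (W \ S)
      have e3 : #W ≤ #R + s + #bad := by rw [hR]; omega
      have e3' : (#W : ℝ) ≤ #R + s + #bad := by exact_mod_cast e3
      linarith
    have hRW : R ⊆ W := sdiff_subset.trans sdiff_subset
    have hRS : ∀ A ⊆ R, Disjoint S A := fun A hA =>
      disjoint_left.2 fun v hv hvA => (mem_sdiff.1 (mem_sdiff.1 (hA hvA)).1).2 hv
    have hRmis : ∀ z ∈ R, (#(mis z) : ℝ) ≤ ε * s := by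
      intro z hz
      by_contra! h
      exact (mem_sdiff.1 hz).2 (mem_filter.2 ⟨hRW hz, h⟩)
    have hsplit : (#(R.filter (G.Adj x)) : ℝ) + #(R.filter (fun z => ¬ G.Adj x z)) = #R := by
      exact_mod_cast card_filter_add_card_filter_not (s := R) (G.Adj x)
    have hbig : 4 ^ m * t ≤ (#W : ℝ) / 4 := by
      rw [pow_succ] at hW; linarith
    rcases le_or_gt ((#W : ℝ) / 4) #(R.filter (G.Adj x)) with hcase | hcase
    · obtain ⟨a, b, A, B, hab, hA, hB, hAc, hBc, hAs, hBs⟩ := ih _ (hbig.trans hcase)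
      have hBR := hB.trans (filter_subset _ _)
      refine ⟨a, b + 1, A, S ∪ B, by omega, hA.trans ((filter_subset _ _).trans hRW),
        union_subset hSW (hBR.trans hRW), hAc, ?_, hAs, ?_⟩
      · rw [card_union_of_disjoint (hRS B hBR), hSs, hBc]; ring
      · suffices hcross : ∀ z ∈ B, (#(S.filter (Gᶜ.Adj z)) : ℝ) ≤ ε * s by
          convert sum_card_filter_adj_union_le Gᶜ hε.le (hRS B hBR) hSs hBc
            (by convert hcross) (by convert hBs)
        intro z hz
        refine le_trans ?_ (hRmis z (hBR hz))
        have hxz := (mem_filter.1 (hB hz)).2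
        refine Nat.cast_le.2 (card_le_card fun y hy => ?_)
        rw [mem_filter] at hy ⊢
        exact ⟨hy.1, fun h => ((G.compl_adj z y).1 hy.2).2 (h.1 hxz).symm⟩
    · obtain ⟨a, b, A, B, hab, hA, hB, hAc, hBc, hAs, hBs⟩ :=
        ih (R.filter (fun z => ¬ G.Adj x z)) (by linarith)
      have hAR := hA.trans (filter_subset _ _)
      refine ⟨a + 1, b, S ∪ A, B, by omega, union_subset hSW (hAR.trans hRW),
        hB.trans ((filter_subset _ _).trans hRW), ?_, hBc, ?_, hBs⟩
      · rw [card_union_of_disjoint (hRS A hAR), hSs, hAc]; ring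
      · refine sum_card_filter_adj_union_le G hε.le (hRS A hAR) hSs hAc ?_ hAs
        intro z hz
        refine le_trans ?_ (hRmis z (hAR hz))
        have hxz := (mem_filter.1 (hA hz)).2
        refine Nat.cast_le.2 (card_le_card fun y hy => ?_)
        rw [mem_filter] at hy ⊢
        exact ⟨hy.1, fun h => hxz (h.2 hy.2.symm)⟩

open Finset Classical in
theorem exists_almost_twins_of_not_diverse {V : Type*} (G : SimpleGraph V) (W : Finset V)
    {c δ : ℝ} (h : ¬ Diverse c δ (G.induce (W : Set V))) :
    ∃ x, ∃ S ⊆ W, (#W : ℝ) ^ δ < #S ∧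
      ∀ y ∈ S, (#(W.filter (fun z => ¬ (G.Adj x z ↔ G.Adj y z))) : ℝ) ≤ c * #W := by
  unfold Diverse at h
  push Not at h
  obtain ⟨x, hx⟩ := h
  have hcard : Fintype.card (W : Set V) = #W := by simp
  rw [hcard] at hx
  set T : Set (W : Set V) := {y | ((symmDiff ((G.induce (W : Set V)).neighborSet x)
    ((G.induce (W : Set V)).neighborSet y)).ncard : ℝ) < c * (#W : ℝ)} with hT
  refine ⟨x, T.toFinset.map (Function.Embedding.subtype _), ?_, ?_, ?_⟩
  · intro v hv
    obtain ⟨w, -, rfl⟩ := mem_map.1 hv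
    exact w.2
  · rw [card_map, ← Set.ncard_eq_toFinset_card']
    exact hx
  · intro v hv
    obtain ⟨y, hy, rfl⟩ := mem_map.1 hv
    rw [Set.mem_toFinset, hT, Set.mem_ofPred_eq] at hy
    refine le_trans (le_of_eq ?_) hy.le
    rw [← Set.ncard_coe_finset, ← Set.ncard_image_of_injective _ Subtype.val_injective]
    congr 2
    ext z
    simp only [coe_filter, Set.mem_ofPred_eq, Set.mem_image, Set.mem_symmDiff,
      SimpleGraph.mem_neighborSet, SimpleGraph.comap_adj, Subtype.exists]
    constructor
    · rintro ⟨hz, h⟩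
      refine ⟨z, hz, ?_, rfl⟩
      simp only [Function.Embedding.subtype_apply] at h ⊢
      tauto
    · rintro ⟨z', hz, h, rfl⟩
      refine ⟨hz, ?_⟩
      simp only [Function.Embedding.subtype_apply] at h ⊢
      tauto

theorem Diverse.mono {V : Type*} [Fintype V] {G : SimpleGraph V} {c c' δ : ℝ}
    (h : Diverse c δ G) (hc : c' ≤ c) : Diverse c' δ G := by
  intro x
  refine le_trans (Nat.cast_le.2 (Set.ncard_le_ncard ?_ (Set.toFinite _))) (h x)
  intro y hy
  rw [Set.mem_ofPred_eq] at hy ⊢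
  exact hy.trans_le (by gcongr)

open Filter in
theorem eventually_numeric_bounds {c δ : ℝ} (hc : 0 < c) (hδ : 0 < δ) (hδ' : δ ≤ 1 / 2) (N : ℕ) :
    ∀ᶠ n : ℕ in atTop, 1 ≤ n ∧ N ≤ ⌊(c * n) ^ δ⌋₊ ∧ 1 ≤ c * (n : ℝ) ∧
      (n : ℝ) ^ (δ / 2) ≤ ⌊(c * n) ^ δ⌋₊ ∧ 4 * (⌊(c * n) ^ δ⌋₊ : ℝ) ≤ c * n := by
  have hu : Tendsto (fun n : ℕ => (n : ℝ) ^ (δ / 2)) atTop atTop :=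
    (tendsto_rpow_atTop (by positivity)).comp tendsto_natCast_atTop_atTop
  have hcn : Tendsto (fun n : ℕ => c * (n : ℝ)) atTop atTop :=
    tendsto_natCast_atTop_atTop.const_mul_atTop hc
  have hcδ : 0 < c ^ δ := by positivity
  filter_upwards [eventually_ge_atTop 1, hu.eventually_ge_atTop (N : ℝ),
    hu.eventually_ge_atTop (2 / c ^ δ), hu.eventually_ge_atTop 1,
    hcn.eventually_ge_atTop 16] with n hn1 hnN hn2 hnu hn16
  have hexp : (c * n : ℝ) ^ δ = c ^ δ * ((n : ℝ) ^ (δ / 2) * (n : ℝ) ^ (δ / 2)) := by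
    have : (0 : ℝ) < n := by exact_mod_cast hn1
    rw [Real.mul_rpow hc.le this.le, ← Real.rpow_add this, add_halves]
  have hfl : (n : ℝ) ^ (δ / 2) ≤ ⌊(c * n) ^ δ⌋₊ := by
    have h1 := Nat.lt_floor_add_one ((c * n : ℝ) ^ δ)
    rw [div_le_iff₀ hcδ] at hn2
    have h2 : 2 * (n : ℝ) ^ (δ / 2) ≤ (c * n : ℝ) ^ δ := by
      rw [hexp]; nlinarith
    linarith
  refine ⟨hn1, by exact_mod_cast hnN.trans hfl, by linarith, hfl, ?_⟩
  have h1 : (⌊(c * n) ^ δ⌋₊ : ℝ) ≤ (c * n : ℝ) ^ δ := Nat.floor_le (by positivity)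
  have h2 : (c * n : ℝ) ^ δ ≤ Real.sqrt (c * n) := by
    rw [Real.sqrt_eq_rpow]
    exact Real.rpow_le_rpow_of_exponent_le (by linarith) hδ'
  have h3 : 4 ≤ Real.sqrt (c * n) := Real.le_sqrt_of_sq_le (by linarith)
  have h4 : Real.sqrt (c * n) * Real.sqrt (c * n) = c * n := Real.mul_self_sqrt (by linarith)
  nlinarith

open Finset Filter Classical in
/-- The case of large `n`. -/
theorem eventually_exists_diverse (C δ : ℝ) (hC : 0 < C) (hδ : 0 < δ) :
    ∃ c : ℝ, 0 < c ∧ ∀ᶠ n : ℕ in atTop, ∀ G : SimpleGraph (Fin n), IsCRamsey C G →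
      ∃ S : Finset (Fin n), c * n ≤ (S.card : ℝ) ∧
        Diverse c δ (G.induce (S : Set (Fin n))) := by
  set δ₀ := min δ (1 / 2) with hδ₀
  have hδ₀pos : 0 < δ₀ := lt_min hδ (by norm_num)
  obtain ⟨ε, hε, N₀, hES⟩ := exists_homogeneous_of_sparse (2 * C / δ₀) (by positivity)
  obtain ⟨K, hK⟩ := exists_nat_ge (2 / ε)
  have hKpos : 0 < K := by
    have : (0 : ℝ) < K := lt_of_lt_of_le (by positivity) hK
    exact_mod_cast this
  rw [div_le_iff₀ hε] at hK
  set c : ℝ := min (ε / 2 / 4) (1 / 4 ^ (2 * K)) with hcdef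
  have hc : 0 < c := lt_min (by positivity) (by positivity)
  refine ⟨c, hc, ?_⟩
  filter_upwards [eventually_numeric_bounds hc hδ₀pos (min_le_right _ _) (max 1 N₀)]
    with n ⟨hn1, hNs, hcn, hns, hst⟩ G hG
  set s := ⌊(c * n) ^ δ₀⌋₊ with hs
  by_contra! hcon
  have hspos : 0 < s := (le_max_left 1 N₀).trans hNs
  have hnpos : (0 : ℝ) < n := by exact_mod_cast hn1
  have H : ∀ W : Finset (Fin n), c * n ≤ #W → ∃ x, ∃ S ⊆ W, #S = s ∧
      ∀ y ∈ S, (#(W.filter (fun z => ¬ (G.Adj x z ↔ G.Adj y z))) : ℝ) ≤ c * #W := by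
    intro W hW
    obtain ⟨x, S, hSW, hSc, hS⟩ := exists_almost_twins_of_not_diverse G W (hcon W hW)
    have hsS : s ≤ #S := by
      have h1 : (s : ℝ) ≤ (c * n) ^ δ₀ := Nat.floor_le (by positivity)
      have h2 : (c * n : ℝ) ^ δ₀ ≤ (#W : ℝ) ^ δ₀ := by gcongr
      have h3 : (#W : ℝ) ^ δ₀ ≤ (#W : ℝ) ^ δ :=
        Real.rpow_le_rpow_of_exponent_le (by linarith) (min_le_left _ _)
      exact_mod_cast (by linarith : (s : ℝ) ≤ #S)
    obtain ⟨S', hS', hS'c⟩ := exists_subset_card_eq hsS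
    exact ⟨x, S', hS'.trans hSW, hS'c, fun y hy => hS y (hS' hy)⟩
  have hstart : 4 ^ (2 * K) * (c * n) ≤ (#(univ : Finset (Fin n)) : ℝ) := by
    have h1 : c * 4 ^ (2 * K) ≤ 1 := by
      rw [← le_div_iff₀ (by positivity)]; exact min_le_right _ _
    rw [card_univ, Fintype.card_fin]
    nlinarith
  obtain ⟨a, b, A, B, hab, -, -, hAc, hBc, hA, hB⟩ := exists_sparse_and_dense_parts G hspos
    (half_pos hε) (min_le_left _ _) hst H (2 * K) univ hstart
  have key : ∀ (F : SimpleGraph (Fin n)) (d : ℕ) (D : Finset (Fin n)), IsCRamsey C F → K ≤ d →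
      #D = d * s → ∑ v ∈ D, (#(D.filter (F.Adj v)) : ℝ) ≤
        d * (s : ℝ) ^ 2 + ε / 2 * (d * s : ℝ) ^ 2 → False := by
    intro F d D hF hd hDc hD
    have hsD : s ≤ #D := by rw [hDc]; exact Nat.le_mul_of_pos_left s (hKpos.trans_le hd)
    obtain ⟨J, -, hJ, hJc⟩ := hES _ F D ((le_max_right 1 N₀).trans (hNs.trans hsD)) (by
      refine hD.trans ?_
      rw [hDc]
      push_cast
      have hd' : (K : ℝ) ≤ d := by exact_mod_cast hd
      have h2 : 2 ≤ d * ε := hK.trans (by gcongr)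
      have h3 : 0 ≤ (d : ℝ) * (s : ℝ) ^ 2 := by positivity
      nlinarith)
    have hle := hF J hJ
    rw [Fintype.card_fin] at hle
    have hlog : δ₀ / 2 * Real.logb 2 n ≤ Real.logb 2 #D := by
      rw [← Real.logb_rpow_eq_mul_logb_of_pos hnpos]
      refine Real.logb_le_logb_of_le (by norm_num) (by positivity) (hns.trans ?_)
      exact_mod_cast hsD
    have h5 : C * Real.logb 2 n ≤ 2 * C / δ₀ * Real.logb 2 #D := by
      calc C * Real.logb 2 n = 2 * C / δ₀ * (δ₀ / 2 * Real.logb 2 n) := by field_simp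
        _ ≤ _ := by gcongr
    linarith
  rcases le_or_gt K a with ha | ha
  · exact key G a A hG ha hAc hA
  · refine key Gᶜ b B (fun J hJ => hG J ?_) (by omega) hBc (by convert hB)
    rw [compl_compl] at hJ
    exact hJ.symm

theorem diverse_of_subsingleton {V : Type*} [Fintype V] [Subsingleton V] (G : SimpleGraph V)
    (c δ : ℝ) : Diverse c δ G := by
  intro x
  have h : Fintype.card V = 1 := Fintype.card_eq_one_iff.2 ⟨x, fun y => Subsingleton.elim _ _⟩
  rw [h, Nat.cast_one, Real.one_rpow]
  exact_mod_cast Set.ncard_le_one_of_subsingleton _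

/-- Theorem (Bukh–Sudakov): for any `C, δ > 0` there is `c > 0` such that for all `n`,
every `C`-Ramsey graph on `n` vertices contains a `(c, δ)`-diverse induced subgraph
on at least `c n` vertices. -/
theorem ramsey_diverse_subgraph (C δ : ℝ) (hC : 0 < C) (hδ : 0 < δ) :
    ∃ c : ℝ, 0 < c ∧ ∀ n : ℕ, ∀ G : SimpleGraph (Fin n), IsCRamsey C G →
      ∃ S : Finset (Fin n), c * n ≤ (S.card : ℝ) ∧
        Diverse c δ (G.induce (S : Set (Fin n))) := by
  obtain ⟨c, hc, h⟩ := eventually_exists_diverse C δ hC hδ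
  obtain ⟨N, hN⟩ := Filter.eventually_atTop.1 h
  refine ⟨min c (1 / (N + 1)), lt_min hc (by positivity), fun n G hG => ?_⟩
  rcases le_or_gt N n with hn | hn
  · obtain ⟨S, hS, hdiv⟩ := hN n hn G hG
    exact ⟨S, le_trans (by gcongr; exact min_le_left _ _) hS, hdiv.mono (min_le_left _ _)⟩
  rcases n.eq_zero_or_pos with rfl | hpos
  · exact ⟨∅, by simp, fun x => x.1.elim0⟩
  refine ⟨{⟨0, hpos⟩}, ?_, ?_⟩
  · have hn' : (n : ℝ) ≤ N + 1 := by exact_mod_cast (by omega : n ≤ N + 1)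
    calc min c (1 / (N + 1)) * (n : ℝ) ≤ 1 / (N + 1) * (N + 1) := by
          gcongr; exact min_le_right _ _
      _ = _ := by simp; field_simp
  · have : Subsingleton (({⟨0, hpos⟩} : Finset (Fin n)) : Set (Fin n)) := by
      rw [Finset.coe_singleton]; infer_instance
    exact diverse_of_subsingleton _ _ _
end

section
/- For all integers a, b with 1 ≤ a ≤ b and every real p with 0 < p < 1, Σ_{i=0}^{a} C(a,i)·C(b,i)·p^{2i}·(1−p)^{a+b−2i} < 10/√(p(1−p)b). Equivalently, if X and Y are independent binomial random variables with X ~ Bin(a,p) and Y ~ Bin(b,p), then P(X = Y) < 10/√(p(1−p)b). -/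
open Real in
theorem factorial_sq_mul_exp_le {n : ℕ} (hn : n ≠ 0) :
    (n.factorial : ℝ) ^ 2 * exp 1 ^ (2 * n) ≤ exp 1 ^ 2 * n * (n : ℝ) ^ (2 * n) := by
  obtain ⟨m, rfl⟩ := Nat.exists_eq_succ_of_ne_zero hn
  have h : Stirling.stirlingSeq (m + 1) ≤ Stirling.stirlingSeq 1 :=
    Stirling.stirlingSeq'_antitone (Nat.zero_le m)
  have h2 := pow_le_pow_left₀ (Stirling.stirlingSeq'_pos m).le h 2
  rw [Stirling.stirlingSeq_one, Stirling.stirlingSeq, div_pow, mul_pow,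
    Real.sq_sqrt (by positivity), div_pow (exp 1) (√2), Real.sq_sqrt (by positivity), div_le_div_iff₀ (by positivity)
    (by positivity), div_pow, div_pow, ← pow_mul, ← pow_mul, mul_comm (m + 1) 2] at h2
  have he : (0 : ℝ) < exp 1 ^ (2 * (m + 1)) := by positivity
  rw [← mul_div_assoc, ← mul_div_assoc, le_div_iff₀ he] at h2
  push_cast [Nat.succ_eq_add_one] at h2 ⊢
  linarith

open Real in
theorem two_mul_add_one_pow_le_factorial_sq (k : ℕ) :
    (2 * k + 1 : ℝ) ^ (2 * k + 1) ≤ 2 * (k.factorial : ℝ) ^ 2 * (2 * exp 1) ^ (2 * k) := by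
  rcases Nat.eq_zero_or_pos k with rfl | hk
  · norm_num
  have hk1 : (1 : ℝ) ≤ k := by exact_mod_cast hk
  have hst := pow_le_pow_left₀ (by positivity) (Stirling.le_factorial_stirling k) 2
  rw [mul_pow, Real.sq_sqrt (by positivity), div_pow, div_pow, ← pow_mul, ← pow_mul,
    mul_comm k 2, ← mul_div_assoc, div_le_iff₀ (by positivity)] at hst
  have hexp : (1 + 1 / (2 * k : ℝ)) ^ (2 * k + 1) ≤ 6 := by
    have h1 : 1 + 1 / (2 * k : ℝ) ≤ exp (1 / (2 * k : ℝ)) := by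
      linarith [add_one_le_exp (1 / (2 * k : ℝ))]
    have h2 : exp (1 / (2 * k : ℝ)) ^ (2 * k + 1) ≤ exp (3 / 2) := by
      rw [← exp_nat_mul]
      apply exp_le_exp.mpr
      push_cast
      rw [mul_one_div, div_le_div_iff₀ (by positivity) (by norm_num)]
      linarith
    have h3 : exp (3 / 2) ≤ 6 := by
      have h4 : exp (3 / 2) ^ 2 = exp 1 ^ 3 := by
        rw [← exp_nat_mul, ← exp_nat_mul]; norm_num
      have h5 : exp 1 ^ 3 ≤ 3 ^ 3 := pow_le_pow_left₀ (exp_pos 1).le exp_one_lt_three.le 3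
      nlinarith [exp_pos (3 / 2)]
    exact (pow_le_pow_left₀ (by positivity) h1 _).trans (h2.trans h3)
  have hsplit : (2 * k + 1 : ℝ) = (2 * k) * (1 + 1 / (2 * k)) := by field_simp
  calc (2 * k + 1 : ℝ) ^ (2 * k + 1)
      = (2 * k) ^ (2 * k + 1) * (1 + 1 / (2 * k : ℝ)) ^ (2 * k + 1) := by
        rw [hsplit, mul_pow]
    _ ≤ (2 * k) ^ (2 * k + 1) * (2 * π) := by
        gcongr
        linarith [pi_gt_three]
    _ = 2 * 2 ^ (2 * k) * (2 * π * k * (k : ℝ) ^ (2 * k)) := by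
        rw [mul_pow]; ring
    _ ≤ 2 * 2 ^ (2 * k) * ((k.factorial : ℝ) ^ 2 * exp 1 ^ (2 * k)) := by gcongr
    _ = _ := by rw [mul_pow]; ring

open Real in
theorem pow_mul_pow_le_of_add_eq_one {p q : ℝ} (hp : 0 ≤ p) (hq : 0 ≤ q) (hpq : p + q = 1)
    {r s : ℕ} (hr : r ≠ 0) (hs : s ≠ 0) :
    p ^ r * q ^ s * (r + s : ℝ) ^ (r + s) ≤ (r : ℝ) ^ r * (s : ℝ) ^ s := by
  have key : ∀ (x : ℝ) (t : ℕ), 0 ≤ x → t ≠ 0 →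
      (x * (r + s)) ^ t ≤ (t : ℝ) ^ t * exp (x * (r + s) - t) := by
    intro x t hx ht
    have ht' : (t : ℝ) ≠ 0 := by exact_mod_cast ht
    have h : x * (r + s) / t ≤ exp (x * (r + s) / t - 1) := by
      linarith [add_one_le_exp (x * (r + s) / t - 1)]
    have h2 := pow_le_pow_left₀ (by positivity) h t
    rw [← exp_nat_mul, div_pow, div_le_iff₀ (by positivity), mul_sub, mul_div_cancel₀ _ ht',
      mul_one] at h2
    linarith
  calc p ^ r * q ^ s * (r + s : ℝ) ^ (r + s)
      = (p * (r + s)) ^ r * (q * (r + s)) ^ s := by rw [mul_pow, mul_pow, pow_add]; ring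
    _ ≤ ((r : ℝ) ^ r * exp (p * (r + s) - r)) * ((s : ℝ) ^ s * exp (q * (r + s) - s)) :=
        mul_le_mul (key p r hp hr) (key q s hq hs) (by positivity) (by positivity)
    _ = (r : ℝ) ^ r * (s : ℝ) ^ s * exp ((p * (r + s) - r) + (q * (r + s) - s)) := by
        rw [exp_add]; ring
    _ = _ := by
        have : (p * (r + s) - r) + (q * (r + s) - s) = 0 := by
          linear_combination (r + s : ℝ) * hpq
        rw [this, exp_zero, mul_one]

open Real in
theorem choose_mul_pow_mul_pow_sq_le {n k : ℕ} (hn : n ≠ 0) (hk : k ≤ n) {p q : ℝ}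
    (hp : 0 ≤ p) (hq : 0 ≤ q) (hpq : p + q = 1) :
    (n.choose k * p ^ k * q ^ (n - k)) ^ 2 * (p * q * n) ≤ 9 := by
  obtain ⟨m, rfl⟩ := Nat.exists_eq_add_of_le hk
  rw [Nat.add_sub_cancel_left]
  have hfac : ((k + m).choose k : ℝ) * k.factorial * m.factorial = (k + m).factorial := by
    have := Nat.choose_mul_factorial_mul_factorial hk
    rw [Nat.add_sub_cancel_left] at this
    exact_mod_cast this
  have hamgm := pow_mul_pow_le_of_add_eq_one hp hq hpq (r := 2 * k + 1) (s := 2 * m + 1)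
    (by omega) (by omega)
  have hup := factorial_sq_mul_exp_le hn
  have hK := two_mul_add_one_pow_le_factorial_sq k
  have hM := two_mul_add_one_pow_le_factorial_sq m
  have hexp : 2 * k + 1 + (2 * m + 1) = 2 * (k + m) + 2 := by ring
  rw [hexp] at hamgm
  push_cast at hamgm hup ⊢
  have hn0 : (0 : ℝ) < k + m := by exact_mod_cast Nat.pos_of_ne_zero hn
  set N : ℝ := k + m with hN
  have hbase : (2 * k + 1 + (2 * m + 1) : ℝ) = 2 * N + 2 := by rw [hN]; ring
  rw [hbase] at hamgm
  have hDpos : (0 : ℝ) < (2 * N + 2) ^ (2 * (k + m) + 2) := by positivity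
  have hD : 4 * N ^ 2 * (2 * N) ^ (2 * (k + m)) ≤ (2 * N + 2) ^ (2 * (k + m) + 2) := by
    calc 4 * N ^ 2 * (2 * N) ^ (2 * (k + m)) = (2 * N) ^ (2 * (k + m) + 2) := by ring
      _ ≤ _ := by gcongr; linarith
  have he : exp 1 ^ 2 ≤ 9 := by nlinarith [exp_pos 1, exp_one_lt_three]
  refine le_of_mul_le_mul_right ?_ hDpos
  calc ((k + m).choose k * p ^ k * q ^ m) ^ 2 * (p * q * N) * (2 * N + 2) ^ (2 * (k + m) + 2)
      = ((k + m).choose k : ℝ) ^ 2 * N *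
          (p ^ (2 * k + 1) * q ^ (2 * m + 1) * (2 * N + 2) ^ (2 * (k + m) + 2)) := by ring
    _ ≤ ((k + m).choose k : ℝ) ^ 2 * N *
          ((2 * k.factorial ^ 2 * (2 * exp 1) ^ (2 * k)) *
            (2 * m.factorial ^ 2 * (2 * exp 1) ^ (2 * m))) := by
        refine mul_le_mul_of_nonneg_left ?_ (by positivity)
        exact hamgm.trans (mul_le_mul hK hM (by positivity) (by positivity))
    _ = 4 * N * 2 ^ (2 * (k + m)) * (((k + m).choose k * k.factorial * m.factorial : ℝ) ^ 2 *
          exp 1 ^ (2 * (k + m))) := by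
        simp only [mul_pow, mul_add, pow_add]; ring
    _ ≤ 4 * N * 2 ^ (2 * (k + m)) * (exp 1 ^ 2 * N * N ^ (2 * (k + m))) := by
        rw [hfac]; gcongr
    _ = exp 1 ^ 2 * (4 * N ^ 2 * (2 * N) ^ (2 * (k + m))) := by
        rw [mul_pow 2 N (2 * (k + m))]; ring
    _ ≤ 9 * (2 * N + 2) ^ (2 * (k + m) + 2) := by gcongr

/-- If `X ~ Bin(a, p)` and `Y ~ Bin(b, p)` are independent with `1 ≤ a ≤ b` and `0 < p < 1`,
then `P(X = Y) = ∑_{i=0}^{a} C(a,i) C(b,i) p^{2i} (1-p)^{a+b-2i} < 10 / √(p(1-p)b)`. -/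
theorem binomial_collision_bound (a b : ℕ) (ha : 1 ≤ a) (hab : a ≤ b)
    (p : ℝ) (hp : 0 < p) (hp1 : p < 1) :
    ∑ i ∈ Finset.range (a + 1),
        (a.choose i : ℝ) * (b.choose i : ℝ) * p ^ (2 * i) * (1 - p) ^ (a + b - 2 * i)
      < 10 / Real.sqrt (p * (1 - p) * b) := by
  have hq : 0 < 1 - p := sub_pos.mpr hp1
  have hb : b ≠ 0 := by omega
  have hb0 : (0 : ℝ) < b := by exact_mod_cast Nat.pos_of_ne_zero hb
  set S := Real.sqrt (p * (1 - p) * b) with hS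
  have hSpos : 0 < S := Real.sqrt_pos.mpr (by positivity)
  have hpmf : ∀ i ≤ b, (b.choose i : ℝ) * p ^ i * (1 - p) ^ (b - i) ≤ 3 / S := by
    intro i hi
    rw [le_div_iff₀ hSpos]
    refine le_of_sq_le_sq ?_ (by norm_num)
    rw [mul_pow, hS, Real.sq_sqrt (by positivity)]
    linarith [choose_mul_pow_mul_pow_sq_le hb hi hp.le hq.le (add_sub_cancel p 1)]
  calc ∑ i ∈ Finset.range (a + 1),
        (a.choose i : ℝ) * (b.choose i : ℝ) * p ^ (2 * i) * (1 - p) ^ (a + b - 2 * i)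
      ≤ ∑ i ∈ Finset.range (a + 1), p ^ i * (1 - p) ^ (a - i) * a.choose i * (3 / S) := by
        refine Finset.sum_le_sum fun i hi => ?_
        have hia : i ≤ a := Nat.lt_succ_iff.mp (Finset.mem_range.mp hi)
        have hexp : a + b - 2 * i = (a - i) + (b - i) := by omega
        calc _ = p ^ i * (1 - p) ^ (a - i) * a.choose i *
              ((b.choose i : ℝ) * p ^ i * (1 - p) ^ (b - i)) := by
              rw [hexp, pow_add, two_mul, pow_add]; ring
          _ ≤ _ := mul_le_mul_of_nonneg_left (hpmf i (hia.trans hab)) (by positivity)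
    _ = 3 / S := by
        rw [← Finset.sum_mul, ← add_pow, add_sub_cancel, one_pow, one_mul]
    _ < 10 / S := by gcongr; norm_num
end

section
/- Let a and b be positive integers and set s = a + b. Then for all integers x, y with 0 ≤ y ≤ x and 1 ≤ x ≤ s − 1, one has C(a,y)·C(b,x−y)·C(s,x)^{-1} ≤ 10·√(s³/(x(s−x)ab)). -/
open MeasureTheory Real

lemma integral_cexp_int_mul_I (m : ℤ) :
    ∫ t in (-π)..π, Complex.exp ((m * Complex.I) * t) = if m = 0 then 2 * (π : ℂ) else 0 := by
  split_ifs with h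
  · subst h; simp; ring
  · have hm : (m : ℂ) * Complex.I ≠ 0 := mul_ne_zero (by exact_mod_cast h) Complex.I_ne_zero
    rw [integral_exp_mul_complex hm, div_eq_zero_iff, sub_eq_zero]
    left
    rw [Complex.exp_eq_exp_iff_exists_int]
    exact ⟨m, by push_cast; ring⟩

lemma integral_binomial_charFun (n y : ℕ) (hy : y ≤ n) (p q : ℝ) :
    ∫ t in (-π)..π, ((p : ℂ) * Complex.exp (Complex.I * t) + q) ^ n
        * Complex.exp (-(y * Complex.I) * t)
      = 2 * π * ((n.choose y : ℂ) * p ^ y * q ^ (n - y)) := by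
  have hexp : ∀ t : ℝ, ((p : ℂ) * Complex.exp (Complex.I * t) + q) ^ n
      * Complex.exp (-(y * Complex.I) * t)
      = ∑ k ∈ Finset.range (n + 1), ((n.choose k : ℂ) * p ^ k * q ^ (n - k))
        * Complex.exp ((((k : ℤ) - (y : ℤ) : ℤ) * Complex.I) * t) := by
    intro t
    rw [add_pow, Finset.sum_mul]
    refine Finset.sum_congr rfl fun k _ => ?_
    have : Complex.exp ((((k : ℤ) - (y : ℤ) : ℤ) * Complex.I) * t)
        = Complex.exp (Complex.I * t) ^ k * Complex.exp (-(y * Complex.I) * t) := by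
      rw [← Complex.exp_nat_mul, ← Complex.exp_add]
      congr 1
      push_cast
      ring
    rw [this, mul_pow]
    ring
  simp_rw [hexp]
  rw [intervalIntegral.integral_finsetSum
    fun k _ => Continuous.intervalIntegrable (by fun_prop) _ _]
  simp_rw [intervalIntegral.integral_const_mul, integral_cexp_int_mul_I]
  rw [Finset.sum_eq_single y]
  · simp; ring
  · intro k _ hk
    rw [if_neg (by omega), mul_zero]
  · intro h
    exact absurd (Finset.mem_range.2 (by omega)) h

lemma norm_bernoulli_charFun_le {p q t : ℝ} (hp : 0 ≤ p) (hq : 0 ≤ q) (hpq : p + q = 1)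
    (ht : |t| ≤ π) :
    ‖(p : ℂ) * Complex.exp (Complex.I * t) + q‖ ≤ rexp (-(2 * (p * q) / π ^ 2) * t ^ 2) := by
  refine le_of_sq_le_sq ?_ (exp_pos _).le
  have hsq : ‖(p : ℂ) * Complex.exp (Complex.I * t) + q‖ ^ 2 = 1 - 2 * (p * q) * (1 - cos t) := by
    rw [← Complex.normSq_eq_norm_sq, mul_comm Complex.I, Complex.exp_mul_I, Complex.normSq_apply]
    simp [← Complex.ofReal_cos, ← Complex.ofReal_sin]
    obtain rfl : q = 1 - p := by linarith
    linear_combination p ^ 2 * sin_sq_add_cos_sq t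
  rw [hsq, ← exp_nat_mul]
  have hcos := cos_le_one_sub_mul_cos_sq ht
  have h1 := mul_le_mul_of_nonneg_left hcos (mul_nonneg hp hq)
  have h2 := add_one_le_exp (((2 : ℕ) : ℝ) * (-(2 * (p * q) / π ^ 2) * t ^ 2))
  refine le_trans ?_ h2
  have h3 : ((2 : ℕ) : ℝ) * (-(2 * (p * q) / π ^ 2) * t ^ 2)
      = -(2 * (p * q * (2 / π ^ 2 * t ^ 2))) := by
    push_cast; ring
  rw [h3]
  linarith

/-- A local bound on the binomial distribution, uniform in the point `y`. -/
lemma choose_mul_pow_le (n y : ℕ) (hn : 0 < n) (hy : y ≤ n) {p q : ℝ} (hp : 0 < p) (hq : 0 < q)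
    (hpq : p + q = 1) :
    (n.choose y : ℝ) * p ^ y * q ^ (n - y) ≤ √(1 / (n * (p * q))) := by
  have hn' : (0 : ℝ) < n := by exact_mod_cast hn
  have hpos : 0 < p * q := mul_pos hp hq
  set c : ℝ := 2 * (n * (p * q)) / π ^ 2 with hc
  have hcpos : 0 < c := by positivity
  have hint := integral_binomial_charFun n y hy p q
  have hle : ‖∫ t in (-π)..π, ((p : ℂ) * Complex.exp (Complex.I * t) + q) ^ n
        * Complex.exp (-(y * Complex.I) * t)‖ ≤ ∫ t in (-π)..π, rexp (-c * t ^ 2) := by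
    refine intervalIntegral.norm_integral_le_of_norm_le (by linarith [pi_pos]) ?_
      (Continuous.intervalIntegrable (by fun_prop) _ _)
    refine Filter.Eventually.of_forall fun t ht => ?_
    have h1 := norm_bernoulli_charFun_le hp.le hq.le hpq (abs_le.2 ⟨ht.1.le, ht.2⟩)
    have h2 : ‖Complex.exp (-(y * Complex.I) * t)‖ = 1 := by
      simp [Complex.norm_exp]
    rw [norm_mul, norm_pow, h2, mul_one]
    refine (pow_le_pow_left₀ (norm_nonneg _) h1 n).trans_eq ?_
    rw [← exp_nat_mul, hc]
    congr 1
    ring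
  have hgauss : ∫ t in (-π)..π, rexp (-c * t ^ 2) ≤ √(π / c) := by
    rw [intervalIntegral.integral_of_le (by linarith [pi_pos]), ← integral_gaussian c]
    exact setIntegral_le_integral (integrable_exp_neg_mul_sq hcpos)
      (Filter.Eventually.of_forall fun t => (exp_pos _).le)
  have hnorm : ‖(2 * π * ((n.choose y : ℂ) * p ^ y * q ^ (n - y)) : ℂ)‖
      = 2 * π * ((n.choose y : ℝ) * p ^ y * q ^ (n - y)) := by
    simp [abs_of_pos hp, abs_of_pos hq, abs_of_pos pi_pos]
  have hbound : √(π / c) ≤ 2 * π * √(1 / (n * (p * q))) := by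
    rw [show 2 * π = √((2 * π) ^ 2) from (sqrt_sq (by positivity)).symm,
      ← sqrt_mul (by positivity)]
    refine sqrt_le_sqrt ?_
    have : π / c = π * π ^ 2 / 2 * (1 / (n * (p * q))) := by
      rw [hc]; field_simp
    rw [this]
    refine mul_le_mul_of_nonneg_right ?_ (by positivity)
    nlinarith [pi_le_four, sq_nonneg π]
  rw [hint, hnorm] at hle
  exact le_of_mul_le_mul_left (hle.trans (hgauss.trans hbound)) (by positivity)

lemma factorial_le_exp_mul_sqrt_mul_pow (n : ℕ) (hn : 0 < n) :
    (n.factorial : ℝ) ≤ rexp 1 * √n * (n / rexp 1) ^ n := by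
  obtain ⟨m, rfl⟩ := Nat.exists_eq_succ_of_ne_zero hn.ne'
  have h := Stirling.stirlingSeq'_antitone (Nat.zero_le m)
  simp only [Function.comp_apply] at h
  change Stirling.stirlingSeq (m + 1) ≤ Stirling.stirlingSeq 1 at h
  rw [Stirling.stirlingSeq_one, Stirling.stirlingSeq, div_le_iff₀ (by positivity)] at h
  refine h.trans_eq ?_
  rw [sqrt_mul (by norm_num)]
  field_simp

/-- A lower bound for the binomial distribution with parameters `m + k` and `m / (m + k)` at its
mean `m`. -/
lemma sqrt_le_choose_mul_pow (m k : ℕ) (hm : 0 < m) (hk : 0 < k) {p q : ℝ}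
    (hp : p = m / (m + k)) (hq : q = k / (m + k)) :
    √(1 / ((m + k) * (p * q))) ≤ 10 * (((m + k).choose m : ℝ) * p ^ m * q ^ k) := by
  have hm' : (0 : ℝ) < m := by exact_mod_cast hm
  have hk' : (0 : ℝ) < k := by exact_mod_cast hk
  have hfm := factorial_le_exp_mul_sqrt_mul_pow m hm
  have hfk := factorial_le_exp_mul_sqrt_mul_pow k hk
  have hfs := Stirling.le_factorial_stirling (m + k)
  push_cast at hfs
  have hch : ((m + k).choose m : ℝ) * (m.factorial * k.factorial) = (m + k).factorial := by
    rw [← mul_assoc]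
    exact_mod_cast Nat.choose_symm_add (a := m) (b := k) ▸ Nat.add_choose_mul_factorial_mul_factorial m k
  set e := rexp 1
  have he : 0 < e := exp_pos 1
  have he3 : e ≤ 3 := (exp_one_lt_d9.trans (by norm_num)).le
  set C : ℝ := ((m + k).choose m : ℝ)
  have hlow : √(2 * π * (m + k)) * ((m + k) / e) ^ (m + k)
      ≤ C * ((e * √m * (m / e) ^ m) * (e * √k * (k / e) ^ k)) := by
    refine hfs.trans (hch.symm.le.trans ?_)
    gcongr
  have hlow' : √(2 * π * (m + k)) ≤ C * (e ^ 2 * (√m * √k) * (p ^ m * q ^ k)) := by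
    refine le_of_mul_le_mul_right (hlow.trans_eq ?_)
      (show 0 < ((m + k) / e : ℝ) ^ (m + k) by positivity)
    have h1 : (m / e : ℝ) = p * ((m + k) / e) := by rw [hp]; field_simp
    have h2 : (k / e : ℝ) = q * ((m + k) / e) := by rw [hq]; field_simp
    rw [h1, h2, mul_pow, mul_pow, pow_add]
    ring
  have hsq : √(1 / ((m + k) * (p * q))) * (√m * √k) = √(m + k : ℝ) := by
    rw [← sqrt_mul hm'.le, ← sqrt_mul (by rw [hp, hq]; positivity)]
    congr 1
    rw [hp, hq]
    field_simp
  have hpi : 2 * √(m + k : ℝ) ≤ √(2 * π * (m + k)) := by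
    rw [show (2 : ℝ) = √(2 ^ 2) from (sqrt_sq (by norm_num)).symm, ← sqrt_mul (by norm_num),
      sqrt_sq (by norm_num)]
    refine sqrt_le_sqrt ?_
    nlinarith [pi_gt_three]
  have hw : 0 ≤ C * (p ^ m * q ^ k) * (√m * √k) := by rw [hp, hq]; positivity
  refine le_of_mul_le_mul_right ?_ (show 0 < √(m : ℝ) * √k by positivity)
  rw [hsq]
  nlinarith [mul_le_mul_of_nonneg_right (show e ^ 2 ≤ 9 by nlinarith) hw]

/-- Hypergeometric pmf bound: for positive integers `a, b` with `s = a + b`, and integers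
`x, y` with `0 ≤ y ≤ x` and `1 ≤ x ≤ s - 1`, one has
`C(a,y) C(b,x-y) / C(s,x) ≤ 10 √(s³ / (x (s-x) a b))`. -/
theorem hypergeometric_pmf_bound (a b : ℕ) (ha : 0 < a) (hb : 0 < b)
    (x y : ℕ) (hyx : y ≤ x) (hx1 : 1 ≤ x) (hx : x ≤ a + b - 1) :
    (a.choose y : ℝ) * (b.choose (x - y) : ℝ) / ((a + b).choose x : ℝ)
      ≤ 10 * Real.sqrt (((a : ℝ) + b) ^ 3
          / ((x : ℝ) * (((a : ℝ) + b) - x) * a * b)) := by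
  by_cases hya : y ≤ a
  swap
  · rw [Nat.choose_eq_zero_of_lt (not_le.1 hya)]
    simp
  by_cases hyb : x - y ≤ b
  swap
  · rw [Nat.choose_eq_zero_of_lt (not_le.1 hyb)]
    simp
  obtain ⟨k, hk⟩ : ∃ k, a + b = x + k := ⟨a + b - x, by omega⟩
  have hk0 : 0 < k := by omega
  have hs : (a : ℝ) + b = x + k := by exact_mod_cast hk
  have ha' : (0 : ℝ) < a := by exact_mod_cast ha
  have hb' : (0 : ℝ) < b := by exact_mod_cast hb
  have hx' : (0 : ℝ) < x := by exact_mod_cast hx1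
  have hk' : (0 : ℝ) < k := by exact_mod_cast hk0
  obtain ⟨p, hp⟩ : ∃ p : ℝ, p = x / (x + k) := ⟨_, rfl⟩
  obtain ⟨q, hq⟩ : ∃ q : ℝ, q = k / (x + k) := ⟨_, rfl⟩
  have hp0 : 0 < p := by rw [hp]; positivity
  have hq0 : 0 < q := by rw [hq]; positivity
  have hpq : p + q = 1 := by rw [hp, hq]; field_simp
  have hA := choose_mul_pow_le a y ha hya hp0 hq0 hpq
  have hB := choose_mul_pow_le b (x - y) hb hyb hp0 hq0 hpq
  have hS := sqrt_le_choose_mul_pow x k hx1 hk0 hp hq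
  have hAB := mul_le_mul hA hB (by positivity) (sqrt_nonneg _)
  rw [hk, hs, add_sub_cancel_left]
  have hC : 0 < ((x + k).choose x : ℝ) := by exact_mod_cast Nat.choose_pos (Nat.le_add_right x k)
  have hw : 0 < p ^ x * q ^ k := by positivity
  have hroot : √(1 / (a * (p * q))) * √(1 / (b * (p * q)))
      = √(((x : ℝ) + k) ^ 3 / (x * k * a * b)) * √(1 / ((x + k) * (p * q))) := by
    rw [← sqrt_mul (by positivity), ← sqrt_mul (by positivity)]
    congr 1
    rw [hp, hq]
    field_simp
  rw [div_le_iff₀ hC]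
  refine le_of_mul_le_mul_right ?_ hw
  calc (a.choose y : ℝ) * (b.choose (x - y) : ℝ) * (p ^ x * q ^ k)
      = (a.choose y * p ^ y * q ^ (a - y))
        * (b.choose (x - y) * p ^ (x - y) * q ^ (b - (x - y))) := by
        rw [show p ^ x = p ^ y * p ^ (x - y) by rw [← pow_add]; congr 1; omega,
          show q ^ k = q ^ (a - y) * q ^ (b - (x - y)) by rw [← pow_add]; congr 1; omega]
        ring
    _ ≤ √(((x : ℝ) + k) ^ 3 / (x * k * a * b)) * √(1 / ((x + k) * (p * q))) :=
        hAB.trans_eq hroot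
    _ ≤ √(((x : ℝ) + k) ^ 3 / (x * k * a * b))
        * (10 * ((x + k).choose x * p ^ x * q ^ k)) :=
        mul_le_mul_of_nonneg_left hS (sqrt_nonneg _)
    _ = 10 * √(((x : ℝ) + k) ^ 3 / (x * k * a * b)) * ((x + k).choose x) * (p ^ x * q ^ k) := by
        ring
end

section
/- Let N ≥ 1 be an integer and let ω : {1, 2, …, N} → ℤ be injective. Then Σ_{1 ≤ a < b ≤ N} 1/|ω(a) − ω(b)| ≤ N · Σ_{j=1}^{N} 1/j. -/
/-- A sum of reciprocals of distinct positive integers is at most the harmonic number of the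
same length. -/
theorem sum_one_div_le_harmonic_card (S : Finset ℕ) (hS : ∀ s ∈ S, 1 ≤ s) :
    ∑ s ∈ S, (1 : ℝ) / (s : ℝ) ≤ ∑ j ∈ Finset.Icc 1 S.card, (1 : ℝ) / (j : ℝ) := by
  induction S using Finset.induction_on_max with
  | empty => simp
  | insert m S hm ih =>
    have hmS : m ∉ S := fun h => lt_irrefl _ (hm m h)
    have hcard : S.card + 1 ≤ m := by
      have hsub : S ⊆ Finset.Ico 1 m := fun x hx =>
        Finset.mem_Ico.2 ⟨hS x (Finset.mem_insert_of_mem hx), hm x hx⟩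
      have hle := Finset.card_le_card hsub
      have hpos := hS m (Finset.mem_insert_self m S)
      rw [Nat.card_Ico] at hle
      omega
    rw [Finset.sum_insert hmS, Finset.card_insert_of_notMem hmS,
      Finset.sum_Icc_succ_top (by omega), add_comm]
    refine add_le_add (ih fun s hs => hS s (Finset.mem_insert_of_mem hs)) ?_
    exact one_div_le_one_div_of_le (by positivity) (by exact_mod_cast hcard)

/-- A symmetric function has the same sum over the pairs increasing in the index order and over
the pairs increasing under an injective map to a linear order. -/
theorem sum_filter_lt_eq_sum_filter_map_lt {ι α M : Type*} [Fintype ι] [LinearOrder ι]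
    [LinearOrder α] [AddCommMonoid M] (g : ι → α) (hg : Function.Injective g) (f : ι × ι → M)
    (hf : ∀ q, f q.swap = f q) :
    ∑ q ∈ Finset.univ.filter (fun q : ι × ι => q.1 < q.2), f q =
      ∑ q ∈ Finset.univ.filter (fun q : ι × ι => g q.1 < g q.2), f q := by
  have hne : ∀ a b, g a = g b → a = b := fun a b h => hg h
  refine Finset.sum_nbij' (fun q => if g q.1 < g q.2 then q else q.swap)
    (fun q => if q.1 < q.2 then q else q.swap) ?_ ?_ ?_ ?_ ?_
  · rintro ⟨a, b⟩ h
    grind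
  · rintro ⟨a, b⟩ h
    grind
  · rintro ⟨a, b⟩ h
    grind
  · rintro ⟨a, b⟩ h
    grind
  · rintro q -
    grind

/-- The reciprocals of the distances from `x` to the larger values of an injective integer
sequence of length `N` sum to at most the `N`-th harmonic number. -/
theorem sum_one_div_sub_le_harmonic (N : ℕ) (ω : Fin N → ℤ) (hω : Function.Injective ω) (x : ℤ) :
    ∑ b ∈ Finset.univ.filter (fun b => x < ω b), (1 : ℝ) / |(x : ℝ) - (ω b : ℝ)| ≤
      ∑ j ∈ Finset.Icc 1 N, (1 : ℝ) / (j : ℝ) := by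
  set T := Finset.univ.filter (fun b => x < ω b) with hT
  have hmem : ∀ b ∈ T, x < ω b := fun b hb => (Finset.mem_filter.1 hb).2
  have hinj : Set.InjOn (fun b => (ω b - x).toNat) T := by
    intro b hb c hc h
    have := hmem b hb
    have := hmem c hc
    apply hω
    simp only at h
    omega
  calc ∑ b ∈ T, (1 : ℝ) / |(x : ℝ) - (ω b : ℝ)|
      = ∑ s ∈ T.image (fun b => (ω b - x).toNat), (1 : ℝ) / (s : ℝ) := by
        rw [Finset.sum_image hinj]
        refine Finset.sum_congr rfl fun b hb => ?_
        have h := hmem b hb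
        have hcast : (((ω b - x).toNat : ℕ) : ℝ) = (ω b : ℝ) - x := by
          have hz : (((ω b - x).toNat : ℕ) : ℤ) = ω b - x := Int.toNat_of_nonneg (by omega)
          exact_mod_cast hz
        have hlt : (x : ℝ) < ω b := by exact_mod_cast h
        rw [hcast, abs_sub_comm, abs_of_pos (sub_pos.2 hlt)]
    _ ≤ ∑ j ∈ Finset.Icc 1 (T.image (fun b => (ω b - x).toNat)).card, (1 : ℝ) / (j : ℝ) := by
        apply sum_one_div_le_harmonic_card
        intro s hs
        obtain ⟨b, hb, rfl⟩ := Finset.mem_image.1 hs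
        have := hmem b hb
        omega
    _ ≤ ∑ j ∈ Finset.Icc 1 N, (1 : ℝ) / (j : ℝ) := by
        refine Finset.sum_le_sum_of_subset_of_nonneg (Finset.Icc_subset_Icc_right ?_)
          fun _ _ _ => by positivity
        exact Finset.card_image_le.trans ((Finset.card_le_univ T).trans_eq (Fintype.card_fin N))

/-- If `ω : {1, …, N} → ℤ` is injective, then
`∑_{1 ≤ a < b ≤ N} 1 / |ω(a) - ω(b)| ≤ N ∑_{j=1}^{N} 1/j`. -/
theorem injective_weights_reciprocal_sum (N : ℕ) (hN : 1 ≤ N)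
    (ω : Fin N → ℤ) (hω : Function.Injective ω) :
    ∑ q ∈ Finset.univ.filter (fun q : Fin N × Fin N => q.1 < q.2),
        (1 : ℝ) / |(ω q.1 : ℝ) - (ω q.2 : ℝ)|
      ≤ (N : ℝ) * ∑ j ∈ Finset.Icc 1 N, (1 : ℝ) / (j : ℝ) := by
  rw [sum_filter_lt_eq_sum_filter_map_lt ω hω _ fun q => by
    rw [Prod.fst_swap, Prod.snd_swap, abs_sub_comm], Finset.sum_filter, Fintype.sum_prod_type]
  simp only [← Finset.sum_filter]
  calc _ ≤ ∑ _a : Fin N, ∑ j ∈ Finset.Icc 1 N, (1 : ℝ) / (j : ℝ) :=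
        Finset.sum_le_sum fun a _ => sum_one_div_sub_le_harmonic N ω hω (ω a)
    _ = _ := by rw [Finset.sum_const, Finset.card_univ, Fintype.card_fin, nsmul_eq_mul]
end

section
/- Let G be a graph and let U and W be disjoint subsets of its vertex set. Suppose there are real numbers l and D with D ≥ 0 such that l ≤ deg_U(x) ≤ l + D for every x ∈ W, and suppose l > |W|·D + |W|². Then for all subsets Z₁, Z₂ ⊆ W with |Z₁| < |Z₂|, one has e(G[U ∪ Z₁]) < e(G[U ∪ Z₂]). -/
/-- The degree of the vertex `x` into the set `U`, i.e. `|Γ(x) ∩ U|`. -/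
noncomputable def degIn {V : Type*} (G : SimpleGraph V) (U : Set V) (x : V) : ℕ :=
  (G.neighborSet x ∩ U).ncard

theorem inducedEdges_eq_ncard_edges_within {V : Type*} (G : SimpleGraph V) (S : Set V) :
    inducedEdges G S = {e ∈ G.edgeSet | ∀ v ∈ e, v ∈ S}.ncard := by
  have h : Sym2.map ((↑) : S → V) '' (G.induce S).edgeSet =
      {e ∈ G.edgeSet | ∀ v ∈ e, v ∈ S} := by
    ext e
    constructor
    · rintro ⟨f, hf, rfl⟩
      induction f with
      | _ a b => simpa using hf
    · induction e with
      | _ a b =>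
        rintro ⟨he, hS⟩
        exact ⟨s(⟨a, hS a (by simp)⟩, ⟨b, hS b (by simp)⟩), by simpa using he, by simp⟩
  rw [inducedEdges, ← h,
    Set.ncard_image_of_injective _ (Sym2.map.injective Subtype.val_injective)]

theorem inducedEdges_insert_s12 {V : Type*} [Finite V] (G : SimpleGraph V) {S : Set V} {x : V}
    (hx : x ∉ S) : inducedEdges G (insert x S) = inducedEdges G S + degIn G S x := by
  have h : {e ∈ G.edgeSet | ∀ v ∈ e, v ∈ insert x S} =
      {e ∈ G.edgeSet | ∀ v ∈ e, v ∈ S} ∪ (fun y => s(x, y)) '' (G.neighborSet x ∩ S) := by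
    ext e
    induction e with
    | _ a b =>
      have hne : ¬ G.Adj x x := G.irrefl
      have hsymm := G.adj_comm a b
      simp only [Set.mem_ofPred_eq, SimpleGraph.mem_edgeSet, Sym2.mem_iff, forall_eq_or_imp,
        forall_eq, Set.mem_insert_iff, Set.mem_union, Set.mem_image, Set.mem_inter_iff,
        SimpleGraph.mem_neighborSet, Sym2.eq_iff]
      grind
  have hdisj : Disjoint {e ∈ G.edgeSet | ∀ v ∈ e, v ∈ S}
      ((fun y => s(x, y)) '' (G.neighborSet x ∩ S)) := by
    rw [Set.disjoint_left]
    rintro _ ⟨-, he⟩ ⟨y, -, rfl⟩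
    exact hx (he x (Sym2.mem_mk_left x y))
  have hinj : Function.Injective fun y => s(x, y) := fun _ _ => Sym2.congr_right.mp
  rw [inducedEdges_eq_ncard_edges_within, inducedEdges_eq_ncard_edges_within, h,
    Set.ncard_union_eq hdisj, Set.ncard_image_of_injective _ hinj, degIn]

theorem degIn_le_degIn_union {V : Type*} [Finite V] (G : SimpleGraph V) (U Z : Set V) (x : V) :
    degIn G U x ≤ degIn G (U ∪ Z) x :=
  Set.ncard_le_ncard (Set.inter_subset_inter_right _ Set.subset_union_left)

theorem degIn_union_le {V : Type*} [Finite V] (G : SimpleGraph V) (U Z : Set V) (x : V) :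
    degIn G (U ∪ Z) x ≤ degIn G U x + Z.ncard := by
  rw [degIn, Set.inter_union_distrib_left]
  exact (Set.ncard_union_le _ _).trans
    (Nat.add_le_add_left (Set.ncard_le_ncard Set.inter_subset_right) _)

theorem inducedEdges_union_bounds {V : Type*} [Finite V] (G : SimpleGraph V) {U W : Set V}
    (hUW : Disjoint U W) {a b : ℝ}
    (hdeg : ∀ x ∈ W, a ≤ (degIn G U x : ℝ) ∧ (degIn G U x : ℝ) ≤ b) {Z : Set V} (hZ : Z ⊆ W) :
    inducedEdges G U + Z.ncard * a ≤ (inducedEdges G (U ∪ Z) : ℝ) ∧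
      (inducedEdges G (U ∪ Z) : ℝ) ≤ inducedEdges G U + Z.ncard * (b + W.ncard) := by
  induction Z, Z.toFinite using Set.Finite.induction_on with
  | empty => simp
  | @insert x Z hxZ _ ih =>
    obtain ⟨hxW, hZW⟩ := Set.insert_subset_iff.mp hZ
    obtain ⟨ih₁, ih₂⟩ := ih hZW
    obtain ⟨hx₁, hx₂⟩ := hdeg x hxW
    have hx : x ∉ U ∪ Z := by
      rintro (h | h)
      · exact hUW.notMem_of_mem_left h hxW
      · exact hxZ h
    have h₁ : (degIn G U x : ℝ) ≤ degIn G (U ∪ Z) x := mod_cast degIn_le_degIn_union G U Z x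
    have h₂ : (degIn G (U ∪ Z) x : ℝ) ≤ degIn G U x + Z.ncard :=
      mod_cast degIn_union_le G U Z x
    have h₃ : (Z.ncard : ℝ) ≤ W.ncard := mod_cast Set.ncard_le_ncard hZW
    rw [Set.union_insert, inducedEdges_insert_s12 G hx, Set.ncard_insert_of_notMem hxZ]
    push_cast
    constructor <;> linarith

/-- If `U` and `W` are disjoint vertex sets of a graph `G`, `l ≤ deg_U(x) ≤ l + D` for all
`x ∈ W` with `D ≥ 0`, and `l > |W| D + |W|²`, then subsets `Z₁, Z₂ ⊆ W` with `|Z₁| < |Z₂|`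
satisfy `e(G[U ∪ Z₁]) < e(G[U ∪ Z₂])`. -/
theorem monotone_sizes_of_large_degrees {V : Type*} [Fintype V] (G : SimpleGraph V)
    (U W : Set V) (hUW : Disjoint U W) (l D : ℝ) (hD : 0 ≤ D)
    (hdeg : ∀ x ∈ W, l ≤ (degIn G U x : ℝ) ∧ (degIn G U x : ℝ) ≤ l + D)
    (hl : (W.ncard : ℝ) * D + (W.ncard : ℝ) ^ 2 < l) :
    ∀ Z₁ Z₂ : Set V, Z₁ ⊆ W → Z₂ ⊆ W → Z₁.ncard < Z₂.ncard →
      inducedEdges G (U ∪ Z₁) < inducedEdges G (U ∪ Z₂) := by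
  intro Z₁ Z₂ hZ₁ hZ₂ hlt
  have hupper := (inducedEdges_union_bounds G hUW hdeg hZ₁).2
  have hlower := (inducedEdges_union_bounds G hUW hdeg hZ₂).1
  have hcard : (Z₁.ncard : ℝ) + 1 ≤ Z₂.ncard := mod_cast hlt
  have hle : (Z₁.ncard : ℝ) ≤ W.ncard := mod_cast Set.ncard_le_ncard hZ₁
  have hW : (0 : ℝ) ≤ W.ncard := Nat.cast_nonneg _
  have hlpos : 0 ≤ l := le_trans (by positivity) hl.le
  have hl_mul := mul_le_mul_of_nonneg_right hcard hlpos
  have hD_mul := mul_le_mul_of_nonneg_right hle (add_nonneg hD hW)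
  have hfinal : (inducedEdges G (U ∪ Z₁) : ℝ) < inducedEdges G (U ∪ Z₂) := by linarith
  exact_mod_cast hfinal
end

section
/- For all real numbers δ > 0 and c with 0 < c ≤ 1, the following holds for all sufficiently large n ∈ ℕ. Let m be a real number with m ≥ cn/4, and let Δ₁, Δ₂, Δ₃ be real numbers with 0 < |Δ₁| ≤ n^{1+δ}. Then the number of integer pairs (k, i) satisfying cn/20 ≤ k ≤ cn/10, cn/50 ≤ i ≤ cn/25 and |Δ₁ + (k/m)·Δ₂ + (i/m)·Δ₃| < n^{1/2+δ} is at most 4n^{5/2+δ}/|Δ₁|. -/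
/-- A finite set of integers of diameter at most `L` has at most `L + 1` elements. -/
theorem Finset.card_int_le_of_sub_le (s : Finset ℤ) (L : ℝ) (hL : 0 ≤ L)
    (h : ∀ x ∈ s, ∀ y ∈ s, (x : ℝ) - y ≤ L) : (s.card : ℝ) ≤ L + 1 := by
  rcases s.eq_empty_or_nonempty with rfl | hs
  · simp; linarith
  · have hsub : s ⊆ Finset.Icc (s.min' hs) (s.max' hs) := fun x hx =>
      Finset.mem_Icc.2 ⟨s.min'_le x hx, s.le_max' x hx⟩
    have hcard := Finset.card_le_card hsub
    rw [Int.card_Icc] at hcard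
    have hle : s.min' hs ≤ s.max' hs := s.min'_le_max' hs
    have hcard' : (s.card : ℤ) ≤ s.max' hs + 1 - s.min' hs := by omega
    have hreal : (s.card : ℝ) ≤ s.max' hs + 1 - s.min' hs := by exact_mod_cast hcard'
    linarith [h _ (s.max'_mem hs) _ (s.min'_mem hs)]

/-- If `g` has diameter at most `A` on `S` and `f` has diameter at most `B` on each fibre of `g`
in `S`, and `(f, g)` separates points, then `S` has at most `(A + 1) * (B + 1)` elements. -/
theorem Set.ncard_le_of_fiber_sub_le {α : Type*} (S : Set α) (f g : α → ℤ)
    (hfg : ∀ x y, f x = f y → g x = g y → x = y) (A B : ℝ) (hA : 0 ≤ A) (hB : 0 ≤ B)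
    (hg : ∀ x ∈ S, ∀ y ∈ S, (g x : ℝ) - g y ≤ A)
    (hf : ∀ x ∈ S, ∀ y ∈ S, g x = g y → (f x : ℝ) - f y ≤ B) :
    (S.ncard : ℝ) ≤ (A + 1) * (B + 1) := by
  classical
  rcases S.finite_or_infinite with hS | hS
  · lift S to Finset α using hS
    rw [Set.ncard_coe_finset, Finset.card_eq_sum_card_image g S]
    push_cast
    have hfiber : ∀ b ∈ S.image g, ((S.filter (fun x => g x = b)).card : ℝ) ≤ B + 1 := by
      intro b _
      rw [← Finset.card_image_of_injOn (f := f)]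
      · refine Finset.card_int_le_of_sub_le _ B hB ?_
        simp only [Finset.mem_image, Finset.mem_filter]
        rintro _ ⟨x, ⟨hx, hxb⟩, rfl⟩ _ ⟨y, ⟨hy, hyb⟩, rfl⟩
        exact hf x hx y hy (hxb.trans hyb.symm)
      · intro x hx y hy hxy
        simp only [Finset.coe_filter, Set.mem_ofPred_eq] at hx hy
        exact hfg x y hxy (hx.2.trans hy.2.symm)
    have himage : ((S.image g).card : ℝ) ≤ A + 1 := by
      refine Finset.card_int_le_of_sub_le _ A hA ?_
      simp only [Finset.mem_image]
      rintro _ ⟨x, hx, rfl⟩ _ ⟨y, hy, rfl⟩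
      exact hg x hx y hy
    refine (Finset.sum_le_card_nsmul _ _ _ hfiber).trans ?_
    rw [nsmul_eq_mul]
    gcongr
  · rw [hS.ncard]
    push_cast
    positivity

/-- If two values of an affine function with slope `b` both have absolute value less than `T`, and
the slope is at least `5 * d / (2 * n)`, then the arguments are at distance at most
`4 * (n * T / d) / 5`. -/
theorem sub_le_of_abs_affine_lt {n T d a b x y : ℝ} (hn : 0 < n) (hd : 0 < d)
    (hb : 5 * d ≤ 2 * n * |b|) (hx : |a + x * b| < T) (hy : |a + y * b| < T) :
    x - y ≤ 4 * (n * T / d) / 5 := by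
  have hdiff : |x - y| * |b| ≤ 2 * T := by
    rw [← abs_mul, show (x - y) * b = (a + x * b) - (a + y * b) by ring]
    linarith [abs_sub (a + x * b) (a + y * b)]
  have hmul : |x - y| * (5 * d) ≤ |x - y| * (2 * n * |b|) := by gcongr
  have hscale : n * (|x - y| * |b|) ≤ n * (2 * T) := by gcongr
  rw [show 4 * (n * T / d) / 5 = 4 * n * T / (5 * d) by field_simp]
  refine (le_abs_self _).trans ?_
  rw [le_div_iff₀ (by positivity)]
  linarith

/-- If `0 ≤ k ≤ n / 10` and `d ≤ 4 * |k * b|`, then `|b|` is at least `5 * d / (2 * n)`. -/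
theorem le_mul_abs_of_le_abs_mul {n d k b : ℝ} (hk0 : 0 ≤ k) (hk : k ≤ n / 10)
    (h : d ≤ 4 * |k * b|) : 5 * d ≤ 2 * n * |b| := by
  rw [abs_mul, abs_of_nonneg hk0] at h
  nlinarith [mul_le_mul_of_nonneg_right hk (abs_nonneg b)]

/-- Counting lattice points of the box `[cn/20, cn/10] × [cn/50, cn/25]` in the strip
`|a + k * u + i * v| < T`. -/
theorem ncard_lattice_strip_le {n c T a u v : ℝ} (hn : 2 ≤ n) (hc : 0 < c) (hc1 : c ≤ 1)
    (ha : 0 < |a|) (haT : |a| ≤ n * T) :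
    (({q : ℤ × ℤ |
        c * n / 20 ≤ (q.1 : ℝ) ∧ (q.1 : ℝ) ≤ c * n / 10 ∧
        c * n / 50 ≤ (q.2 : ℝ) ∧ (q.2 : ℝ) ≤ c * n / 25 ∧
        |a + q.1 * u + q.2 * v| < T}).ncard : ℝ) ≤ 4 * n * (n * T / |a|) := by
  set S := {q : ℤ × ℤ |
        c * n / 20 ≤ (q.1 : ℝ) ∧ (q.1 : ℝ) ≤ c * n / 10 ∧
        c * n / 50 ≤ (q.2 : ℝ) ∧ (q.2 : ℝ) ≤ c * n / 25 ∧
        |a + q.1 * u + q.2 * v| < T} with hS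
  have hn0 : 0 < n := by linarith
  have hcn : c * n ≤ n := mul_le_of_le_one_left hn0.le hc1
  have hcn0 : 0 < c * n := by positivity
  set X := n * T / |a| with hX
  have hX1 : 1 ≤ X := (one_le_div ha).2 haT
  have hfst : ∀ x ∈ S, ∀ y ∈ S, (x.1 : ℝ) - y.1 ≤ n / 20 := by
    rintro x ⟨_, hx, _⟩ y ⟨hy, _⟩
    linarith
  have hsnd : ∀ x ∈ S, ∀ y ∈ S, (x.2 : ℝ) - y.2 ≤ n / 20 := by
    rintro x ⟨_, _, _, hx, _⟩ y ⟨_, _, hy, _⟩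
    linarith
  have hfinal : (n / 20 + 1) * (4 * X / 5 + 1) ≤ 4 * n * X := by
    have hfac : (n / 20 + 1) * (4 * X / 5 + 1) ≤ n * (2 * X) := by
      gcongr <;> linarith
    nlinarith [mul_pos hn0 (show 0 < X by linarith)]
  by_cases hlarge : |a| ≤ 2 * T
  · refine (Set.ncard_le_of_fiber_sub_le S Prod.fst Prod.snd (fun x y => Prod.ext) (n / 20) (n / 20)
      (by positivity) (by positivity) hsnd (fun x hx y hy _ => hfst x hx y hy)).trans ?_
    have hXn : n / 2 ≤ X := by
      rw [hX, le_div_iff₀ ha]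
      nlinarith
    have hfac : (n / 20 + 1) * (n / 20 + 1) ≤ n * n := by
      gcongr <;> linarith
    nlinarith
  · push Not at hlarge
    rcases S.eq_empty_or_nonempty with hempty | ⟨p, hp1, hp2, hp3, hp4, hp5⟩
    · rw [hempty, Set.ncard_empty, Nat.cast_zero]
      positivity
    · have hslope : 5 * |a| ≤ 2 * n * |u| ∨ 5 * |a| ≤ 2 * n * |v| := by
        by_cases hu : |a| ≤ 4 * |(p.1 : ℝ) * u|
        · exact Or.inl (le_mul_abs_of_le_abs_mul (by linarith) (by linarith) hu)
        · refine Or.inr (le_mul_abs_of_le_abs_mul (k := p.2) (by linarith) (by linarith) ?_)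
          have habs : |a| ≤ |a + p.1 * u + p.2 * v| + |p.1 * u| + |p.2 * v| := by
            calc |a| = |(a + p.1 * u + p.2 * v) - p.1 * u - p.2 * v| := by ring_nf
              _ ≤ _ := (abs_sub _ _).trans (by gcongr; exact abs_sub _ _)
          linarith
      rcases hslope with hu | hv
      · refine (Set.ncard_le_of_fiber_sub_le S Prod.fst Prod.snd (fun x y => Prod.ext)
          (n / 20) (4 * X / 5) (by positivity) (by positivity) hsnd ?_).trans hfinal
        rintro x ⟨_, _, _, _, hx⟩ y ⟨_, _, _, _, hy⟩ hxy
        rw [← hxy] at hy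
        rw [add_right_comm] at hx hy
        exact sub_le_of_abs_affine_lt hn0 ha hu hx hy
      · refine (Set.ncard_le_of_fiber_sub_le S Prod.snd Prod.fst (fun x y h h' => Prod.ext h' h)
          (n / 20) (4 * X / 5) (by positivity) (by positivity) hfst ?_).trans hfinal
        rintro x ⟨_, _, _, _, hx⟩ y ⟨_, _, _, _, hy⟩ hxy
        rw [← hxy] at hy
        exact sub_le_of_abs_affine_lt hn0 ha hv hx hy

/-- Claim 9 (incompatible pairs): for any `δ > 0` and `0 < c ≤ 1`, for all sufficiently
large `n`, if `m ≥ cn/4` and `Δ₁, Δ₂, Δ₃` are reals with `0 < |Δ₁| ≤ n^{1+δ}`, then the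
number of integer pairs `(k, i)` with `cn/20 ≤ k ≤ cn/10`, `cn/50 ≤ i ≤ cn/25` and
`|Δ₁ + (k/m) Δ₂ + (i/m) Δ₃| < n^{1/2+δ}` is at most `4 n^{5/2+δ} / |Δ₁|`. -/
theorem incompatible_pairs_count (δ c : ℝ) (hδ : 0 < δ) (hc : 0 < c) (hc1 : c ≤ 1) :
    ∃ N : ℕ, ∀ n : ℕ, N ≤ n →
      ∀ m Δ₁ Δ₂ Δ₃ : ℝ, c * n / 4 ≤ m → 0 < |Δ₁| → |Δ₁| ≤ (n : ℝ) ^ ((1 : ℝ) + δ) →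
        (({q : ℤ × ℤ |
            c * n / 20 ≤ (q.1 : ℝ) ∧ (q.1 : ℝ) ≤ c * n / 10 ∧
            c * n / 50 ≤ (q.2 : ℝ) ∧ (q.2 : ℝ) ≤ c * n / 25 ∧
            |Δ₁ + ((q.1 : ℝ) / m) * Δ₂ + ((q.2 : ℝ) / m) * Δ₃|
              < (n : ℝ) ^ ((1 : ℝ) / 2 + δ)}).ncard : ℝ)
          ≤ 4 * (n : ℝ) ^ ((5 : ℝ) / 2 + δ) / |Δ₁| := by
  refine ⟨2, fun n hn m Δ₁ Δ₂ Δ₃ _ hpos hle => ?_⟩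
  have hn2 : (2 : ℝ) ≤ n := by exact_mod_cast hn
  have hn0 : (0 : ℝ) < n := by linarith
  have hT : (n : ℝ) ^ ((5 : ℝ) / 2 + δ) = n * (n * (n : ℝ) ^ ((1 : ℝ) / 2 + δ)) := by
    rw [show (5 : ℝ) / 2 + δ = 1 + (1 + (1 / 2 + δ)) by ring, Real.rpow_add hn0,
      Real.rpow_add hn0 1 (1 / 2 + δ), Real.rpow_one]
  have hle' : |Δ₁| ≤ n * (n : ℝ) ^ ((1 : ℝ) / 2 + δ) := by
    refine hle.trans ?_
    rw [← Real.rpow_one_add' hn0.le (by positivity)]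
    exact Real.rpow_le_rpow_of_exponent_le (by linarith) (by linarith)
  have hcount := ncard_lattice_strip_le (u := Δ₂ / m) (v := Δ₃ / m) hn2 hc hc1 hpos hle'
  rw [hT, show 4 * ((n : ℝ) * (n * (n : ℝ) ^ ((1 : ℝ) / 2 + δ))) / |Δ₁|
    = 4 * n * (n * (n : ℝ) ^ ((1 : ℝ) / 2 + δ) / |Δ₁|) by ring]
  simpa only [div_mul_eq_mul_div, mul_div_assoc] using hcount
end
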